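/- Let k ≥ 1 and m = 2k + 1, and let G ∈ ℝ[x₀,x₁,x₂,x₃] be a nonzero homogeneous polynomial of degree m whose image in the quotient ring ℂ[x₀,x₁,x₂,x₃]/(x₀²+x₁²+x₂²−x₃²) is a squarefree element (i.e., the curve C = {x₀²+x₁²+x₂²−x₃² = 0, G = 0} ⊂ ℙ³(ℂ), of bidegree (m,m) on the quadric ellipsoid, is reduced). If the set ℝC = {[x] ∈ ℙ³(ℝ) : x₀²+x₁²+x₂² = x₃² and G(x) = 0} is finite, then |ℝC| ≤ 3k² + 2k. -/

import Mathlib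

section Frozen
open MvPolynomial

/-- The quadric `x₀² + x₁² + x₂² − x₃²` over `ℂ`. -/
noncomputable def Qc : MvPolynomial (Fin 4) ℂ :=
  X 0 ^ 2 + X 1 ^ 2 + X 2 ^ 2 - X 3 ^ 2

/-- The image of `G` in the coordinate ring `ℂ[x₀,…,x₃]/(Q)` of the quadric ellipsoid
is a squarefree element. -/
noncomputable def SquarefreeOnEllipsoid (G : MvPolynomial (Fin 4) ℝ) : Prop :=
  Squarefree (Ideal.Quotient.mk (Ideal.span {Qc})
    (MvPolynomial.map (algebraMap ℝ ℂ) G))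

/-- The real point set of the curve cut out on the quadric ellipsoid by `G`:
points of `ℙ³(ℝ)` lying on the sphere `x₀² + x₁² + x₂² = x₃²` at which `G` vanishes. -/
noncomputable def sphereRZ (G : MvPolynomial (Fin 4) ℝ) :
    Set (Projectivization ℝ (Fin 4 → ℝ)) :=
  {x | x.rep 0 ^ 2 + x.rep 1 ^ 2 + x.rep 2 ^ 2 = x.rep 3 ^ 2 ∧
    MvPolynomial.eval x.rep G = 0}

end Frozen


namespace Ell
open Polynomial
open scoped Polynomial.Bivariate

section Syl
variable {R S : Type*} [CommRing R] [CommRing S]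

/-- The list of columns `w^s a`, `w^s b`, `F`. -/
noncomputable def cols (q : ℕ) (a b F : R[X][Y]) (c : ℕ) : R[X][Y] :=
  if c < q + 1 then X ^ c * a else if c < 2 * q + 3 then X ^ (c - (q + 1)) * b else F

/-- Sylvester type matrix. -/
noncomputable def sylM (q : ℕ) (a b F : R[X][Y]) :
    Matrix (Fin (2 * q + 4)) (Fin (2 * q + 4)) R[X] :=
  Matrix.of fun i c => (cols q a b F c).coeff i

noncomputable def sylP (q : ℕ) (a b F : R[X][Y]) : R[X] := (sylM q a b F).det

noncomputable def sylE (q : ℕ) (a b : R[X][Y]) : R[X][Y] :=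
  C (b.coeff (q + 2)) * X ^ (q + 1) * a - C (a.coeff (q + 3)) * X ^ (q + 2) * b

/-- the eliminant -/
noncomputable def elim (q : ℕ) (a b : R[X][Y]) : R[X] := sylP q a b (sylE q a b)

lemma cols_a (q : ℕ) (a b F : R[X][Y]) {c : ℕ} (h : c < q + 1) : cols q a b F c = X ^ c * a :=
  if_pos h

lemma cols_b (q : ℕ) (a b F : R[X][Y]) {c s : ℕ} (h : c = s + (q + 1)) (hs : s < q + 2) :
    cols q a b F c = X ^ s * b := by
  subst h
  rw [cols, if_neg (by omega), if_pos (by omega)]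
  simp

lemma cols_F (q : ℕ) (a b F : R[X][Y]) {c : ℕ} (h : c = 2 * q + 3) : cols q a b F c = F := by
  rw [cols, if_neg (by omega), if_neg (by omega)]

lemma sylM_updateCol (q : ℕ) (a b F : R[X][Y]) :
    sylM q a b F = (sylM q a b 0).updateCol (Fin.last (2 * q + 3)) (fun i => F.coeff i) := by
  ext1 i c
  rcases eq_or_ne c (Fin.last (2 * q + 3)) with rfl | h
  · simp [sylM, cols_F]
  · rw [Matrix.updateCol_ne h]
    have : (c : ℕ) < 2 * q + 3 := by
      have := c.2
      have h2 : (c : ℕ) ≠ 2 * q + 3 := fun h3 => h (Fin.ext (by simp [h3]))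
      omega
    simp [sylM, cols, this]

lemma sylP_eq (q : ℕ) (a b F : R[X][Y]) :
    sylP q a b F = ((sylM q a b 0).updateCol (Fin.last (2 * q + 3)) (fun i => F.coeff i)).det := by
  rw [sylP, sylM_updateCol]

/-- `F ↦ sylP q a b F` as a linear map. -/
noncomputable def sylL (q : ℕ) (a b : R[X][Y]) : R[X][Y] →ₗ[R[X]] R[X] where
  toFun F := sylP q a b F
  map_add' F G := by
    simp only [sylP_eq]
    rw [← Matrix.det_updateCol_add]
    congr 2
  map_smul' r F := by
    simp only [sylP_eq, RingHom.id_apply, smul_eq_mul]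
    rw [← Matrix.det_updateCol_smul]
    congr 2

lemma sylL_apply (q : ℕ) (a b F : R[X][Y]) : sylL q a b F = sylP q a b F := rfl

lemma sylP_col_a (q : ℕ) (a b : R[X][Y]) (s : ℕ) (hs : s < q + 1) :
    sylP q a b (X ^ s * a) = 0 := by
  unfold sylP
  apply Matrix.det_zero_of_column_eq (i := ⟨s, by omega⟩) (j := Fin.last (2 * q + 3))
  · intro h
    have := congrArg Fin.val h
    simp at this; omega
  · intro k
    simp [sylM, cols_a q a b _ hs, cols_F]

lemma sylP_col_b (q : ℕ) (a b : R[X][Y]) (s : ℕ) (hs : s < q + 2) :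
    sylP q a b (X ^ s * b) = 0 := by
  unfold sylP
  apply Matrix.det_zero_of_column_eq (i := ⟨s + (q + 1), by omega⟩) (j := Fin.last (2 * q + 3))
  · intro h
    have := congrArg Fin.val h
    simp at this; omega
  · intro k
    simp [sylM, cols_b q a b _ rfl hs, cols_F]

lemma sylP_map (φ : R →+* S) (q : ℕ) (a b F : R[X][Y]) :
    sylP q (a.map (mapRingHom φ)) (b.map (mapRingHom φ)) (F.map (mapRingHom φ))
      = (sylP q a b F).map φ := by
  unfold sylP
  rw [← coe_mapRingHom φ, RingHom.map_det]
  congr 1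
  ext1 i c
  simp only [sylM, cols, Matrix.of_apply, RingHom.mapMatrix_apply, Matrix.map_apply]
  split_ifs
  · rw [← coeff_map]; simp
  · rw [← coeff_map]; simp
  · rw [← coeff_map]

lemma elim_map (φ : R →+* S) (q : ℕ) (a b : R[X][Y]) :
    elim q (a.map (mapRingHom φ)) (b.map (mapRingHom φ)) = (elim q a b).map φ := by
  unfold elim
  rw [← sylP_map]
  congr 1
  simp [sylE]

/-- At a common zero, the functional `sylP` is a multiple of evaluation. -/
lemma sylP_eval_zero (q : ℕ) (a b F : R[X][Y]) (z w : R)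
    (ha : a.natDegree ≤ q + 3) (hb : b.natDegree ≤ q + 2) (hF : F.natDegree ≤ 2 * q + 3)
    (haz : a.evalEval z w = 0) (hbz : b.evalEval z w = 0) :
    (sylP q a b F).eval z = F.evalEval z w * (sylP q a b 1).eval z := by
  -- general: det after row operation
  have key : ∀ F : R[X][Y], F.natDegree ≤ 2 * q + 3 → (sylP q a b F).eval z =
      F.evalEval z w * ((-1) ^ (2 * q + 3) * (Matrix.det
        (((evalRingHom z).mapMatrix (sylM q a b 0)).submatrix Fin.succ
          (Fin.succAbove (Fin.last (2 * q + 3)))))) := by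
    intro F hF
    have hrow : ∀ c : Fin (2 * q + 4), (∑ i : Fin (2 * q + 4), w ^ (i : ℕ) *
        ((cols q a b F c).coeff i).eval z) = if c = Fin.last (2 * q + 3) then F.evalEval z w else 0 := by
      intro c
      have hd : ∀ p : R[X][Y], p.natDegree < 2 * q + 4 → (∑ i : Fin (2 * q + 4), w ^ (i : ℕ) *
        (p.coeff i).eval z) = p.evalEval z w := by
        intro p hp
        rw [evalEval, eval_eq_sum_range' hp, eval_finsetSum, Finset.sum_range]
        refine Finset.sum_congr rfl fun i _ => ?_
        simp [mul_comm]
      have hcd : (cols q a b F c).natDegree < 2 * q + 4 := by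
        unfold cols
        split_ifs with h1 h2
        · exact lt_of_le_of_lt natDegree_mul_le
            (by have := natDegree_X_pow_le (R := R[X]) (c : ℕ); omega)
        · exact lt_of_le_of_lt natDegree_mul_le
            (by have := natDegree_X_pow_le (R := R[X]) ((c : ℕ) - (q + 1)); omega)
        · omega
      rw [hd _ hcd]
      have hc := c.2
      split_ifs with h
      · subst h
        have h1 : ¬ (2 * q + 3 < q + 1) := by omega
        simp [cols, h1]
      · have h3 : (c : ℕ) < 2 * q + 3 := by
          have h2 : (c : ℕ) ≠ 2 * q + 3 := fun h3 => h (Fin.ext (by simp [h3]))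
          omega
        unfold cols
        split_ifs
        · rw [evalEval_mul, haz, mul_zero]
        · rw [evalEval_mul, hbz, mul_zero]
    unfold sylP
    rw [← coe_evalRingHom, RingHom.map_det]
    set A := (evalRingHom z).mapMatrix (sylM q a b F) with hA
    have h1 := Matrix.det_updateRow_sum A 0 (fun k => w ^ (k : ℕ))
    simp only [Fin.val_zero, pow_zero, one_smul] at h1
    rw [← h1, Matrix.det_succ_row_zero, Finset.sum_eq_single (Fin.last (2 * q + 3))]
    · rw [Matrix.updateRow_self]
      have := hrow (Fin.last (2 * q + 3))
      simp only [if_true] at this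
      rw [← this]
      have e1 : (∑ k, (fun k : Fin (2*q+4) => w ^ (k : ℕ)) k • A k) (Fin.last (2 * q + 3)) =
        ∑ i : Fin (2 * q + 4), w ^ (i : ℕ) * ((cols q a b F (Fin.last (2*q+3)).val).coeff i).eval z := by
        rw [Finset.sum_apply]
        refine Finset.sum_congr rfl fun i _ => ?_
        simp [hA, sylM]
      rw [e1]
      have e2 : (A.updateRow 0 (∑ k, (fun k : Fin (2*q+4) => w ^ (k : ℕ)) k • A k)).submatrix Fin.succ
          (Fin.last (2 * q + 3)).succAbove = ((evalRingHom z).mapMatrix (sylM q a b 0)).submatrix Fin.succ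
          (Fin.succAbove (Fin.last (2 * q + 3))) := by
        ext i j
        rw [Matrix.submatrix_apply, Matrix.updateRow_ne (Fin.succ_ne_zero i), hA, sylM_updateCol]
        simp
      rw [e2]
      simp only [Fin.val_last]
      ring
    · intro c _ hc
      rw [Matrix.updateRow_self]
      have := hrow c
      rw [if_neg hc] at this
      have e1 : (∑ k, (fun k : Fin (2*q+4) => w ^ (k : ℕ)) k • A k) c =
        ∑ i : Fin (2 * q + 4), w ^ (i : ℕ) * ((cols q a b F c).coeff i).eval z := by
        rw [Finset.sum_apply]
        refine Finset.sum_congr rfl fun i _ => ?_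
        simp [hA, sylM]
      rw [e1, this]; simp
    · simp
  rw [key F hF, key 1 (by simp)]
  simp

end Syl
end Ell

namespace Ell
open Polynomial
open scoped Polynomial.Bivariate

section DZ
variable {R : Type*} [CommRing R]

/-- partial derivative with respect to the inner variable -/
noncomputable def dz (p : R[X][Y]) : R[X][Y] :=
  ∑ j ∈ Finset.range (p.natDegree + 1), monomial j (derivative (p.coeff j))

lemma coeff_dz (p : R[X][Y]) (j : ℕ) : (dz p).coeff j = derivative (p.coeff j) := by
  unfold dz
  simp only [finsetSum_coeff, coeff_monomial]
  rw [Finset.sum_ite_eq' (Finset.range (p.natDegree + 1)) j]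
  split_ifs with h
  · rfl
  · rw [coeff_eq_zero_of_natDegree_lt]
    · simp
    · simp at h; omega

lemma dz_add (p r : R[X][Y]) : dz (p + r) = dz p + dz r := by
  ext1 j; simp [coeff_dz]

lemma dz_neg (p : R[X][Y]) : dz (-p) = - dz p := by
  ext1 j; simp [coeff_dz]

lemma dz_sub (p r : R[X][Y]) : dz (p - r) = dz p - dz r := by
  ext1 j; simp [coeff_dz]

lemma dz_mul (p r : R[X][Y]) : dz (p * r) = dz p * r + p * dz r := by
  ext1 j
  simp only [coeff_dz, coeff_mul, coeff_add, derivative_sum, derivative_mul,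
    Finset.sum_add_distrib]

lemma dz_C (p : R[X]) : dz (C p) = C (derivative p) := by
  ext1 j; simp only [coeff_dz, coeff_C]; split_ifs <;> simp

lemma dz_X : dz (X : R[X][Y]) = 0 := by
  ext1 j; simp only [coeff_dz, coeff_X]; split_ifs <;> simp

lemma dz_zero : dz (0 : R[X][Y]) = 0 := by
  ext1 j; simp [coeff_dz]

lemma dz_one : dz (1 : R[X][Y]) = 0 := by
  ext1 j; simp [coeff_dz, coeff_one]; split_ifs <;> simp

lemma dz_pow (p : R[X][Y]) (n : ℕ) : dz (p ^ (n + 1)) = (n + 1 : ℕ) * p ^ n * dz p := by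
  induction n with
  | zero => simp
  | succ n ih => rw [pow_succ, dz_mul, ih]; push_cast; ring

end DZ

section Fld
variable {K : Type*} [Field K]

lemma sylP_mul_a {R : Type*} [CommRing R] (q : ℕ) (a b U : R[X][Y]) (hU : U.natDegree < q + 1) :
    sylP q a b (U * a) = 0 := by
  rw [← sylL_apply, U.as_sum_range' _ hU, Finset.sum_mul, map_sum]
  refine Finset.sum_eq_zero fun s hs => ?_
  rw [← C_mul_X_pow_eq_monomial, mul_assoc, ← smul_eq_C_mul, map_smul, sylL_apply,
    sylP_col_a q a b s (Finset.mem_range.1 hs), smul_zero]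

lemma sylP_mul_b {R : Type*} [CommRing R] (q : ℕ) (a b U : R[X][Y]) (hU : U.natDegree < q + 2) :
    sylP q a b (U * b) = 0 := by
  rw [← sylL_apply, U.as_sum_range' _ hU, Finset.sum_mul, map_sum]
  refine Finset.sum_eq_zero fun s hs => ?_
  rw [← C_mul_X_pow_eq_monomial, mul_assoc, ← smul_eq_C_mul, map_smul, sylL_apply,
    sylP_col_b q a b s (Finset.mem_range.1 hs), smul_zero]

lemma sylE_natDegree {R : Type*} [CommRing R] (q : ℕ) (a b : R[X][Y])
    (ha : a.natDegree ≤ q + 3) (hb : b.natDegree ≤ q + 2) :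
    (sylE q a b).natDegree ≤ 2 * q + 3 := by
  rw [natDegree_le_iff_coeff_eq_zero]
  intro N hN
  obtain ⟨j, rfl⟩ : ∃ j, N = j + (2 * q + 4) := ⟨N - (2 * q + 4), by omega⟩
  have e1 : j + (2 * q + 4) = (j + (q + 3)) + (q + 1) := by omega
  have e2 : j + (2 * q + 4) = (j + (q + 2)) + (q + 2) := by omega
  rw [sylE, coeff_sub, mul_assoc, mul_assoc, coeff_C_mul, coeff_C_mul]
  nth_rewrite 1 [e1]
  rw [e2, coeff_X_pow_mul, coeff_X_pow_mul]
  rcases j with _ | j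
  · simp; ring
  · rw [coeff_eq_zero_of_natDegree_lt (p := a) (n := j + 1 + (q + 3)) (by omega),
      coeff_eq_zero_of_natDegree_lt (p := b) (n := j + 1 + (q + 2)) (by omega)]
    simp

lemma evalEval_eq_map {R : Type*} [CommRing R] (p : R[X][Y]) (z w : R) :
    p.evalEval z w = (p.map (evalRingHom z)).eval w := by
  rw [map_evalRingHom_eval]

/-- the Jacobian -/
noncomputable def jac (a b : K[X][Y]) (z w : K) : K :=
  (dz a).evalEval z w * (derivative b).evalEval z w
    - (derivative a).evalEval z w * (dz b).evalEval z w

lemma exists_quot (p : K[X]) (w : K) (d : ℕ) (hd : p.natDegree ≤ d + 1) (h : p.eval w = 0) :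
    ∃ r : K[X], p = (X - C w) * r ∧ r.natDegree ≤ d ∧ r.coeff d = p.coeff (d + 1) ∧
      r.eval w = (derivative p).eval w := by
  obtain ⟨r, hr⟩ := dvd_iff_isRoot.2 h
  have hdeg : r.natDegree ≤ d := by
    rcases eq_or_ne r 0 with rfl | h0
    · simp
    · rw [hr, natDegree_mul (X_sub_C_ne_zero w) h0, natDegree_X_sub_C] at hd
      omega
  refine ⟨r, hr, hdeg, ?_, ?_⟩
  · rw [hr, sub_mul, coeff_sub, coeff_X_mul, coeff_C_mul,
      coeff_eq_zero_of_natDegree_lt (p := r) (n := d + 1) (by omega)]; simp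
  · rw [hr]; simp

lemma elim_deriv (q : ℕ) (a b : K[X][Y]) (z w : K)
    (ha : a.natDegree ≤ q + 3) (hb : b.natDegree ≤ q + 2)
    (haz : a.evalEval z w = 0) (hbz : b.evalEval z w = 0) :
    (elim q a b).eval z = 0 ∧
    (derivative (elim q a b)).eval z = jac a b z w * (sylP q a b 1).eval z := by
  obtain ⟨A, hA, hAd, hAc, hAe⟩ := exists_quot (a.map (evalRingHom z)) w (q + 2)
    (natDegree_map_le.trans ha) (by rw [← evalEval_eq_map, haz])
  obtain ⟨B, hB, hBd, hBc, hBe⟩ := exists_quot (b.map (evalRingHom z)) w (q + 1)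
    (natDegree_map_le.trans hb) (by rw [← evalEval_eq_map, hbz])
  set u : K[X][Y] := (B - C (B.coeff (q + 1)) * X ^ (q + 1)).map C with hu
  set v : K[X][Y] := (- (A - C (A.coeff (q + 2)) * X ^ (q + 2))).map C with hv
  have hsubdeg : ∀ (p : K[X]) (d : ℕ), p.natDegree ≤ d + 1 →
      (p - C (p.coeff (d + 1)) * X ^ (d + 1)).natDegree < d + 1 := by
    intro p d hp
    rw [Nat.lt_succ_iff, natDegree_le_iff_coeff_eq_zero]
    intro N hN
    rw [coeff_sub, coeff_C_mul, coeff_X_pow]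
    split_ifs with h
    · subst h; simp
    · rw [coeff_eq_zero_of_natDegree_lt (by omega)]; simp
  have hud : u.natDegree < q + 1 := lt_of_le_of_lt natDegree_map_le (hsubdeg _ _ hBd)
  have hvd : v.natDegree < q + 2 := lt_of_le_of_lt natDegree_map_le
    (by rw [natDegree_neg]; exact hsubdeg _ _ hAd)
  set U : K[X][Y] := C (b.coeff (q + 2)) * X ^ (q + 1) + u with hU
  set V : K[X][Y] := - (C (a.coeff (q + 3)) * X ^ (q + 2)) + v with hV
  set e' : K[X][Y] := U * a + V * b with he'
  have hee : e' = sylE q a b + u * a + v * b := by rw [he', hU, hV, sylE]; ring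
  have hE : elim q a b = sylP q a b e' := by
    rw [hee, ← sylL_apply, map_add, map_add, sylL_apply, sylL_apply, sylL_apply,
      sylP_mul_a q a b u hud, sylP_mul_b q a b v hvd, elim, add_zero, add_zero]
  have hid : (evalRingHom z).comp (C : K →+* K[X]) = RingHom.id K := by
    ext; simp
  have hU0 : U.map (evalRingHom z) = B := by
    rw [hU, hu]
    simp [Polynomial.map_map, hid]
    rw [hBc]; simp
  have hV0 : V.map (evalRingHom z) = - A := by
    rw [hV, hv]
    simp [Polynomial.map_map, hid]
    rw [hAc]; simp; ring
  have he0 : e'.map (evalRingHom z) = 0 := by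
    rw [he', Polynomial.map_add, Polynomial.map_mul, Polynomial.map_mul, hU0, hV0, hA, hB]; ring
  have hdvd : C (X - C z) ∣ e' := by
    rw [C_dvd_iff_dvd_coeff]
    intro i
    rw [dvd_iff_isRoot]
    have := congrArg (fun p => p.coeff i) he0
    simpa using this
  obtain ⟨h, hh⟩ := hdvd
  have hedeg : e'.natDegree ≤ 2 * q + 3 := by
    rw [hee]
    refine natDegree_add_le_of_degree_le (natDegree_add_le_of_degree_le
      (sylE_natDegree q a b ha hb) ?_) ?_
    · exact natDegree_mul_le.trans (by omega)
    · exact natDegree_mul_le.trans (by omega)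
  have hhdeg : h.natDegree ≤ 2 * q + 3 := by
    rcases eq_or_ne h 0 with rfl | h0
    · simp
    · rw [hh, natDegree_mul (C_ne_zero.2 (X_sub_C_ne_zero z)) h0, natDegree_C, zero_add] at hedeg
      exact hedeg
  have hE2 : elim q a b = (X - C z) * sylP q a b h := by
    rw [hE, hh, ← sylL_apply, ← smul_eq_C_mul, map_smul, sylL_apply, smul_eq_mul]
  have hjac : h.evalEval z w = jac a b z w := by
    have h1 : (dz e').evalEval z w = h.evalEval z w := by
      rw [hh, dz_mul, dz_C]
      simp [evalEval_add, evalEval_mul, evalEval_C]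
    rw [← h1, he', dz_add, dz_mul, dz_mul]
    simp only [evalEval_add, evalEval_mul, haz, hbz]
    rw [evalEval_eq_map U, evalEval_eq_map V, hU0, hV0, eval_neg, hBe, hAe]
    rw [derivative_map, derivative_map, ← evalEval_eq_map, ← evalEval_eq_map, jac]
    ring
  rw [hE2]
  constructor
  · simp
  · simp only [derivative_mul, derivative_sub, derivative_X, derivative_C, eval_add, eval_mul,
      eval_sub, eval_X, eval_C, sub_self, zero_mul, add_zero, eval_one, sub_zero, one_mul]
    rw [sylP_eval_zero q a b h z w ha hb hhdeg haz hbz, hjac]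

end Fld
end Ell

namespace Ell
open Polynomial
open scoped Polynomial.Bivariate

section Cls
variable {R : Type*} [CommRing R]

/-- `p` has `z`-degree `≤ d`, `w`-degree `≤ e` and total degree `≤ t`. -/
def Cls (d e t : ℕ) (p : R[X][Y]) : Prop :=
  ∀ i j, (p.coeff j).coeff i ≠ 0 → i ≤ d ∧ j ≤ e ∧ i + j ≤ t

lemma Cls.mono {d e t d' e' t' : ℕ} {p : R[X][Y]} (h : Cls d e t p) (hd : d ≤ d') (he : e ≤ e')
    (ht : t ≤ t') : Cls d' e' t' p := fun i j hij => by
  have := h i j hij; omega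

lemma Cls.zero (d e t : ℕ) : Cls d e t (0 : R[X][Y]) := fun i j h => by simp at h

lemma Cls.add {d e t : ℕ} {p r : R[X][Y]} (hp : Cls d e t p) (hr : Cls d e t r) :
    Cls d e t (p + r) := fun i j h => by
  by_cases h1 : (p.coeff j).coeff i = 0
  · refine hr i j ?_
    rw [coeff_add, coeff_add, h1, zero_add] at h; exact h
  · exact hp i j h1

lemma Cls.neg {d e t : ℕ} {p : R[X][Y]} (hp : Cls d e t p) : Cls d e t (-p) := fun i j h =>
  hp i j (by simpa using h)

lemma Cls.sub {d e t : ℕ} {p r : R[X][Y]} (hp : Cls d e t p) (hr : Cls d e t r) :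
    Cls d e t (p - r) := by rw [sub_eq_add_neg]; exact hp.add hr.neg

lemma Cls.sum {ι : Type*} {d e t : ℕ} (s : Finset ι) (p : ι → R[X][Y])
    (hp : ∀ i ∈ s, Cls d e t (p i)) : Cls d e t (∑ i ∈ s, p i) := by
  classical
  induction s using Finset.induction_on with
  | empty => simpa using Cls.zero d e t
  | insert a s ha ih =>
    rw [Finset.sum_insert ha]
    exact (hp a (by simp)).add (ih fun i hi => hp i (by simp [hi]))

lemma Cls.mul {d e t d' e' t' : ℕ} {p r : R[X][Y]} (hp : Cls d e t p) (hr : Cls d' e' t' r) :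
    Cls (d + d') (e + e') (t + t') (p * r) := fun i j h => by
  rw [coeff_mul, finsetSum_coeff] at h
  obtain ⟨x, hx, hx2⟩ := Finset.exists_ne_zero_of_sum_ne_zero h
  rw [coeff_mul] at hx2
  obtain ⟨y, hy, hy2⟩ := Finset.exists_ne_zero_of_sum_ne_zero hx2
  have h1 := hp y.1 x.1 (left_ne_zero_of_mul hy2)
  have h2 := hr y.2 x.2 (right_ne_zero_of_mul hy2)
  rw [Finset.HasAntidiagonal.mem_antidiagonal] at hx hy
  omega

lemma Cls.CC (d e t : ℕ) (c : R) : Cls d e t (C (C c)) := fun i j h => by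
  rw [coeff_C] at h
  split_ifs at h with hj
  · rw [coeff_C] at h
    split_ifs at h with hi
    · omega
    · simp at h
  · simp at h

lemma Cls.one (d e t : ℕ) : Cls d e t (1 : R[X][Y]) := by
  simpa using Cls.CC d e t (1 : R)

lemma Cls.z : Cls 1 0 1 (C X : R[X][Y]) := fun i j h => by
  rw [coeff_C] at h
  split_ifs at h with hj
  · rw [coeff_X] at h
    split_ifs at h with hi
    · omega
    · simp at h
  · simp at h

lemma Cls.w : Cls 0 1 1 (X : R[X][Y]) := fun i j h => by
  rw [coeff_X] at h
  split_ifs at h with hj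
  · rw [coeff_one] at h
    split_ifs at h with hi
    · omega
    · simp at h
  · simp at h

lemma Cls.pow {d e t : ℕ} {p : R[X][Y]} (hp : Cls d e t p) (n : ℕ) :
    Cls (n * d) (n * e) (n * t) (p ^ n) := by
  induction n with
  | zero => simpa using Cls.one 0 0 0
  | succ n ih =>
    rw [pow_succ]
    exact (ih.mul hp).mono (by ring_nf; rfl) (by ring_nf; rfl) (by ring_nf; rfl)

lemma Cls.prod {ι : Type*} (s : Finset ι) (p : ι → R[X][Y]) (d e t : ι → ℕ)
    (hp : ∀ i ∈ s, Cls (d i) (e i) (t i) (p i)) :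
    Cls (∑ i ∈ s, d i) (∑ i ∈ s, e i) (∑ i ∈ s, t i) (∏ i ∈ s, p i) := by
  classical
  induction s using Finset.induction_on with
  | empty => simpa using Cls.one 0 0 0
  | insert a s ha ih =>
    rw [Finset.prod_insert ha, Finset.sum_insert ha, Finset.sum_insert ha, Finset.sum_insert ha]
    exact (hp a (by simp)).mul (ih fun i hi => hp i (by simp [hi]))

lemma Cls.smul {d e t : ℕ} {p : R[X][Y]} (hp : Cls d e t p) (c : R) : Cls d e t (C (C c) * p) := by
  simpa using (Cls.CC 0 0 0 c).mul hp

lemma Cls.natDegree_le {d e t : ℕ} {p : R[X][Y]} (hp : Cls d e t p) : p.natDegree ≤ e := by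
  rw [natDegree_le_iff_coeff_eq_zero]
  intro N hN
  ext i
  by_contra h
  have := hp i N (by simpa using h); omega

lemma Cls.coeff_natDegree {d e t : ℕ} {p : R[X][Y]} (hp : Cls d e t p) (j : ℕ) :
    (p.coeff j).natDegree ≤ d ∧ ((p.coeff j) ≠ 0 → j ≤ e ∧ (p.coeff j).natDegree + j ≤ t) := by
  constructor
  · rw [natDegree_le_iff_coeff_eq_zero]
    intro N hN
    by_contra h
    have := hp N j h; omega
  · intro h
    have := hp (p.coeff j).natDegree j (by simpa using h)
    omega

lemma Cls.dz {d e t : ℕ} {p : R[X][Y]} (hp : Cls (d + 1) e (t + 1) p) : Cls d e t (dz p) :=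
  fun i j h => by
  rw [coeff_dz, coeff_derivative] at h
  have := hp _ _ (left_ne_zero_of_mul h)
  omega

lemma Cls.dw {d e t : ℕ} {p : R[X][Y]} (hp : Cls d (e + 1) (t + 1) p) : Cls d e t (derivative p) :=
  fun i j h => by
  rw [coeff_derivative] at h
  have h2 : (p.coeff (j + 1)).coeff i ≠ 0 := by
    intro h0
    apply h
    have : ((j : R[X]) + 1) = C ((j : R) + 1) := by simp
    rw [this, coeff_mul_C, h0, zero_mul]
  have := hp _ _ h2
  omega

end Cls

section Deg
variable {R : Type*} [CommRing R]

lemma det_coeff_zero {n : ℕ} (M : Matrix (Fin n) (Fin n) R[X]) (σ ρ : Fin n → ℤ)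
    (h : ∀ i c, M i c ≠ 0 → ((M i c).natDegree : ℤ) ≤ σ c + ρ i) (N : ℕ)
    (hN : ∑ c, σ c + ∑ i, ρ i < N) : M.det.coeff N = 0 := by
  rw [Matrix.det_apply, finsetSum_coeff]
  refine Finset.sum_eq_zero fun π _ => ?_
  rw [Units.smul_def, coeff_smul]
  have : (∏ i, M (π i) i).coeff N = 0 := by
    by_cases h0 : ∃ i, M (π i) i = 0
    · obtain ⟨i, hi⟩ := h0
      rw [Finset.prod_eq_zero (f := fun i => M (π i) i) (Finset.mem_univ i) hi, coeff_zero]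
    · push Not at h0
      apply coeff_eq_zero_of_natDegree_lt
      refine lt_of_le_of_lt (natDegree_prod_le _ _) ?_
      zify
      refine lt_of_le_of_lt (Finset.sum_le_sum fun i _ => h _ _ (h0 i)) ?_
      rw [Finset.sum_add_distrib, Equiv.sum_comp π ρ]
      exact hN
  rw [this, smul_zero]

/-- column potential -/
def sig (q : ℕ) (s : ℤ) (c : ℕ) : ℤ :=
  if c < q then q + 2 else if c < q + 1 then q + 3 else if c < 2 * q + 2 then q + 3 else
    if c < 2 * q + 3 then q + 4 else s

/-- row potential -/
def rho (q : ℕ) (i : ℕ) : ℤ := if i ≤ 2 * q then 0 else 2 * q - i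

lemma sum_sig (q : ℕ) (s : ℤ) : ∑ c : Fin (2 * q + 4), sig q s c = 2 * q ^ 2 + 8 * q + 10 + s := by
  rw [Fin.sum_univ_eq_sum_range (fun c => sig q s c), Finset.sum_range_succ, Finset.sum_range_succ,
    show 2 * q + 2 = (q + 1) + (q + 1) by ring, Finset.sum_range_add, Finset.sum_range_succ]
  have h1 : ∑ x ∈ Finset.range q, sig q s x = q * (q + 2) := by
    rw [Finset.sum_congr rfl (g := fun _ => (q + 2 : ℤ))]
    · simp
    · intro x hx; simp at hx; simp [sig, hx]
  have h2 : ∑ x ∈ Finset.range (q + 1), sig q s (q + 1 + x) = (q + 1) * (q + 3) := by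
    rw [Finset.sum_congr rfl (g := fun _ => (q + 3 : ℤ))]
    · simp
    · intro x hx; simp at hx
      rw [sig, if_neg (by omega), if_neg (by omega), if_pos (by omega)]
  rw [h1, h2]
  have h3 : sig q s q = q + 3 := by simp [sig]
  have h4 : sig q s (q + 1 + (q + 1)) = q + 4 := by
    rw [sig, if_neg (by omega), if_neg (by omega), if_neg (by omega), if_pos (by omega)]
  have h5 : sig q s (2 * q + 3) = s := by
    rw [sig, if_neg (by omega), if_neg (by omega), if_neg (by omega), if_neg (by omega)]
  rw [h3, h4, h5]; ring

lemma sum_rho (q : ℕ) : ∑ i : Fin (2 * q + 4), rho q i = - 6 := by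
  rw [Fin.sum_univ_eq_sum_range (fun c => rho q c), Finset.sum_range_succ, Finset.sum_range_succ,
    Finset.sum_range_succ]
  rw [Finset.sum_eq_zero]
  · simp [rho]
  · intro x hx; simp at hx; simp [rho]; omega

lemma sylP_coeff (q : ℕ) (a b F : R[X][Y]) (ha : Cls (q + 2) (q + 3) (2 * q + 3) a)
    (hb : Cls (q + 3) (q + 2) (2 * q + 3) b) (s : ℤ)
    (hF : ∀ i, i < 2 * q + 4 → F.coeff i ≠ 0 → ((F.coeff i).natDegree : ℤ) ≤ s + rho q i) (N : ℕ)
    (hN : 2 * q ^ 2 + 8 * q + 4 + s < N) : (sylP q a b F).coeff N = 0 := by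
  apply det_coeff_zero _ (fun c => sig q s c) (fun i => rho q i)
  · intro i c hic
    have hi := i.2
    have hc := c.2
    simp only [sylM, Matrix.of_apply] at hic ⊢
    by_cases h1 : (c : ℕ) < q + 1
    · rw [cols_a q a b F h1, coeff_X_pow_mul'] at hic ⊢
      split_ifs at hic ⊢ with h2
      · have h3 := ha.coeff_natDegree (i - c)
        have h4 := h3.2 hic
        simp only [sig, rho]
        split_ifs <;> omega
      · simp at hic
    · by_cases h2 : (c : ℕ) < 2 * q + 3
      · obtain ⟨t, ht⟩ : ∃ t, (c : ℕ) = t + (q + 1) := ⟨c - (q + 1), by omega⟩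
        rw [cols_b q a b F ht (by omega), coeff_X_pow_mul'] at hic ⊢
        split_ifs at hic ⊢ with h2
        · have h3 := hb.coeff_natDegree (i - t)
          have h4 := h3.2 hic
          simp only [sig, rho]
          split_ifs <;> omega
        · simp at hic
      · rw [cols_F q a b F (by omega)] at hic ⊢
        have := hF i hi hic
        rw [sig, if_neg (by omega), if_neg (by omega), if_neg (by omega), if_neg (by omega)]
        exact this
  · rw [sum_sig, sum_rho]; linarith

/-- the number of zeros -/
def mu (q : ℕ) : ℕ := 2 * q ^ 2 + 10 * q + 9

lemma elim_natDegree (q : ℕ) (a b : R[X][Y]) (ha : Cls (q + 2) (q + 3) (2 * q + 3) a)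
    (hb : Cls (q + 3) (q + 2) (2 * q + 3) b) : (elim q a b).natDegree ≤ mu q := by
  rw [natDegree_le_iff_coeff_eq_zero]
  intro N hN
  apply sylP_coeff q a b _ ha hb (2 * q + 5)
  · intro i hi h0
    have hb0 := hb.coeff_natDegree (q + 2)
    have ha0 := ha.coeff_natDegree (q + 3)
    have key : ∀ (p r : R[X]), p ≠ 0 → r ≠ 0 → ((p * r).natDegree : ℤ) ≤ p.natDegree + r.natDegree :=
      fun p r _ _ => by exact_mod_cast natDegree_mul_le
    rw [sylE, coeff_sub, mul_assoc, mul_assoc, coeff_C_mul, coeff_C_mul, coeff_X_pow_mul',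
      coeff_X_pow_mul']
    have t1 : ((b.coeff (q + 2) * if q + 1 ≤ i then a.coeff (i - (q + 1)) else 0).natDegree : ℤ)
        ≤ 2 * q + 5 + rho q i := by
      by_cases hz : (b.coeff (q + 2) * if q + 1 ≤ i then a.coeff (i - (q + 1)) else 0) = 0
      · rw [hz]; simp [rho]; split_ifs <;> omega
      · split_ifs at hz ⊢ with h1
        · have h2 := left_ne_zero_of_mul hz
          have h3 := right_ne_zero_of_mul hz
          have h4 := ha.coeff_natDegree (i - (q + 1))
          have h5 := h4.2 h3
          have h6 := hb0.2 h2
          refine (key _ _ h2 h3).trans ?_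
          simp only [rho]
          split_ifs <;> omega
        · simp at hz
    have t2 : ((a.coeff (q + 3) * if q + 2 ≤ i then b.coeff (i - (q + 2)) else 0).natDegree : ℤ)
        ≤ 2 * q + 5 + rho q i := by
      by_cases hz : (a.coeff (q + 3) * if q + 2 ≤ i then b.coeff (i - (q + 2)) else 0) = 0
      · rw [hz]; simp [rho]; split_ifs <;> omega
      · split_ifs at hz ⊢ with h1
        · have h2 := left_ne_zero_of_mul hz
          have h3 := right_ne_zero_of_mul hz
          have h4 := hb.coeff_natDegree (i - (q + 2))
          have h5 := h4.2 h3
          have h6 := ha0.2 h2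
          refine (key _ _ h2 h3).trans ?_
          simp only [rho]
          split_ifs <;> omega
        · simp at hz
    refine le_trans ?_ (max_le t1 t2)
    exact_mod_cast natDegree_sub_le _ _
  · have : (mu q : ℤ) < N := by exact_mod_cast hN
    rw [mu] at this; push_cast at this
    linarith

lemma sylP_natDegree (q : ℕ) (a b F : R[X][Y]) (ha : Cls (q + 2) (q + 3) (2 * q + 3) a)
    (hb : Cls (q + 3) (q + 2) (2 * q + 3) b) (hF : Cls (2 * q + 3) (2 * q + 3) (4 * q + 3) F) :
    (sylP q a b F).natDegree + 2 ≤ mu q := by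
  have : (sylP q a b F).natDegree ≤ mu q - 2 := by
    rw [natDegree_le_iff_coeff_eq_zero]
    intro N hN
    apply sylP_coeff q a b _ ha hb (2 * q + 3)
    · intro i hi h0
      have h1 := hF.coeff_natDegree i
      have h2 := h1.2 h0
      simp only [rho]
      split_ifs <;> omega
    · have h3 : mu q < N + 2 := by omega
      have : (mu q : ℤ) < N + 2 := by exact_mod_cast h3
      rw [mu] at this; push_cast at this
      linarith
  have h9 : 9 ≤ mu q := by rw [mu]; omega
  omega

end Deg
end Ell

namespace Ell
open Polynomial
open scoped Polynomial.Bivariate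

section AC
variable {K : Type*} [Field K]

lemma exists_rel (q : ℕ) (a b F : K[X][Y]) (z : K)
    (ha : a.natDegree ≤ q + 3) (hb : b.natDegree ≤ q + 2) (hF : F.natDegree ≤ 2 * q + 3)
    (h : (sylP q a b F).eval z = 0) :
    ∃ u v : K[X], ∃ l : K, (u ≠ 0 ∨ v ≠ 0 ∨ l ≠ 0) ∧ u.natDegree ≤ q ∧ v.natDegree ≤ q + 1 ∧
      u * a.map (evalRingHom z) + v * b.map (evalRingHom z) + C l * F.map (evalRingHom z) = 0 := by
  unfold sylP at h
  rw [← coe_evalRingHom, RingHom.map_det] at h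
  obtain ⟨x, hx0, hx⟩ := Matrix.exists_mulVec_eq_zero_iff.2 h
  set y : ℕ → K := fun c => if h : c < 2 * q + 4 then x ⟨c, h⟩ else 0 with hy
  have hyx : ∀ c : Fin (2 * q + 4), y c = x c := fun c => by simp [hy]
  have hsum : ∑ c ∈ Finset.range (2 * q + 4), C (y c) * (cols q a b F c).map (evalRingHom z) = 0 := by
    ext i
    rw [finsetSum_coeff]
    simp only [coeff_C_mul, coeff_map, coeff_zero]
    by_cases hi : i < 2 * q + 4
    · have := congrFun hx ⟨i, hi⟩
      simp only [Matrix.mulVec, dotProduct, Pi.zero_apply] at this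
      rw [← this, Finset.sum_range]
      refine Finset.sum_congr rfl fun c _ => ?_
      rw [hyx]; simp [sylM]; ring
    · refine Finset.sum_eq_zero fun c hc => ?_
      simp only [Finset.mem_range] at hc
      have hcd : (cols q a b F c).natDegree < 2 * q + 4 := by
        unfold cols
        split_ifs with h1 h2
        · exact lt_of_le_of_lt natDegree_mul_le
            (by have := natDegree_X_pow_le (R := K[X]) (c : ℕ); omega)
        · exact lt_of_le_of_lt natDegree_mul_le
            (by have := natDegree_X_pow_le (R := K[X]) ((c : ℕ) - (q + 1)); omega)
        · omega
      rw [coeff_eq_zero_of_natDegree_lt (by omega)]; simp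
  refine ⟨∑ s ∈ Finset.range (q + 1), C (y s) * X ^ s,
    ∑ s ∈ Finset.range (q + 2), C (y (q + 1 + s)) * X ^ s, y (2 * q + 3), ?_, ?_, ?_, ?_⟩
  · by_contra hcon
    push Not at hcon
    obtain ⟨h1, h2, h3⟩ := hcon
    apply hx0
    have c1 : ∀ s < q + 1, y s = 0 := by
      intro s hs
      have := congrArg (fun p => p.coeff s) h1
      simpa [finsetSum_coeff, coeff_X_pow, Nat.lt_succ_iff.1 hs] using this
    have c2 : ∀ s < q + 2, y (q + 1 + s) = 0 := by
      intro s hs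
      have := congrArg (fun p => p.coeff s) h2
      simpa [finsetSum_coeff, coeff_X_pow, hs] using this
    ext c
    rw [← hyx]
    have hc := c.2
    simp only [Pi.zero_apply]
    by_cases h4 : (c : ℕ) < q + 1
    · exact c1 c h4
    · by_cases h5 : (c : ℕ) < 2 * q + 3
      · have := c2 (c - (q + 1)) (by omega)
        rwa [show q + 1 + ((c : ℕ) - (q + 1)) = c by omega] at this
      · rwa [show (c : ℕ) = 2 * q + 3 by omega]
  · apply natDegree_sum_le_of_forall_le
    intro s hs
    simp only [Finset.mem_range] at hs
    exact (natDegree_C_mul_X_pow_le _ _).trans (by omega)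
  · apply natDegree_sum_le_of_forall_le
    intro s hs
    simp only [Finset.mem_range] at hs
    exact (natDegree_C_mul_X_pow_le _ _).trans (by omega)
  · rw [Finset.sum_range_succ, show 2 * q + 3 = (q + 1) + (q + 2) by ring,
      Finset.sum_range_add] at hsum
    have e1 : ∑ s ∈ Finset.range (q + 1), C (y s) * (cols q a b F s).map (evalRingHom z)
        = (∑ s ∈ Finset.range (q + 1), C (y s) * X ^ s) * a.map (evalRingHom z) := by
      rw [Finset.sum_mul]
      refine Finset.sum_congr rfl fun s hs => ?_
      rw [cols_a q a b F (Finset.mem_range.1 hs), Polynomial.map_mul, Polynomial.map_pow, map_X,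
        mul_assoc]
    have e2 : ∑ s ∈ Finset.range (q + 2), C (y (q + 1 + s)) *
          (cols q a b F (q + 1 + s)).map (evalRingHom z)
        = (∑ s ∈ Finset.range (q + 2), C (y (q + 1 + s)) * X ^ s) * b.map (evalRingHom z) := by
      rw [Finset.sum_mul]
      refine Finset.sum_congr rfl fun s hs => ?_
      rw [cols_b q a b F (add_comm (q + 1) s) (Finset.mem_range.1 hs), Polynomial.map_mul,
        Polynomial.map_pow, map_X, mul_assoc]
    rw [e1, e2, cols_F q a b F (by ring), show (q + 1) + (q + 2) = 2 * q + 3 by ring] at hsum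
    exact hsum

variable [IsAlgClosed K]

lemma isCoprime_of_no_root (p r : K[X]) (h : ∀ x, ¬ (p.eval x = 0 ∧ r.eval x = 0)) :
    IsCoprime p r := by
  rw [Polynomial.isCoprime_iff_aeval_ne_zero_of_isAlgClosed K K]
  intro x
  have := h x
  simp only [coe_aeval_eq_eval]
  tauto

/-- a root of the eliminant lifts to a common zero -/
lemma exists_common_zero (q : ℕ) (a b : K[X][Y]) (z : K)
    (ha : a.natDegree ≤ q + 3) (hb : b.natDegree ≤ q + 2)
    (h : (elim q a b).eval z = 0)
    (hl : (a.coeff (q + 3)).eval z ≠ 0 ∨ (b.coeff (q + 2)).eval z ≠ 0) :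
    ∃ w, a.evalEval z w = 0 ∧ b.evalEval z w = 0 := by
  by_contra hcon
  push Not at hcon
  have hco : IsCoprime (a.map (evalRingHom z)) (b.map (evalRingHom z)) := by
    apply isCoprime_of_no_root
    rintro w ⟨h1, h2⟩
    rw [← evalEval_eq_map] at h1 h2
    exact hcon w h1 h2
  obtain ⟨u, v, l, hne, hu, hv, hrel⟩ := exists_rel q a b _ z ha hb (sylE_natDegree q a b ha hb) h
  set a0 := a.map (evalRingHom z) with ha0
  set b0 := b.map (evalRingHom z) with hb0
  set α := (a.coeff (q + 3)).eval z with hα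
  set β := (b.coeff (q + 2)).eval z with hβ
  have hα' : a0.coeff (q + 3) = α := by simp [ha0, hα]
  have hβ' : b0.coeff (q + 2) = β := by simp [hb0, hβ]
  set u' := u + C (l * β) * X ^ (q + 1) with hu'
  set v' := v - C (l * α) * X ^ (q + 2) with hv'
  have hrel' : u' * a0 + v' * b0 = 0 := by
    rw [← hrel, hu', hv', sylE]
    simp only [Polynomial.map_sub, Polynomial.map_mul, map_C, Polynomial.map_pow, map_X,
      coe_evalRingHom]
    rw [← ha0, ← hb0, ← hα, ← hβ]
    simp only [C_mul]
    ring
  have hud : u'.natDegree ≤ q + 1 :=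
    natDegree_add_le_of_degree_le (by omega) (natDegree_C_mul_X_pow_le _ _)
  have hvd : v'.natDegree ≤ q + 2 := by
    rw [hv', sub_eq_add_neg]
    refine natDegree_add_le_of_degree_le (by omega) ?_
    rw [natDegree_neg]; exact natDegree_C_mul_X_pow_le _ _
  have hzero : u' = 0 ∧ v' = 0 := by
    rcases hl with hl | hl
    · have hdv : a0 ∣ v' := by
        apply hco.dvd_of_dvd_mul_right
        exact ⟨-u', by linear_combination hrel'⟩
      have hv0 : v' = 0 := by
        apply eq_zero_of_dvd_of_natDegree_lt hdv
        have : q + 3 ≤ a0.natDegree := le_natDegree_of_ne_zero (by rw [hα']; exact hl)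
        omega
      refine ⟨?_, hv0⟩
      rw [hv0, zero_mul, add_zero] at hrel'
      rcases mul_eq_zero.1 hrel' with h1 | h1
      · exact h1
      · exfalso; apply hl; rw [← hα', h1]; simp
    · have hdv : b0 ∣ u' := by
        apply hco.symm.dvd_of_dvd_mul_right
        exact ⟨-v', by linear_combination hrel'⟩
      have hv0 : u' = 0 := by
        apply eq_zero_of_dvd_of_natDegree_lt hdv
        have : q + 2 ≤ b0.natDegree := le_natDegree_of_ne_zero (by rw [hβ']; exact hl)
        omega
      refine ⟨hv0, ?_⟩
      rw [hv0, zero_mul, zero_add] at hrel'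
      rcases mul_eq_zero.1 hrel' with h1 | h1
      · exact h1
      · exfalso; apply hl; rw [← hβ', h1]; simp
  have hl0 : l = 0 := by
    rcases hl with hl | hl
    · have := congrArg (fun p => p.coeff (q + 2)) hzero.2
      simp only [hv', coeff_sub, coeff_C_mul, coeff_X_pow_self, coeff_zero, mul_one] at this
      rw [coeff_eq_zero_of_natDegree_lt (by omega)] at this
      have : l * α = 0 := by linear_combination -this
      exact (mul_eq_zero.1 this).resolve_right hl
    · have := congrArg (fun p => p.coeff (q + 1)) hzero.1
      simp only [hu', coeff_add, coeff_C_mul, coeff_X_pow_self, coeff_zero, mul_one] at this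
      rw [coeff_eq_zero_of_natDegree_lt (by omega)] at this
      have : l * β = 0 := by linear_combination this
      exact (mul_eq_zero.1 this).resolve_right hl
  rw [hu', hv', hl0] at hzero
  simp at hzero
  rcases hne with h1 | h1 | h1
  · exact h1 hzero.1
  · exact h1 hzero.2
  · exact h1 hl0

/-- A pair in general position. -/
structure Good (q : ℕ) (a b : K[X][Y]) : Prop where
  lead : (a.coeff (q + 3)).coeff q ≠ 0
  cop : IsCoprime (a.coeff (q + 3)) (b.coeff (q + 2))
  top : (elim q a b).coeff (mu q) ≠ 0
  sqf : IsCoprime (elim q a b) (derivative (elim q a b))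

/-- the classes for both members of a pair -/
structure Pair (q : ℕ) (a b : K[X][Y]) : Prop where
  ha : Cls (q + 2) (q + 3) (2 * q + 3) a
  hb : Cls (q + 3) (q + 2) (2 * q + 3) b

variable {q : ℕ} {a b : K[X][Y]}

lemma Good.natDegree (hp : Pair q a b) (hg : Good q a b) : (elim q a b).natDegree = mu q :=
  le_antisymm (elim_natDegree q a b hp.ha hp.hb) (le_natDegree_of_ne_zero hg.top)

lemma Good.jac_ne (hp : Pair q a b) (hg : Good q a b) {z w : K} (haz : a.evalEval z w = 0)
    (hbz : b.evalEval z w = 0) : jac a b z w ≠ 0 ∧ (sylP q a b 1).eval z ≠ 0 := by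
  obtain ⟨h1, h2⟩ := elim_deriv q a b z w hp.ha.natDegree_le hp.hb.natDegree_le haz hbz
  have h3 : (derivative (elim q a b)).eval z ≠ 0 := by
    intro h0
    obtain ⟨x, y, hxy⟩ := hg.sqf
    have := congrArg (eval z) hxy
    simp [h1, h0] at this
  rw [h2] at h3
  exact ⟨left_ne_zero_of_mul h3, right_ne_zero_of_mul h3⟩

lemma Good.unique (hp : Pair q a b) (hg : Good q a b) {z w w' : K} (haz : a.evalEval z w = 0)
    (hbz : b.evalEval z w = 0) (haz' : a.evalEval z w' = 0)
    (hbz' : b.evalEval z w' = 0) : w = w' := by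
  have h := (hg.jac_ne hp haz hbz).2
  have hX : (X : K[X][Y]).natDegree ≤ 2 * q + 3 := by simp
  have h1 := sylP_eval_zero q a b X z w hp.ha.natDegree_le hp.hb.natDegree_le hX haz hbz
  have h2 := sylP_eval_zero q a b X z w' hp.ha.natDegree_le hp.hb.natDegree_le hX haz' hbz'
  rw [h1] at h2
  simpa using mul_right_cancel₀ h h2

/-- For a good pair there is a set of `mu q` zeros, on which Euler-Jacobi holds. -/
theorem Good.zeros (hp : Pair q a b) (hg : Good q a b) : ∃ Z : Finset (K × K), Z.card = mu q ∧
    (∀ p, p ∈ Z ↔ a.evalEval p.1 p.2 = 0 ∧ b.evalEval p.1 p.2 = 0) ∧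
    (∀ p ∈ Z, jac a b p.1 p.2 ≠ 0) ∧
    (∀ p ∈ Z, ∀ p' ∈ Z, p.1 = p'.1 → p = p') ∧
    (∀ F : K[X][Y], Cls (2 * q + 3) (2 * q + 3) (4 * q + 3) F →
      ∑ p ∈ Z, F.evalEval p.1 p.2 / jac a b p.1 p.2 = 0) := by
  classical
  set E := elim q a b with hE
  have hEne : E ≠ 0 := fun h => hg.top (by rw [← hE, h]; simp)
  have hsep : E.Separable := hg.sqf
  have hcard : E.roots.toFinset.card = mu q := by
    rw [Multiset.toFinset_card_of_nodup (nodup_roots hsep),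
      splits_iff_card_roots.1 (IsAlgClosed.splits E), hg.natDegree hp]
  have hex : ∀ z, z ∈ E.roots.toFinset → ∃ w, a.evalEval z w = 0 ∧ b.evalEval z w = 0 := by
    intro z hz
    simp only [Multiset.mem_toFinset, mem_roots hEne] at hz
    refine exists_common_zero q a b z hp.ha.natDegree_le hp.hb.natDegree_le hz ?_
    by_contra hcon
    push Not at hcon
    obtain ⟨x, y, hxy⟩ := hg.cop
    have := congrArg (eval z) hxy
    simp [hcon.1, hcon.2] at this
  choose! W hW using hex
  have hmemr : ∀ z w, a.evalEval z w = 0 → b.evalEval z w = 0 → z ∈ E.roots.toFinset := by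
    intro z w h1 h2
    simp only [Multiset.mem_toFinset, mem_roots hEne]
    exact (elim_deriv q a b z w hp.ha.natDegree_le hp.hb.natDegree_le h1 h2).1
  have hinj : Function.Injective (fun z => (z, W z)) := fun x y h => (Prod.ext_iff.1 h).1
  refine ⟨E.roots.toFinset.map ⟨fun z => (z, W z), hinj⟩, by rw [Finset.card_map, hcard],
    ?_, ?_, ?_, ?_⟩
  · rintro ⟨z, w⟩
    simp only [Finset.mem_map, Function.Embedding.coeFn_mk, Prod.mk.injEq]
    constructor
    · rintro ⟨z', hz', rfl, rfl⟩
      exact hW z' hz'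
    · rintro ⟨h1, h2⟩
      have h3 := hmemr z w h1 h2
      exact ⟨z, h3, rfl, hg.unique hp (hW z h3).1 (hW z h3).2 h1 h2⟩
  · intro p hpz
    simp only [Finset.mem_map, Function.Embedding.coeFn_mk] at hpz
    obtain ⟨z, hz, rfl⟩ := hpz
    exact (hg.jac_ne hp (hW z hz).1 (hW z hz).2).1
  · intro p hpz p' hpz' hpp
    simp only [Finset.mem_map, Function.Embedding.coeFn_mk] at hpz hpz'
    obtain ⟨z, hz, rfl⟩ := hpz
    obtain ⟨z', hz', rfl⟩ := hpz'
    simp only at hpp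
    rw [hpp]
  · intro F hF
    rw [Finset.sum_map]
    simp only [Function.Embedding.coeFn_mk]
    have hPd := sylP_natDegree q a b F hp.ha hp.hb hF
    set P := sylP q a b F with hP
    have hterm : ∀ z ∈ E.roots.toFinset, F.evalEval z (W z) / jac a b z (W z)
        = E.leadingCoeff⁻¹ * (P.eval z / ∏ y ∈ E.roots.toFinset.erase z, (z - y)) := by
      intro z hz
      obtain ⟨hj, h1⟩ := hg.jac_ne hp (hW z hz).1 (hW z hz).2
      have e1 := sylP_eval_zero q a b F z (W z) hp.ha.natDegree_le hp.hb.natDegree_le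
        (hF.natDegree_le) (hW z hz).1 (hW z hz).2
      have e2 := (elim_deriv q a b z (W z) hp.ha.natDegree_le hp.hb.natDegree_le
        (hW z hz).1 (hW z hz).2).2
      have e3 : (derivative E).eval z = E.leadingCoeff * ∏ y ∈ E.roots.toFinset.erase z, (z - y) := by
        have hprod : E = C E.leadingCoeff * ∏ y ∈ E.roots.toFinset, (X - C y) := by
          conv_lhs => rw [(IsAlgClosed.splits E).eq_prod_roots]
          congr 1
          rw [Finset.prod_multiset_map_count]
          refine Finset.prod_congr rfl fun y hy => ?_
          rw [Multiset.count_eq_one_of_mem (nodup_roots hsep) (by simpa using hy), pow_one]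
        have := Lagrange.eval_nodal_derivative_eval_node_eq (v := (id : K → K)) hz
        rw [Lagrange.nodal_eq, Lagrange.eval_nodal] at this
        simp only [id] at this
        conv_lhs => rw [hprod]
        rw [derivative_C_mul, eval_mul, eval_C, this]
      rw [← hE, e3] at e2
      have hlc : E.leadingCoeff ≠ 0 := leadingCoeff_ne_zero.2 hEne
      have hpr : ∏ y ∈ E.roots.toFinset.erase z, (z - y) ≠ 0 := by
        intro h0
        rw [h0, mul_zero] at e2
        exact mul_ne_zero hj h1 e2.symm
      rw [hP, e1]
      field_simp
      linear_combination (F.evalEval z (W z)) * e2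
    rw [Finset.sum_congr rfl hterm, ← Finset.mul_sum]
    have hco := Lagrange.coeff_eq_sum (s := E.roots.toFinset) (v := (id : K → K)) (P := P)
      (Function.injective_id.injOn) (by
        rw [hcard]
        refine lt_of_le_of_lt degree_le_natDegree ?_
        exact_mod_cast (by omega : P.natDegree < mu q))
    simp only [id] at hco
    rw [← hco, hcard, coeff_eq_zero_of_natDegree_lt (by omega), mul_zero]

/-- A polynomial of low bidegree vanishing on the zeros of a good pair is zero. -/
theorem Good.inj (hp : Pair q a b) (hg : Good q a b) (d : ℕ) (hd : d ≤ q + 1) (h : K[X][Y])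
    (hh : Cls d d (2 * d) h) (hq : 2 * d ≤ q)
    (hz : ∀ z w, a.evalEval z w = 0 → b.evalEval z w = 0 → h.evalEval z w = 0) : h = 0 := by
  classical
  by_contra hne
  obtain ⟨Z, hZc, hZm, -, hZinj, -⟩ := hg.zeros hp
  set E := elim q a b with hE
  have hEne : E ≠ 0 := fun h => hg.top (by rw [← hE, h]; simp)
  have hPzero : ∀ s, s ≤ q + 2 → sylP q a b (X ^ s * h) = 0 := by
    intro s hs
    have hcl : Cls (2 * q + 3) (2 * q + 3) (4 * q + 3) (X ^ s * h) := by
      refine ((Cls.w.pow s).mul hh).mono ?_ ?_ ?_ <;> omega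
    have hdeg := sylP_natDegree q a b _ hp.ha hp.hb hcl
    refine eq_zero_of_natDegree_lt_card_of_eval_eq_zero' _ (Z.image Prod.fst) ?_ ?_
    · intro z hzm
      simp only [Finset.mem_image] at hzm
      obtain ⟨p, hpZ, rfl⟩ := hzm
      have := (hZm p).1 hpZ
      rw [sylP_eval_zero q a b _ p.1 p.2 hp.ha.natDegree_le hp.hb.natDegree_le hcl.natDegree_le
        this.1 this.2, evalEval_mul, hz _ _ this.1 this.2]
      simp
    · rw [Finset.card_image_of_injOn (fun p hp p' hp' hpp => hZinj p hp p' hp' hpp), hZc]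
      omega
  -- choose a good specialization
  obtain ⟨j, hj⟩ : ∃ j, h.coeff j ≠ 0 := by
    by_contra hcon; push Not at hcon; exact hne (by ext1 j; simpa using hcon j)
  have ham : a.coeff (q + 3) ≠ 0 := fun h0 => hg.lead (by rw [h0]; simp)
  obtain ⟨z, hz0⟩ : ∃ z, (E * a.coeff (q + 3) * h.coeff j).eval z ≠ 0 := by
    by_contra hcon
    push Not at hcon
    exact mul_ne_zero (mul_ne_zero hEne ham) hj (Polynomial.funext (by simpa using hcon))
  rw [eval_mul, eval_mul] at hz0
  have hEz := left_ne_zero_of_mul (left_ne_zero_of_mul hz0)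
  have haz := right_ne_zero_of_mul (left_ne_zero_of_mul hz0)
  have hhz := right_ne_zero_of_mul hz0
  set a0 := a.map (evalRingHom z) with ha0
  set b0 := b.map (evalRingHom z) with hb0
  set h0 := h.map (evalRingHom z) with hh0
  have hco : IsCoprime a0 b0 := by
    apply isCoprime_of_no_root
    rintro w ⟨h1, h2⟩
    rw [ha0, ← evalEval_eq_map] at h1
    rw [hb0, ← evalEval_eq_map] at h2
    exact hEz (elim_deriv q a b z w hp.ha.natDegree_le hp.hb.natDegree_le h1 h2).1
  have had : a0.natDegree = q + 3 := by
    refine le_antisymm (natDegree_map_le.trans hp.ha.natDegree_le) (le_natDegree_of_ne_zero ?_)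
    simpa [ha0] using haz
  have hh0ne : h0 ≠ 0 := by
    intro h00
    apply hhz
    have := congrArg (fun p => p.coeff j) h00
    simpa [hh0] using this
  have ha0ne : a0 ≠ 0 := fun h00 => by rw [h00] at had; simp at had
  have hhd : h0.natDegree ≤ d := natDegree_map_le.trans hh.natDegree_le
  -- every multiple of h0 of bounded degree is in the span
  have hspan : ∀ g : K[X], g.natDegree ≤ q + 2 → ∃ u v : K[X], v.natDegree ≤ q + 1 ∧
      h0 * g = u * a0 + v * b0 := by
    intro g hgd
    set F : K[X][Y] := g.map C * h with hF
    have hid : (evalRingHom z).comp (C : K →+* K[X]) = RingHom.id K := by ext; simp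
    have hF0 : F.map (evalRingHom z) = g * h0 := by
      rw [hF, Polynomial.map_mul, Polynomial.map_map, hid, Polynomial.map_id]
    have hP0 : sylP q a b F = 0 := by
      have hgs : g.map C = ∑ s ∈ Finset.range (q + 3), C (C (g.coeff s)) * X ^ s := by
        conv_lhs => rw [g.as_sum_range' (q + 3) (by omega)]
        rw [Polynomial.map_sum]
        refine Finset.sum_congr rfl fun s _ => ?_
        rw [map_monomial, C_mul_X_pow_eq_monomial]
      rw [hF, hgs, Finset.sum_mul, ← sylL_apply, map_sum]
      refine Finset.sum_eq_zero fun s hs => ?_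
      rw [mul_assoc, ← smul_eq_C_mul, map_smul, sylL_apply,
        hPzero s (by simp only [Finset.mem_range] at hs; omega), smul_zero]
    have hFd : F.natDegree ≤ 2 * q + 3 := by
      refine natDegree_mul_le.trans ?_
      have := hh.natDegree_le
      have h2 : (g.map C : K[X][Y]).natDegree ≤ g.natDegree := natDegree_map_le
      omega
    obtain ⟨u, v, l, hnz, hu, hv, hrel⟩ := exists_rel q a b F z hp.ha.natDegree_le
      hp.hb.natDegree_le hFd (by rw [hP0]; simp)
    rw [← ha0, ← hb0, hF0] at hrel
    have hl : l ≠ 0 := by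
      intro hl
      rw [hl, C_0, zero_mul, add_zero] at hrel
      have hdv : a0 ∣ v := by
        apply hco.dvd_of_dvd_mul_right
        exact ⟨-u, by linear_combination hrel⟩
      have hv0 : v = 0 := eq_zero_of_dvd_of_natDegree_lt hdv (by omega)
      rw [hv0, zero_mul, add_zero] at hrel
      have hu0 : u = 0 := (mul_eq_zero.1 hrel).resolve_right ha0ne
      rcases hnz with h1 | h1 | h1
      · exact h1 hu0
      · exact h1 hv0
      · exact h1 hl
    refine ⟨-(C l⁻¹ * u), -(C l⁻¹ * v), ?_, ?_⟩
    · rw [natDegree_neg]; exact (natDegree_C_mul_le _ _).trans hv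
    · have hll : C l⁻¹ * C l = (1 : K[X]) := by rw [← C_mul, inv_mul_cancel₀ hl, C_1]
      linear_combination (C l⁻¹) * hrel - (g * h0) * hll
  -- contradiction
  set δ := EuclideanDomain.gcd h0 a0 with hδ
  have hδne : δ ≠ 0 := by
    intro h1
    exact hh0ne (EuclideanDomain.gcd_eq_zero_iff.1 h1).1
  have hδd : δ.natDegree ≤ q + 2 :=
    (natDegree_le_of_dvd (EuclideanDomain.gcd_dvd_left h0 a0) hh0ne).trans (by omega)
  have hbez := EuclideanDomain.gcd_eq_gcd_ab h0 a0
  rw [← hδ] at hbez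
  set x := EuclideanDomain.gcdA h0 a0
  set y := EuclideanDomain.gcdB h0 a0
  set vs := δ * X ^ (q + 2 - δ.natDegree) with hvs
  have hvsd : vs.natDegree = q + 2 := by
    rw [hvs, natDegree_mul_X_pow _ hδne]; omega
  set g0 := x * b0 * X ^ (q + 2 - δ.natDegree) with hg0
  have hmod : (g0 % a0).natDegree ≤ q + 2 := by
    have := natDegree_mod_lt g0 (q := a0) (by omega)
    omega
  obtain ⟨u, v, hv, huv⟩ := hspan (g0 % a0) hmod
  have hdm := EuclideanDomain.div_add_mod g0 a0
  have hdvd : a0 ∣ (vs - v) := by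
    apply hco.dvd_of_dvd_mul_right
    refine ⟨u + h0 * (g0 / a0) + y * b0 * X ^ (q + 2 - δ.natDegree), ?_⟩
    rw [hvs]
    linear_combination huv - h0 * hdm + (b0 * X ^ (q + 2 - δ.natDegree)) * hbez
      - h0 * hg0
  have hz2 : vs - v = 0 := by
    apply eq_zero_of_dvd_of_natDegree_lt hdvd
    have := natDegree_sub_le vs v
    rw [hvsd] at this
    omega
  have : vs = v := sub_eq_zero.1 hz2
  rw [this] at hvsd
  omega

end AC
end Ell

namespace Ell
open Polynomial
open scoped Polynomial.Bivariate

section D1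
variable {K : Type*} [Field K]

lemma coprime_generic (P R : K[X][X]) (m n : ℕ) (hP : P.natDegree ≤ m) (hR : R.natDegree ≤ n)
    (hn : n ≠ 0) (t0 : K) (h0 : (P.coeff m).eval t0 ≠ 0)
    (hc : IsCoprime (P.map (evalRingHom t0)) (R.map (evalRingHom t0))) :
    ∃ T : K[X], T.eval t0 ≠ 0 ∧ ∀ t, T.eval t ≠ 0 →
      IsCoprime (P.map (evalRingHom t)) (R.map (evalRingHom t)) := by
  have hmap : ∀ t, (resultant P R m n).eval t
      = resultant (P.map (evalRingHom t)) (R.map (evalRingHom t)) m n := by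
    intro t
    rw [resultant_map_map]; rfl
  refine ⟨resultant P R m n, ?_, ?_⟩
  · rw [hmap]
    have hd : (P.map (evalRingHom t0)).natDegree = m :=
      le_antisymm (natDegree_map_le.trans hP) (le_natDegree_of_ne_zero (by simpa using h0))
    obtain ⟨k, hk⟩ := Nat.exists_eq_add_of_le
      (natDegree_map_le.trans hR : (R.map (evalRingHom t0)).natDegree ≤ n)
    rw [hk, resultant_add_right_deg _ _ _ _ _ le_rfl]
    refine mul_ne_zero (pow_ne_zero _ (by simpa using h0)) ?_
    have := resultant_ne_zero _ _ hc
    rwa [hd] at this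
  · intro t ht
    rw [hmap] at ht
    obtain ⟨x, y, -, -, hxy⟩ := exists_mul_add_mul_eq_C_resultant (P.map (evalRingHom t))
      (R.map (evalRingHom t)) (natDegree_map_le.trans hP) (natDegree_map_le.trans hR) (Or.inr hn)
    set ρ := resultant (P.map (evalRingHom t)) (R.map (evalRingHom t)) m n with hρ
    have hll : C ρ⁻¹ * C ρ = (1 : K[X]) := by rw [← C_mul, inv_mul_cancel₀ ht, C_1]
    exact ⟨C ρ⁻¹ * x, C ρ⁻¹ * y, by linear_combination (C ρ⁻¹) * hxy + hll⟩

lemma Cls.map {R S : Type*} [CommRing R] [CommRing S] (φ : R →+* S) {d e t : ℕ} {p : R[X][Y]}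
    (hp : Cls d e t p) : Cls d e t (p.map (mapRingHom φ)) := fun i j h => by
  refine hp i j fun h0 => h ?_
  simp [h0]

/-- the affine family of pairs -/
noncomputable def lin (a0 a1 : K[X][Y]) (t : K) : K[X][Y] := a0 + C (C t) * a1

lemma Cls.lin {d e t : ℕ} {a0 a1 : K[X][Y]} (h0 : Cls d e t a0) (h1 : Cls d e t a1) (s : K) :
    Cls d e t (lin a0 a1 s) := h0.add (h1.smul s)

noncomputable def linL (a0 a1 : K[X][Y]) : K[X][X][Y] :=
  a0.map (mapRingHom C) + C (C X) * a1.map (mapRingHom C)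

lemma linL_map (a0 a1 : K[X][Y]) (t : K) :
    (linL a0 a1).map (mapRingHom (evalRingHom t)) = lin a0 a1 t := by
  have hid : (evalRingHom t).comp (C : K →+* K[X]) = RingHom.id K := by ext; simp
  unfold linL lin
  rw [Polynomial.map_add, Polynomial.map_mul, Polynomial.map_map, Polynomial.map_map,
    mapRingHom_comp, hid]
  simp

lemma Cls.linL {d e t : ℕ} {a0 a1 : K[X][Y]} (h0 : Cls d e t a0) (h1 : Cls d e t a1) :
    Cls d e t (linL a0 a1) := (h0.map C).add ((h1.map C).smul X)

lemma linL_coeff (a0 a1 : K[X][Y]) (t : K) (j : ℕ) :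
    ((linL a0 a1).coeff j).map (evalRingHom t) = (lin a0 a1 t).coeff j := by
  rw [← linL_map]; simp

end D1

theorem good_generic {K : Type*} [Field K] [IsAlgClosed K] {q : ℕ} {a0 b0 a1 b1 : K[X][Y]}
    (h0 : Pair q a0 b0) (h1 : Pair q a1 b1)
    (t0 : K) (hg : Good q (lin a0 a1 t0) (lin b0 b1 t0)) :
    ∃ T : K[X], T ≠ 0 ∧ ∀ t, T.eval t ≠ 0 → Good q (lin a0 a1 t) (lin b0 b1 t) := by
  set A := linL a0 a1 with hA
  set B := linL b0 b1 with hB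
  have cA := h0.ha.linL h1.ha
  have cB := h0.hb.linL h1.hb
  rw [← hA] at cA
  rw [← hB] at cB
  have hE : ∀ t, (elim q A B).map (evalRingHom t) = elim q (lin a0 a1 t) (lin b0 b1 t) := by
    intro t
    rw [← elim_map, hA, hB, linL_map, linL_map]
  have hdA : (A.coeff (q + 3)).natDegree ≤ q := by
    by_cases h : A.coeff (q + 3) = 0
    · simp [h]
    · have := ((cA.coeff_natDegree (q + 3)).2 h).2; omega
  have hdB : (B.coeff (q + 2)).natDegree ≤ q + 3 := (cB.coeff_natDegree (q + 2)).1
  have hdE : (elim q A B).natDegree ≤ mu q := elim_natDegree q A B cA cB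
  have hlead : ∀ t, ((A.coeff (q + 3)).coeff q).eval t = ((lin a0 a1 t).coeff (q + 3)).coeff q := by
    intro t; rw [← linL_coeff, coeff_map]; rfl
  have htop : ∀ t, ((elim q A B).coeff (mu q)).eval t
      = (elim q (lin a0 a1 t) (lin b0 b1 t)).coeff (mu q) := by
    intro t; rw [← hE, coeff_map]; rfl
  obtain ⟨T1, hT1, hT1'⟩ := coprime_generic (A.coeff (q + 3)) (B.coeff (q + 2)) q (q + 3) hdA hdB
    (by omega) t0 (by rw [hlead]; exact hg.lead) (by rw [hA, hB, linL_coeff, linL_coeff]; exact hg.cop)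
  obtain ⟨T2, hT2, hT2'⟩ := coprime_generic (elim q A B) (derivative (elim q A B)) (mu q) (mu q) hdE
    ((natDegree_derivative_le _).trans (by omega)) (by unfold mu; omega) t0
    (by rw [htop]; exact hg.top) (by rw [← derivative_map, hE]; exact hg.sqf)
  refine ⟨(A.coeff (q + 3)).coeff q * (elim q A B).coeff (mu q) * T1 * T2, ?_, ?_⟩
  · intro h
    have := congrArg (eval t0) h
    simp only [eval_mul, eval_zero, hlead, htop] at this
    exact mul_ne_zero (mul_ne_zero (mul_ne_zero hg.lead hg.top) hT1) hT2 this
  · intro t ht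
    simp only [eval_mul, hlead, htop] at ht
    have c2 := right_ne_zero_of_mul ht
    have c1 := right_ne_zero_of_mul (left_ne_zero_of_mul ht)
    have c0 := right_ne_zero_of_mul (left_ne_zero_of_mul (left_ne_zero_of_mul ht))
    have cl := left_ne_zero_of_mul (left_ne_zero_of_mul (left_ne_zero_of_mul ht))
    refine ⟨cl, ?_, c0, ?_⟩
    · have := hT1' t c1
      rwa [hA, hB, linL_coeff, linL_coeff] at this
    · have := hT2' t c2
      rwa [← derivative_map, hE] at this

end Ell

namespace Ell
open Polynomial
open scoped Polynomial.Bivariate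

/-- intersection polynomial -/
noncomputable def Iab (D N D' N' : ℂ[X]) (c : ℂ) : ℂ[X] := N * D' - N' * D + C c * (D * D')

lemma not_both {p r : ℂ[X]} (h : IsCoprime p r) (z : ℂ) (hp : p.eval z = 0) (hr : r.eval z = 0) :
    False := by
  obtain ⟨x, y, hxy⟩ := h
  have := congrArg (eval z) hxy
  simp [hp, hr] at this

lemma cop_AB {D N D' N' : ℂ[X]} (h : IsCoprime D N) (h' : IsCoprime D' N') (hD : IsCoprime D D') :
    IsCoprime (N * D' - N' * D) (D * D') := by
  apply isCoprime_of_no_root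
  rintro z ⟨h1, h2⟩
  simp only [eval_mul, eval_sub] at h1 h2
  rcases mul_eq_zero.1 h2 with h3 | h3
  · rw [h3, mul_zero, sub_zero] at h1
    rcases mul_eq_zero.1 h1 with h4 | h4
    · exact not_both h z h3 h4
    · exact not_both hD z h3 h4
  · rw [h3, mul_zero, zero_sub, neg_eq_zero] at h1
    rcases mul_eq_zero.1 h1 with h4 | h4
    · exact not_both h' z h3 h4
    · exact not_both hD z h4 h3

lemma avoid (A B H : ℂ[X]) (hAB : IsCoprime A B) (hH : H ≠ 0) :
    ∃ S : Finset ℂ, ∀ c, c ∉ S → IsCoprime (A + C c * B) H := by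
  classical
  refine ⟨H.roots.toFinset.image (fun z => - A.eval z / B.eval z), fun c hc => ?_⟩
  apply isCoprime_of_no_root
  rintro z ⟨h1, h2⟩
  apply hc
  simp only [Finset.mem_image, Multiset.mem_toFinset, mem_roots hH]
  refine ⟨z, h2, ?_⟩
  simp only [eval_add, eval_mul, eval_C] at h1
  have hB : B.eval z ≠ 0 := by
    intro hB
    rw [hB, mul_zero, add_zero] at h1
    exact not_both hAB z h1 hB
  field_simp
  linear_combination -h1

lemma wronsk_ne {A B : ℂ[X]} (hAB : IsCoprime A B) (h : A.natDegree ≠ B.natDegree) :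
    A * derivative B - derivative A * B ≠ 0 := by
  intro h0
  have h1 : B ∣ derivative B := by
    apply hAB.symm.dvd_of_dvd_mul_left
    exact ⟨derivative A, by linear_combination h0⟩
  have h2 : A ∣ derivative A := by
    apply hAB.dvd_of_dvd_mul_right
    exact ⟨derivative B, by linear_combination -h0⟩
  rw [dvd_derivative_iff] at h1 h2
  apply h
  rw [derivative_eq_zero.1 h1, derivative_eq_zero.1 h2]

/-- choice of the parameters -/
lemma choose_c (J : ℕ) (D N D' N' : ℕ → ℂ[X]) (n : ℕ)
    (h : ∀ i < n, IsCoprime (D i) (N i)) (h' : ∀ j < J, IsCoprime (D' j) (N' j))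
    (hD : ∀ i < n, ∀ j < J, IsCoprime (D i) (D' j))
    (hdeg : ∀ i < n, ∀ j < J, (N i * D' j - N' j * D i).natDegree ≠ (D i * D' j).natDegree)
    (hne : ∀ j < J, ∀ j' < J, j ≠ j' → D' j * N' j' - D' j' * N' j ≠ 0) :
    ∃ c : ℕ → ℂ, (∀ i < n, c i ≠ 0) ∧
      (∀ i < n, ∀ j < J, (Iab (D i) (N i) (D' j) (N' j) (c i)).Separable) ∧
      (∀ i < n, ∀ j < J, ∀ j' < J, j ≠ j' → IsCoprime (Iab (D i) (N i) (D' j) (N' j) (c i))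
        (Iab (D i) (N i) (D' j') (N' j') (c i))) ∧
      (∀ i < n, ∀ i' < i, ∀ j < J, ∀ j' < J, IsCoprime (Iab (D i) (N i) (D' j) (N' j) (c i))
        (Iab (D i') (N i') (D' j') (N' j') (c i'))) := by
  classical
  induction n with
  | zero => exact ⟨fun _ => 0, by simp, by simp, by simp, by simp⟩
  | succ n ih =>
    obtain ⟨c, h1, h2, h3, h4⟩ := ih (fun i hi => h i (by omega)) (fun i hi => hD i (by omega))
      (fun i hi => hdeg i (by omega))
    have hI : ∀ i < n, ∀ j < J, Iab (D i) (N i) (D' j) (N' j) (c i) ≠ 0 := fun i hi j hj =>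
      (h2 i hi j hj).ne_zero
    have hAB : ∀ j < J, IsCoprime (N n * D' j - N' j * D n) (D n * D' j) := fun j hj =>
      cop_AB (h n (by omega)) (h' j hj) (hD n (by omega) j hj)
    have key : ∀ j : ℕ, ∀ H : ℂ[X], ∃ S : Finset ℂ, j < J → H ≠ 0 → ∀ c, c ∉ S →
        IsCoprime (Iab (D n) (N n) (D' j) (N' j) c) H := by
      intro j H
      by_cases hj : j < J
      · by_cases hH : H = 0
        · exact ⟨∅, fun _ h => absurd hH h⟩
        · obtain ⟨S, hS⟩ := avoid _ _ H (hAB j hj) hH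
          exact ⟨S, fun _ _ => hS⟩
      · exact ⟨∅, fun h => absurd h hj⟩
    choose S hS using key
    obtain ⟨x, hx⟩ := Infinite.exists_notMem_finset
      ({0} ∪ (Finset.range J).biUnion (fun j =>
        S j ((N n * D' j - N' j * D n) * derivative (D n * D' j)
            - derivative (N n * D' j - N' j * D n) * (D n * D' j)) ∪
          ((Finset.range J).biUnion (fun j' => S j (D' j * N' j' - D' j' * N' j) ∪
            (Finset.range n).biUnion (fun i' => S j (Iab (D i') (N i') (D' j') (N' j') (c i')))))))
    simp only [Finset.mem_union, Finset.mem_singleton, Finset.mem_biUnion, Finset.mem_range,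
      not_or, not_exists, not_and] at hx
    obtain ⟨hx0, hx⟩ := hx
    refine ⟨Function.update c n x, ?_, ?_, ?_, ?_⟩
    · intro i hi
      rcases eq_or_ne i n with rfl | hin
      · simpa using hx0
      · simpa [hin] using h1 i (by omega)
    · intro i hi j hj
      rcases eq_or_ne i n with rfl | hin
      · rw [Function.update_self]
        have := hS j _ hj (wronsk_ne (hAB j hj) (hdeg i hi j hj)) x (hx j hj).1
        apply isCoprime_of_no_root
        rintro z ⟨e1, e2⟩
        apply not_both this z e1
        simp only [Iab, derivative_add, derivative_C_mul, eval_add, eval_mul, eval_C,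
          eval_sub] at e1 e2 ⊢
        linear_combination (eval z (derivative (D i * D' j))) * e1
          - (eval z (D i) * eval z (D' j)) * e2
      · simpa [hin] using h2 i (by omega) j hj
    · intro i hi j hj j' hj' hjj
      rcases eq_or_ne i n with rfl | hin
      · rw [Function.update_self]
        have := hS j _ hj (hne j hj j' hj' hjj) x ((hx j hj).2 j' hj').1
        apply isCoprime_of_no_root
        rintro z ⟨e1, e2⟩
        apply not_both this z e1
        by_cases hDz : (D i).eval z = 0
        · exfalso
          apply not_both (hAB j hj) z
          · simp only [Iab, eval_add, eval_mul, eval_C, eval_sub, hDz] at e1 ⊢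
            linear_combination e1
          · simp [hDz]
        · apply mul_left_cancel₀ hDz
          simp only [Iab, eval_add, eval_mul, eval_C, eval_sub] at e1 e2 ⊢
          linear_combination (eval z (D' j')) * e1 - eval z (D' j) * e2
      · simpa [hin] using h3 i (by omega) j hj j' hj' hjj
    · intro i hi i' hi' j hj j' hj'
      rcases eq_or_ne i n with rfl | hin
      · rw [Function.update_self, Function.update_of_ne (by omega)]
        exact hS j _ hj (hI i' hi' j' hj') x (((hx j hj).2 j' hj').2 i' hi')
      · rw [Function.update_of_ne hin, Function.update_of_ne (by omega)]
        exact h4 i (by omega) i' hi' j hj j' hj'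

noncomputable def facA (D N : ℂ[X]) (c : ℂ) : ℂ[X][Y] := C D * (X - C (C c)) - C N
noncomputable def facB (D N : ℂ[X]) : ℂ[X][Y] := C D * X - C N

lemma facA_eval (D N : ℂ[X]) (c z w : ℂ) :
    (facA D N c).evalEval z w = D.eval z * (w - c) - N.eval z := by
  simp [facA, evalEval]
lemma facB_eval (D N : ℂ[X]) (z w : ℂ) :
    (facB D N).evalEval z w = D.eval z * w - N.eval z := by
  simp [facB, evalEval]

lemma evalEval_prod {ι : Type*} (s : Finset ι) (f : ι → ℂ[X][Y]) (z w : ℂ) :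
    (∏ i ∈ s, f i).evalEval z w = ∏ i ∈ s, (f i).evalEval z w := by
  rw [← coe_evalEvalRingHom, map_prod]

lemma good_of_factors (q : ℕ) (D N D' N' : ℕ → ℂ[X]) (c : ℕ → ℂ)
    (hp : Pair q (∏ i ∈ Finset.range (q + 3), facA (D i) (N i) (c i))
      (∏ j ∈ Finset.range (q + 2), facB (D' j) (N' j)))
    (hlead : ((∏ i ∈ Finset.range (q + 3), facA (D i) (N i) (c i)).coeff (q + 3)).coeff q ≠ 0)
    (hcop : IsCoprime ((∏ i ∈ Finset.range (q + 3), facA (D i) (N i) (c i)).coeff (q + 3))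
      ((∏ j ∈ Finset.range (q + 2), facB (D' j) (N' j)).coeff (q + 2)))
    (h' : ∀ j < q + 2, IsCoprime (D' j) (N' j))
    (h : ∀ i < q + 3, IsCoprime (D i) (N i))
    (hD : ∀ i < q + 3, ∀ j < q + 2, IsCoprime (D i) (D' j))
    (h2 : ∀ i < q + 3, ∀ j < q + 2, (Iab (D i) (N i) (D' j) (N' j) (c i)).Separable)
    (h3 : ∀ i < q + 3, ∀ j < q + 2, ∀ j' < q + 2, j ≠ j' →
      IsCoprime (Iab (D i) (N i) (D' j) (N' j) (c i)) (Iab (D i) (N i) (D' j') (N' j') (c i)))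
    (h4 : ∀ i < q + 3, ∀ i' < i, ∀ j < q + 2, ∀ j' < q + 2,
      IsCoprime (Iab (D i) (N i) (D' j) (N' j) (c i)) (Iab (D i') (N i') (D' j') (N' j') (c i')))
    (hdeg : mu q ≤ ∑ i ∈ Finset.range (q + 3), ∑ j ∈ Finset.range (q + 2),
      (Iab (D i) (N i) (D' j) (N' j) (c i)).natDegree) :
    Good q (∏ i ∈ Finset.range (q + 3), facA (D i) (N i) (c i))
      (∏ j ∈ Finset.range (q + 2), facB (D' j) (N' j)) := by
  classical
  set a := ∏ i ∈ Finset.range (q + 3), facA (D i) (N i) (c i) with ha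
  set b := ∏ j ∈ Finset.range (q + 2), facB (D' j) (N' j) with hb
  set I : ℕ → ℕ → ℂ[X] := fun i j => Iab (D i) (N i) (D' j) (N' j) (c i) with hI
  set P := ∏ i ∈ Finset.range (q + 3), ∏ j ∈ Finset.range (q + 2), I i j with hP
  have hPsep : P.Separable := by
    apply separable_prod'
    · intro i hi i' hi' hii
      simp only [Finset.mem_range] at hi hi'
      apply IsCoprime.prod_left
      intro j hj
      apply IsCoprime.prod_right
      intro j' hj'
      simp only [Finset.mem_range] at hj hj'
      rcases lt_or_gt_of_ne hii with hlt | hlt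
      · exact (h4 i' hi' i hlt j' hj' j hj).symm
      · exact h4 i hi i' hlt j hj j' hj'
    · intro i hi
      simp only [Finset.mem_range] at hi
      apply separable_prod'
      · intro j hj j' hj' hjj
        simp only [Finset.mem_range] at hj hj'
        exact h3 i hi j hj j' hj' hjj
      · intro j hj
        simp only [Finset.mem_range] at hj
        exact h2 i hi j hj
  have hPdeg : mu q ≤ P.natDegree := by
    rw [hP, natDegree_prod]
    · refine hdeg.trans (le_of_eq ?_)
      refine Finset.sum_congr rfl fun i hi => ?_
      rw [natDegree_prod]
      intro j hj
      simp only [Finset.mem_range] at hi hj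
      exact (h2 i hi j hj).ne_zero
    · intro i hi
      rw [Finset.prod_ne_zero_iff]
      intro j hj
      simp only [Finset.mem_range] at hi hj
      exact (h2 i hi j hj).ne_zero
  have hmem : ∀ z, P.eval z = 0 ↔ ∃ w, a.evalEval z w = 0 ∧ b.evalEval z w = 0 := by
    intro z
    simp only [ha, hb, evalEval_prod, facA_eval, facB_eval, Finset.prod_eq_zero_iff]
    constructor
    · intro hz
      rw [hP, eval_prod, Finset.prod_eq_zero_iff] at hz
      obtain ⟨i, hi, hz⟩ := hz
      rw [eval_prod, Finset.prod_eq_zero_iff] at hz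
      obtain ⟨j, hj, hz⟩ := hz
      simp only [Finset.mem_range] at hi hj
      have hDj : (D' j).eval z ≠ 0 := by
        intro h0
        apply not_both (cop_AB (h i hi) (h' j hj) (hD i hi j hj)) z
        · simp only [hI, Iab, eval_add, eval_mul, eval_C, eval_sub, h0] at hz ⊢
          linear_combination hz
        · simp [h0]
      refine ⟨(N' j).eval z / (D' j).eval z, ⟨i, by simpa using hi, ?_⟩, ⟨j, by simpa using hj, ?_⟩⟩
      · simp only [hI, Iab, eval_add, eval_mul, eval_C, eval_sub] at hz
        field_simp
        linear_combination -hz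
      · field_simp; ring
    · rintro ⟨w, ⟨i, hi, e1⟩, ⟨j, hj, e2⟩⟩
      rw [hP, eval_prod]
      apply Finset.prod_eq_zero hi
      rw [eval_prod]
      apply Finset.prod_eq_zero hj
      simp only [hI, Iab, eval_add, eval_mul, eval_C, eval_sub]
      linear_combination - (eval z (D' j)) * e1 + (eval z (D i)) * e2
  set E := elim q a b with hE
  have hEroot : ∀ z, P.eval z = 0 → E.eval z = 0 := by
    intro z hz
    obtain ⟨w, e1, e2⟩ := (hmem z).1 hz
    exact (elim_deriv q a b z w hp.ha.natDegree_le hp.hb.natDegree_le e1 e2).1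
  have hPne : P ≠ 0 := hPsep.ne_zero
  have hane : a.coeff (q + 3) ≠ 0 := fun h0 => hlead (by rw [h0]; simp)
  have hEne : E ≠ 0 := by
    intro hE0
    obtain ⟨z, hz⟩ : ∃ z, (P * a.coeff (q + 3)).eval z ≠ 0 := by
      by_contra hcon
      push Not at hcon
      exact mul_ne_zero hPne hane (Polynomial.funext (by simpa using hcon))
    rw [eval_mul] at hz
    apply left_ne_zero_of_mul hz
    rw [hmem]
    exact exists_common_zero q a b z hp.ha.natDegree_le hp.hb.natDegree_le
      (by rw [← hE, hE0]; simp) (Or.inl (right_ne_zero_of_mul hz))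
  have hc1 : P.roots.toFinset.card = P.natDegree := by
    rw [Multiset.toFinset_card_of_nodup (nodup_roots hPsep),
      splits_iff_card_roots.1 (IsAlgClosed.splits P)]
  have hc2 : P.roots.toFinset.card ≤ E.roots.toFinset.card := by
    apply Finset.card_le_card
    intro z hz
    simp only [Multiset.mem_toFinset, mem_roots hPne, mem_roots hEne] at hz ⊢
    exact hEroot z hz
  have hc3 := Multiset.toFinset_card_le E.roots
  have hc4 := card_roots' E
  have hc5 : E.natDegree ≤ mu q := elim_natDegree q a b hp.ha hp.hb
  refine ⟨hlead, hcop, ?_, ?_⟩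
  · rw [← hE, show mu q = E.natDegree by omega]
    exact leadingCoeff_ne_zero.2 hEne
  · have hnd : E.roots.Nodup := by
      rw [← Multiset.toFinset_card_eq_card_iff_nodup]; omega
    exact (nodup_roots_iff_of_splits hEne (IsAlgClosed.splits E)).1 hnd

end Ell

namespace Ell
open Polynomial
open scoped Polynomial.Bivariate

noncomputable def exD (q i : ℕ) : ℂ[X] := if i < q then X - C (i : ℂ) else 1
noncomputable def exN (q i : ℕ) : ℂ[X] := if i < q then 1 else if i = q then 0 else
  C ((i : ℂ) - q + 2) * X
noncomputable def exD' (q j : ℕ) : ℂ[X] := if j ≤ q then X + C ((j : ℂ) + 1) else 1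
noncomputable def exN' (q j : ℕ) : ℂ[X] := if j < q then 1 else if j = q then
  X * (X + C ((j : ℂ) + 1)) + 1 else C 2 * X

lemma natDegree_max {A B : ℂ[X]} {x y : ℕ} (hA : A.natDegree = x) (hB : B.natDegree = y)
    (h : x ≠ y) (c : ℂ) (hc : c ≠ 0) : max x y ≤ (A + C c * B).natDegree := by
  have hB' : (C c * B).natDegree = y := by rw [natDegree_C_mul hc, hB]
  rcases lt_or_gt_of_ne h with h | h
  · rw [natDegree_add_eq_right_of_natDegree_lt (by omega)]; omega
  · rw [natDegree_add_eq_left_of_natDegree_lt (by omega)]; omega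

def dA (q i j : ℕ) : ℕ := if i < q then (if j < q then 0 else if j = q then 3 else 2) else
  if i = q then (if j < q then 0 else if j = q then 2 else 1) else (if j ≤ q then 2 else 1)
def dB (q i j : ℕ) : ℕ := (if i < q then 1 else 0) + (if j ≤ q then 1 else 0)

lemma natCast_add_one_ne (i j : ℕ) : (i : ℂ) + (j + 1) ≠ 0 := by
  have : ((i + (j + 1) : ℕ) : ℂ) ≠ 0 := Nat.cast_ne_zero.2 (by omega)
  exact_mod_cast this

lemma hdA (q i j : ℕ) (hi : i < q + 3) (hj : j < q + 2) :
    (exN q i * exD' q j - exN' q j * exD q i).natDegree = dA q i j := by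
  unfold exN exD exN' exD' dA
  by_cases h1 : i < q
  · simp only [h1, if_true]
    by_cases h2 : j < q
    · simp only [h2, if_true, h2.le]
      rw [show (1 : ℂ[X]) * (X + C ((j : ℂ) + 1)) - 1 * (X - C (i : ℂ)) = C ((i : ℂ) + (j + 1)) by
        simp only [C_add]; ring]
      exact natDegree_C _
    · simp only [h2, if_false]
      by_cases h3 : j = q
      · subst h3
        simp only [if_true, le_refl]
        compute_degree!
      · simp only [h3, if_false, show ¬ j ≤ q by omega]
        compute_degree!
  · simp only [h1, if_false]
    by_cases h4 : i = q
    · subst h4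
      simp only [if_true]
      by_cases h2 : j < i
      · simp only [h2, if_true, h2.le]
        simp
      · simp only [h2, if_false]
        by_cases h3 : j = i
        · subst h3
          simp only [if_true, le_refl]
          compute_degree!
        · simp only [h3, if_false, show ¬ j ≤ i by omega]
          compute_degree!
    · simp only [h4, if_false]
      obtain ⟨e, rfl⟩ : ∃ e, i = q + 1 + e := ⟨i - (q + 1), by omega⟩
      have he1 : ((e : ℂ) + 1 + 2) ≠ 0 := by exact_mod_cast (by omega : e + 1 + 2 ≠ 0)
      have he2 : ((e : ℂ) + 1 + 1) ≠ 0 := by exact_mod_cast (by omega : e + 1 + 1 ≠ 0)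
      have he3 : ((e : ℂ) + 1) ≠ 0 := by exact_mod_cast (by omega : e + 1 ≠ 0)
      rw [show ((q + 1 + e : ℕ) : ℂ) - q + 2 = (e : ℂ) + 1 + 2 by push_cast; ring]
      by_cases h2 : j < q
      · simp only [h2, if_true, h2.le]
        rw [show C ((e : ℂ) + 1 + 2) * X * (X + C ((j : ℂ) + 1)) - 1 * 1
          = C ((e : ℂ) + 1 + 2) * X ^ 2 + C (((e : ℂ) + 1 + 2) * ((j : ℂ) + 1)) * X + C (-1) by
          simp only [C_mul, C_neg, C_1]; ring]
        exact natDegree_quadratic he1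
      · simp only [h2, if_false]
        by_cases h3 : j = q
        · subst h3
          simp only [if_true, le_refl]
          rw [show C ((e : ℂ) + 1 + 2) * X * (X + C ((j : ℂ) + 1)) - (X * (X + C ((j : ℂ) + 1)) + 1) * 1
            = C ((e : ℂ) + 1 + 1) * X ^ 2 + C (((e : ℂ) + 1 + 1) * ((j : ℂ) + 1)) * X + C (-1) by
            simp only [C_mul, C_neg, C_1, C_add, C_ofNat]; ring]
          exact natDegree_quadratic he2
        · simp only [h3, if_false, show ¬ j ≤ q by omega]
          rw [show C ((e : ℂ) + 1 + 2) * X * 1 - C 2 * X * 1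
            = C ((e : ℂ) + 1) * X + C 0 by
            simp only [C_0, C_add]; ring]
          exact natDegree_linear he3

lemma hdB (q i j : ℕ) : (exD q i * exD' q j).natDegree = dB q i j := by
  unfold exD exD' dB
  rw [natDegree_mul]
  · congr 1
    · split_ifs
      · exact natDegree_X_sub_C _
      · simp
    · split_ifs
      · exact natDegree_X_add_C _
      · simp
  · split_ifs
    · exact X_sub_C_ne_zero _
    · exact one_ne_zero
  · split_ifs
    · exact X_add_C_ne_zero _
    · exact one_ne_zero

lemma ex_h (q i : ℕ) : IsCoprime (exD q i) (exN q i) := by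
  unfold exD exN
  split_ifs
  · exact isCoprime_one_right
  · exact isCoprime_one_left
  · exact isCoprime_one_left

lemma ex_h' (q j : ℕ) : IsCoprime (exD' q j) (exN' q j) := by
  unfold exD' exN'
  split_ifs
  · exact isCoprime_one_right
  · exact ⟨-X, 1, by ring⟩
  · omega
  · exact isCoprime_one_left
  · exact isCoprime_one_left
  · exact isCoprime_one_left

lemma ex_hD (q i j : ℕ) : IsCoprime (exD q i) (exD' q j) := by
  unfold exD exD'
  split_ifs
  · apply isCoprime_of_no_root
    rintro z ⟨h1, h2⟩
    simp at h1 h2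
    apply natCast_add_one_ne i j
    linear_combination h2 - h1
  · exact isCoprime_one_right
  · exact isCoprime_one_left
  · exact isCoprime_one_left

lemma ex_ne_lt (q j j' : ℕ) (hj' : j' < q + 2) (h : j < j') :
    exD' q j * exN' q j' - exD' q j' * exN' q j ≠ 0 := by
  intro h0
  have := congrArg (eval (-((j : ℂ) + 1))) h0
  have e1 : (exD' q j).eval (-((j : ℂ) + 1)) = 0 := by
    unfold exD'; rw [if_pos (by omega)]; simp
  have e2 : (exN' q j).eval (-((j : ℂ) + 1)) = 1 := by
    unfold exN'
    split_ifs
    · simp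
    · simp
    · omega
  have e3 : (exD' q j').eval (-((j : ℂ) + 1)) ≠ 0 := by
    unfold exD'
    split_ifs
    · simp only [eval_add, eval_X, eval_C]
      intro h1
      have : (j : ℂ) = j' := by linear_combination -h1
      have := Nat.cast_injective this
      omega
    · simp
  simp only [eval_sub, eval_mul, e1, e2, eval_zero] at this
  apply e3
  linear_combination -this

lemma facA_cls (q i : ℕ) (c : ℂ) : Cls (if i < q then 1 else if i = q then 0 else 1) 1
    (if i < q then 2 else 1) (facA (exD q i) (exN q i) c) := by
  have hX : Cls 0 1 1 ((X : ℂ[X][Y]) - C (C c)) := Cls.w.sub (Cls.CC _ _ _ c)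
  have hCX : ∀ x : ℂ, Cls 1 0 1 (C (X - C x) : ℂ[X][Y]) := fun x => by
    rw [C_sub]; exact Cls.z.sub (Cls.CC _ _ _ _)
  unfold facA exD exN
  split_ifs with h1 h2
  · refine (((hCX _).mul hX).mono ?_ ?_ ?_).sub ?_ <;> try omega
    simpa using Cls.one 1 1 2
  · simpa using hX
  · refine Cls.sub (by simpa using hX.mono (by omega) (by omega) (by omega)) ?_
    rw [C_mul]
    exact (Cls.z.smul _).mono (by omega) (by omega) (by omega)

lemma facB_cls (q j : ℕ) : Cls (if j = q then 2 else 1) 1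
    (if j ≤ q then 2 else 1) (facB (exD' q j) (exN' q j)) := by
  have hX : Cls 0 1 1 ((X : ℂ[X][Y])) := Cls.w
  have hCX : ∀ x : ℂ, Cls 1 0 1 (C (X + C x) : ℂ[X][Y]) := fun x => by
    rw [C_add]; exact Cls.z.add (Cls.CC _ _ _ _)
  have hone : ∀ d e t, Cls d e t (C 1 : ℂ[X][Y]) := fun d e t => by simpa using Cls.one d e t
  unfold facB exD' exN'
  split_ifs with h1 h2 h3 h4
  all_goals try omega
  · refine (((hCX _).mul hX).mono ?_ ?_ ?_).sub ?_ <;> try omega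
    rw [C_add, C_mul]
    exact ((Cls.z.mul (hCX _)).mono (by omega) (by omega) (by omega)).add (hone _ _ _)
  · exact (((hCX _).mul hX).mono (by omega) (by omega) (by omega)).sub (hone _ _ _)
  · refine Cls.sub (by simpa using hX.mono (by omega) (by omega) (by omega)) ?_
    rw [C_mul]
    exact (Cls.z.smul _).mono (by omega) (by omega) (by omega)

lemma facA_coeff (D N : ℂ[X]) (c : ℂ) : (facA D N c).coeff 1 = D := by
  simp [facA, coeff_C, mul_sub]
lemma facB_coeff (D N : ℂ[X]) : (facB D N).coeff 1 = D := by
  simp [facB, coeff_C]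

theorem exists_good (q : ℕ) : ∃ a b : ℂ[X][Y], Pair q a b ∧ Good q a b := by
  obtain ⟨c, h1, h2, h3, h4⟩ := choose_c (q + 2) (exD q) (exN q) (exD' q) (exN' q) (q + 3)
    (fun i _ => ex_h q i) (fun j _ => ex_h' q j) (fun i _ j _ => ex_hD q i j)
    (fun i hi j hj => by
      rw [hdA q i j hi hj, hdB]
      unfold dA dB; split_ifs <;> omega)
    (fun j hj j' hj' hjj => by
      rcases lt_or_gt_of_ne hjj with h | h
      · exact ex_ne_lt q j j' hj' h
      · have := ex_ne_lt q j' j hj h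
        intro h0; apply this; linear_combination -h0)
  have hP : Pair q (∏ i ∈ Finset.range (q + 3), facA (exD q i) (exN q i) (c i))
      (∏ j ∈ Finset.range (q + 2), facB (exD' q j) (exN' q j)) := by
    constructor
    · refine (Cls.prod (Finset.range (q + 3)) _ _ _ _ (fun i _ => facA_cls q i (c i))).mono ?_ ?_ ?_
      · rw [Finset.sum_range_succ, Finset.sum_range_succ, Finset.sum_range_succ,
          Finset.sum_congr rfl (g := fun _ => 1) (fun i hi => by
            rw [if_pos (Finset.mem_range.1 hi)])]
        simp
      · simp
      · rw [Finset.sum_range_succ, Finset.sum_range_succ, Finset.sum_range_succ,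
          Finset.sum_congr rfl (g := fun _ => 2) (fun i hi => by
            rw [if_pos (Finset.mem_range.1 hi)])]
        simp; omega
    · refine (Cls.prod (Finset.range (q + 2)) _ _ _ _ (fun i _ => facB_cls q i)).mono ?_ ?_ ?_
      · rw [Finset.sum_range_succ, Finset.sum_range_succ,
          Finset.sum_congr rfl (g := fun _ => 1) (fun i hi => by
            rw [if_neg (Finset.mem_range.1 hi).ne])]
        simp
      · simp
      · rw [Finset.sum_range_succ, Finset.sum_range_succ, 
          Finset.sum_congr rfl (g := fun _ => 2) (fun i hi => by
            rw [if_pos (Finset.mem_range.1 hi).le])]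
        simp; omega
  have hca : (∏ i ∈ Finset.range (q + 3), facA (exD q i) (exN q i) (c i)).coeff (q + 3)
      = ∏ i ∈ Finset.range (q + 3), exD q i := by
    have := coeff_prod_of_natDegree_le (s := Finset.range (q + 3))
      (f := fun i => facA (exD q i) (exN q i) (c i)) (n := 1)
      (fun i _ => (facA_cls q i (c i)).natDegree_le)
    simpa [facA_coeff] using this
  have hcb : (∏ j ∈ Finset.range (q + 2), facB (exD' q j) (exN' q j)).coeff (q + 2)
      = ∏ j ∈ Finset.range (q + 2), exD' q j := by
    have := coeff_prod_of_natDegree_le (s := Finset.range (q + 2))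
      (f := fun i => facB (exD' q i) (exN' q i)) (n := 1)
      (fun i _ => (facB_cls q i).natDegree_le)
    simpa [facB_coeff] using this
  refine ⟨_, _, hP, good_of_factors q _ _ _ _ c hP ?_ ?_ (fun j _ => ex_h' q j) (fun i _ => ex_h q i)
    (fun i _ j _ => ex_hD q i j) h2 h3 h4 ?_⟩
  · rw [hca, Finset.prod_range_succ, Finset.prod_range_succ, Finset.prod_range_succ,
      Finset.prod_congr rfl (g := fun i : ℕ => X - C (i : ℂ)) (fun i hi => by
        rw [exD, if_pos (Finset.mem_range.1 hi)])]
    have hm : (∏ i ∈ Finset.range q, (X - C (i : ℂ))).Monic := monic_prod_of_monic _ _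
      (fun i _ => monic_X_sub_C _)
    have hn : (∏ i ∈ Finset.range q, (X - C (i : ℂ))).natDegree = q := by
      rw [natDegree_prod_of_monic _ _ (fun i _ => monic_X_sub_C _)]; simp only [natDegree_X_sub_C]; simp
    have : (∏ i ∈ Finset.range q, (X - C (i : ℂ))).coeff q = 1 := by
      have := hm.coeff_natDegree
      rwa [hn] at this
    simp only [exD, lt_irrefl, if_false, mul_one, show ¬ q + 1 < q by omega, show ¬ q + 2 < q by omega, this]
    exact one_ne_zero
  · rw [hca, hcb]
    exact IsCoprime.prod_left fun i _ => IsCoprime.prod_right fun j _ => ex_hD q i j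
  · have hle : ∀ i ∈ Finset.range (q + 3), ∀ j ∈ Finset.range (q + 2),
        max (dA q i j) (dB q i j) ≤ (Iab (exD q i) (exN q i) (exD' q j) (exN' q j) (c i)).natDegree := by
      intro i hi j hj
      simp only [Finset.mem_range] at hi hj
      exact natDegree_max (hdA q i j hi hj) (hdB q i j) (by unfold dA dB; split_ifs <;> omega) _ (h1 i hi)
    refine le_trans ?_ (Finset.sum_le_sum fun i hi => Finset.sum_le_sum fun j hj => hle i hi j hj)
    have r1 : ∀ i ∈ Finset.range q, ∑ j ∈ Finset.range (q + 2), max (dA q i j) (dB q i j) = 2 * q + 5 := by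
      intro i hi
      have hi := Finset.mem_range.1 hi
      rw [Finset.sum_range_succ, Finset.sum_range_succ, Finset.sum_congr rfl (g := fun _ => 2)]
      · simp [dA, dB, hi]; omega
      · intro j hj
        have hj := Finset.mem_range.1 hj
        simp [dA, dB, hi, hj, hj.le]
    have r2 : ∑ j ∈ Finset.range (q + 2), max (dA q q j) (dB q q j) = q + 3 := by
      rw [Finset.sum_range_succ, Finset.sum_range_succ, Finset.sum_congr rfl (g := fun _ => 1)]
      · simp [dA, dB]
      · intro j hj
        have hj := Finset.mem_range.1 hj
        simp [dA, dB, hj, hj.le]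
    have r3 : ∀ i, q < i → ∑ j ∈ Finset.range (q + 2), max (dA q i j) (dB q i j) = 2 * q + 3 := by
      intro i hi
      rw [Finset.sum_range_succ, Finset.sum_range_succ, Finset.sum_congr rfl (g := fun _ => 2)]
      · simp [dA, dB, hi.not_gt, hi.ne']; omega
      · intro j hj
        have hj := Finset.mem_range.1 hj
        simp [dA, dB, hj.le, hi.not_gt, hi.ne']
    rw [Finset.sum_range_succ, Finset.sum_range_succ, Finset.sum_range_succ, Finset.sum_congr rfl r1,
      r2, r3 _ (by omega), r3 _ (by omega)]
    simp [mu]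
    nlinarith

end Ell

namespace Ell
open Polynomial
open scoped Polynomial.Bivariate ComplexConjugate

/-- the real structure `p ↦ conj (p (conj w, conj z))` -/
noncomputable def sg : ℂ[X][Y] →+* ℂ[X][Y] :=
  ((Bivariate.swap (R := ℂ)).toRingEquiv.toRingHom).comp (mapRingHom (mapRingHom (starRingEnd ℂ)))

lemma sg_mono (n m : ℕ) (r : ℂ) : sg (monomial n (monomial m r)) = monomial m (monomial n (conj r)) := by
  simp only [sg, RingHom.comp_apply, coe_mapRingHom, map_monomial]
  exact Bivariate.swap_monomial_monomial n m (conj r)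

lemma bi_induction {P : ℂ[X][Y] → Prop} (p : ℂ[X][Y]) (hadd : ∀ p r, P p → P r → P (p + r))
    (hm : ∀ n m r, P (monomial n (monomial m r))) : P p := by
  induction p using Polynomial.induction_on' with
  | add p r hp hr => exact hadd p r hp hr
  | monomial n f =>
    induction f using Polynomial.induction_on' with
    | add f g hf hg => rw [map_add]; exact hadd _ _ hf hg
    | monomial m r => exact hm n m r

lemma coeff_sg (p : ℂ[X][Y]) (i j : ℕ) : ((sg p).coeff j).coeff i = conj ((p.coeff i).coeff j) := by
  induction p using bi_induction with
  | hadd p r hp hr => simp [hp, hr]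
  | hm n m r =>
    rw [sg_mono]
    simp only [coeff_monomial]
    by_cases h1 : m = j <;> by_cases h2 : n = i <;> simp [h1, h2, coeff_monomial]

lemma bi_ext {p r : ℂ[X][Y]} (h : ∀ i j, (p.coeff j).coeff i = (r.coeff j).coeff i) : p = r := by
  ext j i; exact h i j

lemma sg_sg (p : ℂ[X][Y]) : sg (sg p) = p := bi_ext fun i j => by simp [coeff_sg]

lemma evalEval_monomial (n m : ℕ) (r z w : ℂ) :
    (monomial n (monomial m r) : ℂ[X][Y]).evalEval z w = r * z ^ m * w ^ n := by
  simp [evalEval]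

lemma sg_eval (p : ℂ[X][Y]) (z w : ℂ) : (sg p).evalEval z w = conj (p.evalEval (conj w) (conj z)) := by
  induction p using bi_induction with
  | hadd p r hp hr => simp [hp, hr]
  | hm n m r =>
    rw [sg_mono, evalEval_monomial, evalEval_monomial]
    simp; ring

lemma dz_sg (p : ℂ[X][Y]) : dz (sg p) = sg (derivative p) := bi_ext fun i j => by
  rw [coeff_dz, coeff_derivative, coeff_sg, coeff_sg, coeff_derivative]
  rw [show ((i : ℂ[X]) + 1) = C ((i : ℂ) + 1) by simp, coeff_mul_C]; simp

lemma derivative_sg (p : ℂ[X][Y]) : derivative (sg p) = sg (dz p) := by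
  rw [← sg_sg (derivative (sg p)), ← dz_sg, sg_sg]

lemma sg_CC (c : ℂ) : sg (C (C c)) = C (C (conj c)) := by
  have := sg_mono 0 0 c
  simpa using this
lemma sg_z : sg (C X) = X := by
  have := sg_mono 0 1 1
  simpa [← X_pow_eq_monomial] using this
lemma sg_w : sg X = C X := by
  rw [← sg_z, sg_sg]

lemma Cls.sg {d e t : ℕ} {p : ℂ[X][Y]} (hp : Cls d e t p) : Cls e d t (sg p) := fun i j h => by
  rw [coeff_sg] at h
  have := hp j i (by simpa using h)
  omega

theorem exists_real_good (q : ℕ) : ∃ b : ℂ[X][Y], Pair q (sg b) b ∧ Good q (sg b) b := by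
  obtain ⟨a, b, hp, hg⟩ := exists_good q
  have hp0 : Pair q (sg b) (sg a) := ⟨hp.hb.sg, hp.ha.sg⟩
  have hp1 : Pair q (a - sg b) (b - sg a) := ⟨hp.ha.sub hp.hb.sg, hp.hb.sub hp.ha.sg⟩
  obtain ⟨T, hT, hT'⟩ := good_generic hp0 hp1 1 (by simpa [lin] using hg)
  have hinf : (Set.range (fun y : ℝ => (1 / 2 : ℂ) + y * Complex.I)).Infinite := by
    apply Set.infinite_range_of_injective
    intro x y hxy
    have := congrArg Complex.im hxy
    simpa using this
  obtain ⟨t, ⟨y, rfl⟩, ht⟩ := hinf.exists_notMem_finset T.roots.toFinset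
  simp only [Multiset.mem_toFinset, mem_roots hT, IsRoot.def] at ht
  have h1 := hT' _ ht
  refine ⟨lin (sg a) (b - sg a) ((1 / 2 : ℂ) + y * Complex.I), ?_⟩
  have h2 : sg (lin (sg a) (b - sg a) ((1 / 2 : ℂ) + y * Complex.I))
      = lin (sg b) (a - sg b) ((1 / 2 : ℂ) + y * Complex.I) := by
    have h3 : conj ((1 / 2 : ℂ) + y * Complex.I) = 1 - ((1 / 2 : ℂ) + y * Complex.I) := by
      simp only [map_add, map_mul, Complex.conj_ofReal, Complex.conj_I, map_div₀, map_one,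
        map_ofNat]
      ring
    generalize (1 / 2 : ℂ) + y * Complex.I = t at h3
    unfold lin
    rw [map_add, map_mul, map_sub, sg_sg, sg_CC, h3]
    simp only [C_sub, C_1]
    ring
  rw [h2]
  exact ⟨⟨hp0.ha.lin hp1.ha _, hp0.hb.lin hp1.hb _⟩, h1⟩

end Ell

namespace Ell
open Polynomial
open scoped Polynomial.Bivariate ComplexConjugate

lemma jac_conj (b : ℂ[X][Y]) (z w : ℂ) :
    jac (sg b) b (conj w) (conj z) = conj (jac (sg b) b z w) := by
  unfold jac
  rw [dz_sg, derivative_sg]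
  simp only [sg_eval, map_sub, map_mul, Complex.conj_conj]
  ring

lemma jac_real (b : ℂ[X][Y]) (z : ℂ) :
    jac (sg b) b z (conj z) = ((Complex.normSq ((derivative b).evalEval z (conj z))
      - Complex.normSq ((dz b).evalEval z (conj z)) : ℝ) : ℂ) := by
  unfold jac
  rw [dz_sg, derivative_sg]
  simp only [sg_eval, Complex.conj_conj]
  rw [mul_comm, Complex.mul_conj, Complex.ofReal_sub]
  congr 1
  first | rw [Complex.mul_conj] | rw [mul_comm, Complex.mul_conj]

lemma sg_fix_eval {W : ℂ[X][Y]} (hW : sg W = W) (z w : ℂ) :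
    W.evalEval (conj w) (conj z) = conj (W.evalEval z w) := by
  conv_lhs => rw [← hW]
  rw [sg_eval]; simp

/-- hermitian coefficient matrix -/
noncomputable def hcoef (d : ℕ) (x : Fin (d + 1) → Fin (d + 1) → ℝ) (i j : Fin (d + 1)) : ℂ :=
  ((x i j + x j i : ℝ) : ℂ) + ((x i j - x j i : ℝ) : ℂ) * Complex.I

noncomputable def hpoly (d : ℕ) (x : Fin (d + 1) → Fin (d + 1) → ℝ) : ℂ[X][Y] :=
  ∑ i : Fin (d + 1), ∑ j : Fin (d + 1), monomial (i : ℕ) (monomial (j : ℕ) (hcoef d x i j))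

lemma hpoly_sg (d : ℕ) (x : Fin (d + 1) → Fin (d + 1) → ℝ) : sg (hpoly d x) = hpoly d x := by
  unfold hpoly
  simp only [map_sum, sg_mono]
  rw [Finset.sum_comm]
  refine Finset.sum_congr rfl fun i _ => Finset.sum_congr rfl fun j _ => ?_
  congr 2
  unfold hcoef
  apply Complex.ext <;> simp <;> ring

lemma hpoly_coeff (d : ℕ) (x : Fin (d + 1) → Fin (d + 1) → ℝ) (i j : Fin (d + 1)) :
    ((hpoly d x).coeff i).coeff j = hcoef d x i j := by
  unfold hpoly
  simp only [finsetSum_coeff, coeff_monomial]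
  rw [Finset.sum_eq_single i]
  · simp only [if_true, finsetSum_coeff, coeff_monomial]
    rw [Finset.sum_eq_single j]
    · simp
    · intro j' _ hj; rw [if_neg (fun h => hj (Fin.ext h))]
    · simp
  · intro i' _ hi
    simp [show ¬ ((i' : ℕ) = i) from fun h => hi (Fin.ext h)]
  · simp

lemma monomial_cls (d i j : ℕ) (c : ℂ) (hi : i ≤ d) (hj : j ≤ d) :
    Cls d d (2 * d) (monomial i (monomial j c) : ℂ[X][Y]) := fun i' j' h => by
  rw [coeff_monomial] at h
  split_ifs at h with h1
  · rw [coeff_monomial] at h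
    split_ifs at h with h2
    · omega
    · simp at h
  · simp at h

lemma hpoly_cls (d : ℕ) (x : Fin (d + 1) → Fin (d + 1) → ℝ) : Cls d d (2 * d) (hpoly d x) :=
  Cls.sum _ _ fun i _ => Cls.sum _ _ fun j _ =>
    monomial_cls d i j _ (Nat.lt_succ_iff.1 i.2) (Nat.lt_succ_iff.1 j.2)

lemma hpoly_inj (d : ℕ) (x : Fin (d + 1) → Fin (d + 1) → ℝ) (h : hpoly d x = 0) : x = 0 := by
  funext i j
  have := hpoly_coeff d x i j
  rw [h] at this
  simp only [coeff_zero] at this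
  have h1 := congrArg Complex.re this
  have h2 := congrArg Complex.im this
  simp [hcoef] at h1 h2
  simp; linarith

lemma hpoly_eval (d : ℕ) (x : Fin (d + 1) → Fin (d + 1) → ℝ) (z w : ℂ) :
    (hpoly d x).evalEval z w = ∑ i : Fin (d + 1), ∑ j : Fin (d + 1), hcoef d x i j * z ^ (j : ℕ) * w ^ (i : ℕ) := by
  unfold hpoly
  rw [← coe_evalEvalRingHom]
  simp only [map_sum]
  simp only [coe_evalEvalRingHom, evalEval_monomial]

/-- the evaluation functional -/
noncomputable def hfun (d : ℕ) (s z w : ℂ) : (Fin (d + 1) → Fin (d + 1) → ℝ) →ₗ[ℝ] ℝ where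
  toFun x := (s * (hpoly d x).evalEval z w).im
  map_add' x y := by
    simp only [hpoly_eval]
    rw [← Complex.add_im, ← mul_add, ← Finset.sum_add_distrib]
    congr 2
    refine Finset.sum_congr rfl fun i _ => ?_
    rw [← Finset.sum_add_distrib]
    refine Finset.sum_congr rfl fun j _ => ?_
    simp only [hcoef, Pi.add_apply]; push_cast; ring
  map_smul' r x := by
    simp only [hpoly_eval, RingHom.id_apply, smul_eq_mul]
    have e : ∑ i : Fin (d + 1), ∑ j : Fin (d + 1), hcoef d (r • x) i j * z ^ (j : ℕ) * w ^ (i : ℕ)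
        = (r : ℂ) * ∑ i : Fin (d + 1), ∑ j : Fin (d + 1),
          hcoef d x i j * z ^ (j : ℕ) * w ^ (i : ℕ) := by
      rw [Finset.mul_sum]
      refine Finset.sum_congr rfl fun i _ => ?_
      rw [Finset.mul_sum]
      refine Finset.sum_congr rfl fun j _ => ?_
      simp only [hcoef, Pi.smul_apply, smul_eq_mul]; push_cast; ring
    rw [e, mul_left_comm, Complex.im_ofReal_mul]

def lx (z : ℂ) : ℝ ×ₗ ℝ := toLex (z.re, z.im)
lemma lx_inj {z w : ℂ} (h : lx z = lx w) : z = w := by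
  have := toLex.injective h
  simp only [Prod.mk.injEq] at this
  exact Complex.ext this.1 this.2

theorem sig_count {q d : ℕ} (hqd : q = 2 * d) {b W : ℂ[X][Y]} (hp : Pair q (sg b) b)
    (hg : Good q (sg b) b) (hW : Cls (q + 3) (q + 3) (2 * q + 3) W) (hWs : sg W = W)
    (Z : Finset (ℂ × ℂ)) (hZc : Z.card = mu q)
    (hZm : ∀ p, p ∈ Z ↔ (sg b).evalEval p.1 p.2 = 0 ∧ b.evalEval p.1 p.2 = 0)
    (hZj : ∀ p ∈ Z, jac (sg b) b p.1 p.2 ≠ 0)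
    (hEJ : ∀ F : ℂ[X][Y], Cls (2 * q + 3) (2 * q + 3) (4 * q + 3) F →
      ∑ p ∈ Z, F.evalEval p.1 p.2 / jac (sg b) b p.1 p.2 = 0)
    (hW0 : ∀ p ∈ Z, W.evalEval p.1 p.2 ≠ 0) :
    2 * (d + 1) ^ 2 + (Z.filter (fun p => p.1 = conj p.2)).card ≤
      2 * ((Z.filter (fun p => p.1 = conj p.2)).filter
        (fun p => (W.evalEval p.1 p.2 / jac (sg b) b p.1 p.2).re < 0)).card + mu q := by
  classical
  set R := Z.filter (fun p => p.1 = conj p.2) with hR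
  set Ng := R.filter (fun p => (W.evalEval p.1 p.2 / jac (sg b) b p.1 p.2).re < 0) with hNg
  set S1 := Z.filter (fun p => lx p.1 < lx (conj p.2)) with hS1
  set S2 := Z.filter (fun p => lx (conj p.2) < lx p.1) with hS2
  have hτ : ∀ p ∈ Z, (conj p.2, conj p.1) ∈ Z := by
    intro p hpZ
    rw [hZm] at hpZ ⊢
    simp only [sg_eval, Complex.conj_conj] at hpZ ⊢
    have h1 := congrArg conj hpZ.1
    rw [Complex.conj_conj, map_zero] at h1
    exact ⟨by rw [hpZ.2, map_zero], h1⟩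
  have hcard : Z.card = R.card + (S1.card + S2.card) := by
    have e : Z = R ∪ (S1 ∪ S2) := by
      ext p
      simp only [hR, hS1, hS2, Finset.mem_union, Finset.mem_filter]
      constructor
      · intro hpZ
        rcases lt_trichotomy (lx p.1) (lx (conj p.2)) with h | h | h
        · exact Or.inr (Or.inl ⟨hpZ, h⟩)
        · exact Or.inl ⟨hpZ, lx_inj h⟩
        · exact Or.inr (Or.inr ⟨hpZ, h⟩)
      · tauto
    have d1 : Disjoint S1 S2 := by
      rw [Finset.disjoint_left]
      intro p h1 h2
      simp only [hS1, hS2, Finset.mem_filter] at h1 h2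
      exact lt_asymm h1.2 h2.2
    have d2 : Disjoint R (S1 ∪ S2) := by
      rw [Finset.disjoint_left]
      intro p h1 h2
      simp only [hR, hS1, hS2, Finset.mem_filter, Finset.mem_union] at h1 h2
      rw [h1.2] at h2
      simp at h2
    conv_lhs => rw [e]
    rw [Finset.card_union_of_disjoint d2, Finset.card_union_of_disjoint d1]
  have hS12 : S1.card = S2.card := by
    refine Finset.card_bij' (fun p _ => (conj p.2, conj p.1)) (fun p _ => (conj p.2, conj p.1))
      ?_ ?_ ?_ ?_
    · intro p hp1
      simp only [hS1, hS2, Finset.mem_filter, Complex.conj_conj] at hp1 ⊢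
      exact ⟨hτ p hp1.1, hp1.2⟩
    · intro p hp1
      simp only [hS1, hS2, Finset.mem_filter, Complex.conj_conj] at hp1 ⊢
      exact ⟨hτ p hp1.1, hp1.2⟩
    · intro p _; simp
    · intro p _; simp
  by_contra hcon
  push Not at hcon
  set T := Ng ∪ S1 with hT
  have hTc : T.card < (d + 1) ^ 2 := by
    have := Finset.card_union_le Ng S1
    rw [← hT] at this
    omega
  have hsq : ∀ c : ℂ, ∃ s : ℂ, s ^ 2 = c := fun c => IsAlgClosed.exists_pow_nat_eq c (by norm_num)
  choose s hs using hsq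
  set ρ : ℂ × ℂ → ℂ := fun p => W.evalEval p.1 p.2 / jac (sg b) b p.1 p.2 with hρ
  have hρ0 : ∀ p ∈ Z, ρ p ≠ 0 := fun p hpZ => div_ne_zero (hW0 p hpZ) (hZj p hpZ)
  have hρτ : ∀ p : ℂ × ℂ, ρ (conj p.2, conj p.1) = conj (ρ p) := by
    intro p
    simp only [hρ, map_div₀]
    rw [sg_fix_eval hWs, jac_conj]
  set L : (Fin (d + 1) → Fin (d + 1) → ℝ) →ₗ[ℝ] (T → ℝ) :=
    LinearMap.pi (fun p => hfun d (s (ρ p)) p.1.1 p.1.2) with hL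
  have hker : LinearMap.ker L ≠ ⊥ := by
    apply LinearMap.ker_ne_bot_of_finrank_lt
    simp [Module.finrank_pi_fintype]
    nlinarith
  obtain ⟨x, hxk, hx0⟩ := (Submodule.ne_bot_iff _).1 hker
  have hxT : ∀ p ∈ T, (s (ρ p) * (hpoly d x).evalEval p.1 p.2).im = 0 := by
    intro p hpT
    have := congrFun (LinearMap.mem_ker.1 hxk) ⟨p, hpT⟩
    simpa [hL, hfun] using this
  set h := hpoly d x with hh
  have hhs : sg h = h := hpoly_sg d x
  set t : ℂ × ℂ → ℂ := fun p => ρ p * (h.evalEval p.1 p.2) ^ 2 with ht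
  have htτ : ∀ p : ℂ × ℂ, t (conj p.2, conj p.1) = conj (t p) := by
    intro p
    simp only [ht, map_mul, map_pow]
    rw [hρτ, sg_fix_eval hhs]
  have htsq : ∀ p, t p = (s (ρ p) * h.evalEval p.1 p.2) ^ 2 := by
    intro p; simp only [ht]; rw [mul_pow, hs]
  have htT : ∀ p ∈ T, 0 ≤ (t p).re ∧ ((t p).re = 0 → t p = 0) := by
    intro p hpT
    have h1 := hxT p hpT
    rw [htsq]
    have h2 : ((s (ρ p) * h.evalEval p.1 p.2) ^ 2).re = (s (ρ p) * h.evalEval p.1 p.2).re ^ 2 := by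
      rw [sq, Complex.mul_re, h1]; ring
    refine ⟨by rw [h2]; positivity, fun h3 => ?_⟩
    rw [h2] at h3
    have h4 : s (ρ p) * h.evalEval p.1 p.2 = 0 := Complex.ext (by simpa using h3) (by simpa using h1)
    rw [h4]; simp
  have htZ : ∀ p ∈ Z, 0 ≤ (t p).re ∧ ((t p).re = 0 → t p = 0) := by
    intro p hpZ
    rcases lt_trichotomy (lx p.1) (lx (conj p.2)) with hlt | heq | hgt
    · exact htT p (by simp [hT, hS1, hpZ, hlt])
    · have hpr := lx_inj heq
      by_cases hn : (ρ p).re < 0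
      · exact htT p (by simp only [hT, hNg, hR, Finset.mem_union, Finset.mem_filter]; tauto)
      · have e0 : (conj p.2, conj p.1) = p := by
          rw [hpr]; simp
          exact Prod.ext hpr.symm rfl
        have e1 := hρτ p
        rw [e0] at e1
        have e2 := htτ p
        rw [e0] at e2
        have e3 := sg_fix_eval hhs p.1 p.2
        have e4 : conj p.1 = p.2 := by rw [hpr]; simp
        rw [← hpr, e4] at e3
        have i1 := Complex.conj_eq_iff_im.1 e1.symm
        have i2 := Complex.conj_eq_iff_im.1 e2.symm
        have i3 := Complex.conj_eq_iff_im.1 e3.symm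
        refine ⟨?_, fun h3 => Complex.ext h3 i2⟩
        simp only [ht, sq, Complex.mul_re, Complex.mul_im, i1, i3]
        push Not at hn
        simp only [mul_zero, zero_mul, sub_zero]
        exact mul_nonneg hn (mul_self_nonneg _)
    · have h1 : (conj p.2, conj p.1) ∈ T := by
        simp only [hT, hS1, Finset.mem_union, Finset.mem_filter, Complex.conj_conj]
        exact Or.inr ⟨hτ p hpZ, hgt⟩
      have h2 := htT _ h1
      rw [htτ] at h2
      simpa using h2
  have hsum : ∑ p ∈ Z, t p = 0 := by
    have hc : Cls (2 * q + 3) (2 * q + 3) (4 * q + 3) (W * h ^ 2) :=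
      (hW.mul ((hpoly_cls d x).pow 2)).mono (by omega) (by omega) (by omega)
    rw [← hEJ _ hc]
    refine Finset.sum_congr rfl fun p _ => ?_
    simp only [ht, hρ, evalEval_mul, evalEval_pow]
    ring
  have hzero : ∀ p ∈ Z, h.evalEval p.1 p.2 = 0 := by
    intro p hpZ
    have h1 := congrArg Complex.re hsum
    rw [Complex.re_sum, Complex.zero_re, Finset.sum_eq_zero_iff_of_nonneg
      (fun p hp => (htZ p hp).1)] at h1
    have h2 := (htZ p hpZ).2 (h1 p hpZ)
    simp only [ht] at h2
    have := (mul_eq_zero.1 h2).resolve_left (hρ0 p hpZ)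
    exact pow_eq_zero_iff (two_ne_zero) |>.1 this
  apply hx0
  apply hpoly_inj d
  exact hg.inj hp d (by omega) h (hpoly_cls d x) (by omega) (fun z w h1 h2 =>
    hzero (z, w) ((hZm (z, w)).2 ⟨h1, h2⟩))

end Ell

namespace Ell
open Polynomial
open scoped Polynomial.Bivariate ComplexConjugate

lemma kaehler_ne {L : Type} [Field L] [Algebra ℂ L] [Algebra.EssFiniteType ℂ L] (c : L)
    (hc : Function.Injective (aeval c : ℂ[X] →ₐ[ℂ] L)) : KaehlerDifferential.D ℂ L c ≠ 0 := by
  let _ : Algebra ℂ[X] L := (aeval c : ℂ[X] →ₐ[ℂ] L).toRingHom.toAlgebra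
  have hmap : ∀ p : ℂ[X], algebraMap ℂ[X] L p = aeval c p := fun p => rfl
  have : IsScalarTower ℂ ℂ[X] L := IsScalarTower.of_algebraMap_eq fun x => by
    rw [hmap, ← Polynomial.C_eq_algebraMap, aeval_C]
  have : FaithfulSMul ℂ[X] L := (faithfulSMul_iff_algebraMap_injective _ _).mpr hc
  let K := FractionRing ℂ[X]
  let _ : Algebra K L := FractionRing.liftAlgebra ℂ[X] L
  have : IsScalarTower ℂ[X] K L := inferInstance
  have : IsScalarTower ℂ K L := IsScalarTower.of_algebraMap_eq fun x => by
    rw [IsScalarTower.algebraMap_apply ℂ ℂ[X] K, ← IsScalarTower.algebraMap_apply ℂ[X] K L,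
      ← IsScalarTower.algebraMap_apply ℂ ℂ[X] L]
  have : Algebra.EssFiniteType K L := Algebra.EssFiniteType.of_comp ℂ K L
  have : CharZero K := inferInstance
  have : Algebra.FormallySmooth K L := Algebra.FormallySmooth.of_perfectField
  have : Algebra.FormallySmooth ℂ[X] K :=
    Algebra.FormallySmooth.of_isLocalization (nonZeroDivisors ℂ[X])
  have : Algebra.FormallySmooth ℂ[X] L := Algebra.FormallySmooth.comp ℂ[X] K L
  have inj : Function.Injective (KaehlerDifferential.mapBaseChange ℂ ℂ[X] L) := by
    rw [injective_iff_map_eq_zero]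
    intro x hx
    obtain ⟨x, rfl⟩ := (Algebra.H1Cotangent.exact_δ_mapBaseChange ℂ ℂ[X] L x).mp hx
    have := Algebra.FormallySmooth.subsingleton_h1Cotangent (R := ℂ[X]) (A := L)
    rw [Subsingleton.elim x 0, map_zero]
  intro h
  have h1 : KaehlerDifferential.mapBaseChange ℂ ℂ[X] L (1 ⊗ₜ KaehlerDifferential.D ℂ ℂ[X] X) = 0 := by
    rw [KaehlerDifferential.mapBaseChange_tmul, one_smul, KaehlerDifferential.map_D, hmap, aeval_X, h]
  have h2 := inj (h1.trans (map_zero _).symm)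
  have h3 := congrArg (LinearMap.baseChange L (KaehlerDifferential.polynomialEquiv ℂ).toLinearMap) h2
  rw [map_zero, LinearMap.baseChange_tmul] at h3
  have h4 := congrArg (TensorProduct.rid ℂ[X] L) h3
  simp [KaehlerDifferential.polynomialEquiv_D] at h4

lemma D_phi {L : Type} [Field L] [Algebra ℂ L] (φ : ℂ[X][Y] →ₐ[ℂ] L) (p : ℂ[X][Y]) :
    KaehlerDifferential.D ℂ L (φ p) = φ (dz p) • KaehlerDifferential.D ℂ L (φ (C X)) +
      φ (derivative p) • KaehlerDifferential.D ℂ L (φ X) := by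
  induction p using bi_induction with
  | hadd p r hp hr => rw [map_add, map_add, hp, hr, dz_add, derivative_add, map_add, map_add]; module
  | hm n m r =>
    have e : (monomial n (monomial m r) : ℂ[X][Y]) = algebraMap ℂ _ r * ((C X) ^ m * X ^ n) := by
      rw [← C_mul_X_pow_eq_monomial, ← C_mul_X_pow_eq_monomial]
      simp [Polynomial.algebraMap_apply, mul_assoc]
    have hr : (algebraMap ℂ ℂ[X][Y] r) = C (C r) := by simp [Polynomial.algebraMap_apply]
    rw [e]
    have h1 : dz (algebraMap ℂ _ r * ((C X) ^ m * X ^ n) : ℂ[X][Y]) = algebraMap ℂ _ r * ((m : ℂ[X][Y]) * (C X) ^ (m-1) * X ^ n) := by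
      have hx : dz (X ^ n : ℂ[X][Y]) = 0 := by
        cases n with
        | zero => simp [dz_one]
        | succ n => rw [dz_pow, dz_X, mul_zero]
      rw [hr, dz_mul, dz_C, derivative_C, C_0, zero_mul, zero_add, dz_mul, hx, mul_zero, add_zero,
        ← C_pow, dz_C, derivative_X_pow]
      simp
    have h2 : derivative (algebraMap ℂ _ r * ((C X) ^ m * X ^ n) : ℂ[X][Y]) = algebraMap ℂ _ r * ((C X) ^ m * ((n : ℂ[X][Y]) * X ^ (n-1))) := by
      rw [hr, derivative_C_mul, ← C_pow, derivative_C_mul, derivative_X_pow]; simp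
    rw [h1, h2]
    simp only [map_mul, map_pow, map_natCast, AlgHom.commutes, Derivation.leibniz, Derivation.map_algebraMap,
      Derivation.leibniz_pow, smul_add, smul_smul, smul_zero, add_zero, ← Nat.cast_smul_eq_nsmul L]
    rw [add_comm]
    congr 2 <;> ring

/-- `d(F)` lies in the ideal generated by the partial derivatives, for some `d ≠ 0`. -/
lemma crit_ideal (F : ℂ[X][Y]) : ∃ d : ℂ[X], d ≠ 0 ∧ aeval F d ∈ Ideal.span {dz F, derivative F} := by
  by_contra hcon
  push Not at hcon
  let S : Submonoid ℂ[X][Y] := (nonZeroDivisors ℂ[X]).map (aeval F : ℂ[X] →ₐ[ℂ] ℂ[X][Y])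
  have hdis : Disjoint (Ideal.span {dz F, derivative F} : Set ℂ[X][Y]) S := by
    rw [Set.disjoint_left]
    rintro x hx ⟨d, hd, rfl⟩
    exact hcon d (nonZeroDivisors.ne_zero hd) hx
  obtain ⟨P, hP, hIP, hPS⟩ := Ideal.exists_le_prime_disjoint _ S hdis
  let A := ℂ[X][Y] ⧸ P
  let L := FractionRing A
  have : Algebra.FiniteType ℂ ℂ[X][Y] :=
    Algebra.FiniteType.trans (S := ℂ[X]) inferInstance inferInstance
  have : Algebra.FiniteType ℂ A := inferInstance
  have : Algebra.EssFiniteType ℂ A := inferInstance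
  have : Algebra.EssFiniteType A L := Algebra.EssFiniteType.of_isLocalization L (nonZeroDivisors A)
  have : Algebra.EssFiniteType ℂ L := Algebra.EssFiniteType.comp ℂ A L
  let φ : ℂ[X][Y] →ₐ[ℂ] L := (IsScalarTower.toAlgHom ℂ A L).comp (Ideal.Quotient.mkₐ ℂ P)
  have hφ : ∀ x, φ x = 0 ↔ x ∈ P := by
    intro x
    have hj : Function.Injective (IsScalarTower.toAlgHom ℂ A L) := IsFractionRing.injective A L
    have hx : φ x = IsScalarTower.toAlgHom ℂ A L (Ideal.Quotient.mkₐ ℂ P x) := rfl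
    rw [hx, map_eq_zero_iff _ hj, Ideal.Quotient.mkₐ_eq_mk, Ideal.Quotient.eq_zero_iff_mem]
  refine kaehler_ne (φ F) ?_ ?_
  · rw [injective_iff_map_eq_zero]
    intro d hd
    by_contra hd0
    rw [aeval_algHom_apply, hφ] at hd
    exact Set.disjoint_left.mp hPS hd ⟨d, mem_nonZeroDivisors_of_ne_zero hd0, rfl⟩
  · rw [D_phi, (hφ (dz F)).mpr (hIP (Ideal.subset_span (by simp))),
      (hφ (derivative F)).mpr (hIP (Ideal.subset_span (by simp)))]
    simp

lemma crit_finite (F : ℂ[X][Y]) : ∃ T : Finset ℂ, ∀ z w : ℂ, (dz F).evalEval z w = 0 →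
    (derivative F).evalEval z w = 0 → F.evalEval z w ∈ T := by
  classical
  obtain ⟨d, hd, hm⟩ := crit_ideal F
  refine ⟨d.roots.toFinset, fun z w h1 h2 => ?_⟩
  rw [Multiset.mem_toFinset, mem_roots hd, IsRoot]
  obtain ⟨x, y, h⟩ := Ideal.mem_span_pair.mp hm
  have h3 := congrArg (evalEvalRingHom z w) h
  rw [map_add, map_mul, map_mul] at h3
  simp only [coe_evalEvalRingHom, h1, h2, mul_zero, add_zero] at h3
  have h4 : evalEvalRingHom z w (aeval F d) = d.eval (F.evalEval z w) := by
    rw [aeval_def, hom_eval₂]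
    have : (evalEvalRingHom z w).comp (algebraMap ℂ ℂ[X][Y]) = RingHom.id ℂ := by
      ext; simp [Polynomial.algebraMap_apply, evalEval]
    rw [this]; simp [eval₂_id]
  rw [← h4]; exact h3.symm

end Ell

namespace Ell
open MeasureTheory Set

/-- partial derivative -/
noncomputable def pd {n : ℕ} (i : Fin n) (f : (Fin n → ℝ) → ℝ) (x : Fin n → ℝ) : ℝ :=
  fderiv ℝ f x (Pi.single i 1)

lemma pd_contDiff {n : ℕ} (i : Fin n) {f : (Fin n → ℝ) → ℝ} {r s : ℕ∞} (h : ContDiff ℝ s f)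
    (hrs : r + 1 ≤ s) : ContDiff ℝ r (pd i f) := by
  unfold pd
  have h1 : ContDiff ℝ r (fderiv ℝ f) := h.fderiv_right (by exact_mod_cast hrs)
  exact h1.clm_apply contDiff_const

lemma pd_comm {n : ℕ} (i j : Fin n) {f : (Fin n → ℝ) → ℝ} (h : ContDiff ℝ 2 f) (x : Fin n → ℝ) :
    pd i (pd j f) x = pd j (pd i f) x := by
  have h1 : ContDiff ℝ 1 (fderiv ℝ f) := h.fderiv_right (by norm_num)
  have hd : DifferentiableAt ℝ (fderiv ℝ f) x := (h1.differentiable (by norm_num)) x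
  have key : ∀ a b : Fin n, pd a (pd b f) x
      = fderiv ℝ (fderiv ℝ f) x (Pi.single a 1) (Pi.single b 1) := by
    intro a b
    unfold pd
    rw [fderiv_clm_apply hd (by fun_prop)]
    simp
  rw [key, key]
  exact (h.contDiffAt.isSymmSndFDerivAt (by simp)).eq _ _

/-- composition with a function of two variables -/
lemma pd_comp {n : ℕ} (i : Fin n) {φ : (Fin 2 → ℝ) → ℝ} (hφ : ContDiff ℝ 1 φ)
    {P : (Fin n → ℝ) → (Fin 2 → ℝ)} (hP : ContDiff ℝ 1 P) (x : Fin n → ℝ) :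
    pd i (fun x => φ (P x)) x = pd 0 φ (P x) * pd i (fun x => P x 0) x
      + pd 1 φ (P x) * pd i (fun x => P x 1) x := by
  have hPd : DifferentiableAt ℝ P x := (hP.differentiable (by norm_num)) x
  have hφd : DifferentiableAt ℝ φ (P x) := (hφ.differentiable (by norm_num)) _
  have hc : ∀ l : Fin 2, pd i (fun x => P x l) x = (fderiv ℝ P x (Pi.single i 1)) l := by
    intro l
    unfold pd
    have := hasFDerivAt_pi'.1 hPd.hasFDerivAt l
    rw [this.fderiv]; simp
  rw [hc, hc]
  unfold pd
  have : (fun x => φ (P x)) = φ ∘ P := rfl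
  rw [this, fderiv_comp x hφd hPd]
  simp only [ContinuousLinearMap.comp_apply]
  set v := fderiv ℝ P x (Pi.single i 1)
  have hv : v = v 0 • (Pi.single 0 1 : Fin 2 → ℝ) + v 1 • (Pi.single 1 1 : Fin 2 → ℝ) := by
    ext l; fin_cases l <;> simp
  conv_lhs => rw [hv]
  simp [mul_comm]

lemma pd_mul {n : ℕ} (i : Fin n) {f g : (Fin n → ℝ) → ℝ} {x : Fin n → ℝ}
    (hf : DifferentiableAt ℝ f x) (hg : DifferentiableAt ℝ g x) :
    pd i (fun x => f x * g x) x = f x * pd i g x + g x * pd i f x := by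
  unfold pd
  rw [fderiv_fun_mul hf hg]; simp

lemma pd_sub {n : ℕ} (i : Fin n) {f g : (Fin n → ℝ) → ℝ} {x : Fin n → ℝ}
    (hf : DifferentiableAt ℝ f x) (hg : DifferentiableAt ℝ g x) :
    pd i (fun x => f x - g x) x = pd i f x - pd i g x := by
  unfold pd
  rw [fderiv_fun_sub hf hg]; simp

/-- the solenoidal field -/
noncomputable def crs (φ : (Fin 2 → ℝ) → ℝ) (P : (Fin 3 → ℝ) → (Fin 2 → ℝ)) (i j : Fin 3)
    (x : Fin 3 → ℝ) : ℝ :=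
  φ (P x) * (pd i (fun x => P x 0) x * pd j (fun x => P x 1) x
    - pd j (fun x => P x 0) x * pd i (fun x => P x 1) x)

lemma crs_contDiff {φ : (Fin 2 → ℝ) → ℝ} (hφ : ContDiff ℝ 1 φ)
    {P : (Fin 3 → ℝ) → (Fin 2 → ℝ)} (hP : ContDiff ℝ 2 P) (i j : Fin 3) :
    ContDiff ℝ 1 (crs φ P i j) := by
  have h : ∀ l, ContDiff ℝ 2 (fun x => P x l) := fun l => contDiff_pi.1 hP l
  have h' : ∀ i l, ContDiff ℝ 1 (pd i (fun x => P x l)) := fun i l =>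
    pd_contDiff (r := 1) (s := 2) i (h l) (by norm_num)
  unfold crs
  refine (hφ.comp (hP.of_le (by norm_num))).mul ?_
  exact ((h' _ _).mul (h' _ _)).sub ((h' _ _).mul (h' _ _))

lemma crs_pd {φ : (Fin 2 → ℝ) → ℝ} (hφ : ContDiff ℝ 1 φ)
    {P : (Fin 3 → ℝ) → (Fin 2 → ℝ)} (hP : ContDiff ℝ 2 P) (i j l : Fin 3) (x : Fin 3 → ℝ) :
    pd l (crs φ P i j) x = φ (P x) * (pd i (fun x => P x 0) x * pd l (pd j (fun x => P x 1)) x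
      + pd j (fun x => P x 1) x * pd l (pd i (fun x => P x 0)) x
      - (pd j (fun x => P x 0) x * pd l (pd i (fun x => P x 1)) x
      + pd i (fun x => P x 1) x * pd l (pd j (fun x => P x 0)) x)) +
      (pd i (fun x => P x 0) x * pd j (fun x => P x 1) x
    - pd j (fun x => P x 0) x * pd i (fun x => P x 1) x) * (pd 0 φ (P x) * pd l (fun x => P x 0) x
      + pd 1 φ (P x) * pd l (fun x => P x 1) x) := by
  have h : ∀ l, ContDiff ℝ 2 (fun x => P x l) := fun l => contDiff_pi.1 hP l
  have h' : ∀ i l, ContDiff ℝ 1 (pd i (fun x => P x l)) := fun i l =>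
    pd_contDiff (r := 1) (s := 2) i (h l) (by norm_num)
  have h'' : ∀ i l, DifferentiableAt ℝ (pd i (fun x => P x l)) x := fun i l =>
    (h' i l).differentiable (by norm_num) x
  have hc : ContDiff ℝ 1 (fun x => φ (P x)) := hφ.comp (hP.of_le (by norm_num))
  unfold crs
  rw [pd_mul l (hc.differentiable (by norm_num) x) (by fun_prop (disch := assumption)),
    pd_comp l hφ (hP.of_le (by norm_num)), pd_sub, pd_mul, pd_mul]
  all_goals fun_prop

theorem crs_face {φ : (Fin 2 → ℝ) → ℝ} (hφ : ContDiff ℝ 1 φ)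
    {P : (Fin 3 → ℝ) → (Fin 2 → ℝ)} (hP : ContDiff ℝ 2 P) (a b : Fin 3 → ℝ) (hab : a ≤ b)
    (h0 : ∀ x ∈ Icc a b, (∃ l : Fin 3, l ≠ 0 ∧ (x l = a l ∨ x l = b l)) → φ (P x) = 0) :
    ∫ x in Icc (a ∘ Fin.succAbove 0) (b ∘ Fin.succAbove 0),
      crs φ P 1 2 (Fin.insertNth (0 : Fin 3) (a 0) x) =
    ∫ x in Icc (a ∘ Fin.succAbove 0) (b ∘ Fin.succAbove 0),
      crs φ P 1 2 (Fin.insertNth (0 : Fin 3) (b 0) x) := by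
  set f : Fin 3 → (Fin 3 → ℝ) → ℝ := ![crs φ P 1 2, crs φ P 2 0, crs φ P 0 1] with hf
  have hfc : ∀ i, ContDiff ℝ 1 (f i) := by
    intro i; fin_cases i <;> exact crs_contDiff hφ hP _ _
  have hdiv : ∀ x, ∑ i, (fderiv ℝ (f i) x) (Pi.single i 1) = 0 := by
    intro x
    have h : ∀ l, ContDiff ℝ 2 (fun x => P x l) := fun l => contDiff_pi.1 hP l
    have e : ∀ i, (fderiv ℝ (f i) x) (Pi.single i 1) = pd i (f i) x := fun i => rfl
    simp only [e, Fin.sum_univ_three]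
    simp only [hf, Matrix.cons_val_zero, Matrix.cons_val_one, Matrix.cons_val]
    rw [crs_pd hφ hP, crs_pd hφ hP, crs_pd hφ hP,
      pd_comm 1 0 (h 0), pd_comm 1 0 (h 1), pd_comm 2 0 (h 0), pd_comm 2 0 (h 1),
      pd_comm 2 1 (h 0), pd_comm 2 1 (h 1)]
    ring
  have D := integral_divergence_of_hasFDerivAt_off_countable' a b hab f
    (fun i x => fderiv ℝ (f i) x) ∅ countable_empty
    (fun i => (hfc i).continuous.continuousOn)
    (fun x _ i => ((hfc i).differentiable (by norm_num) x).hasFDerivAt)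
    (by simp only [hdiv]; exact integrableOn_zero)
  simp only [hdiv] at D
  have side : ∀ i : Fin 3, i ≠ 0 → ∀ t, (t = a i ∨ t = b i) →
      ∫ x in Icc (a ∘ Fin.succAbove i) (b ∘ Fin.succAbove i), f i (Fin.insertNth i t x) = 0 := by
    intro i hi t ht
    rw [← integral_zero (Fin 2 → ℝ) ℝ (μ := volume.restrict (Icc (a ∘ Fin.succAbove i) (b ∘ Fin.succAbove i)))]
    refine setIntegral_congr_fun measurableSet_Icc fun x hx => ?_
    have hmem : Fin.insertNth (α := fun _ => ℝ) i t x ∈ Icc a b := by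
      have hti : a i ≤ t ∧ t ≤ b i := by
        rcases ht with h | h <;> subst h
        · exact ⟨le_rfl, hab i⟩
        · exact ⟨hab i, le_rfl⟩
      constructor
      · rw [Fin.le_insertNth_iff]; exact ⟨hti.1, hx.1⟩
      · rw [Fin.insertNth_le_iff]; exact ⟨hti.2, hx.2⟩
    have hz := h0 _ hmem ⟨i, hi, by simpa using ht⟩
    fin_cases i
    · exact absurd rfl hi
    · change crs φ P 2 0 _ = 0
      unfold crs; rw [hz, zero_mul]
    · change crs φ P 0 1 _ = 0
      unfold crs; rw [hz, zero_mul]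
  rw [Fin.sum_univ_three, side 1 (by decide) _ (Or.inl rfl), side 1 (by decide) _ (Or.inr rfl),
    side 2 (by decide) _ (Or.inl rfl), side 2 (by decide) _ (Or.inr rfl)] at D
  simp only [integral_zero, sub_zero, add_zero] at D
  exact (sub_eq_zero.1 D.symm).symm

end Ell

namespace Ell
open MeasureTheory Set

/-- jacobian determinant of a planar map -/
noncomputable def Jc (u : (Fin 2 → ℝ) → (Fin 2 → ℝ)) (x : Fin 2 → ℝ) : ℝ :=
  pd 0 (fun x => u x 0) x * pd 1 (fun x => u x 1) x
    - pd 1 (fun x => u x 0) x * pd 0 (fun x => u x 1) x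

/-- `d` is the degree of `u` on the box `Icc a b`. -/
def Deg (a b : Fin 2 → ℝ) (u : (Fin 2 → ℝ) → (Fin 2 → ℝ)) (d : ℤ) : Prop :=
  ∃ δ > 0, ∀ φ : (Fin 2 → ℝ) → ℝ, ContDiff ℝ 1 φ → (∀ y, δ ≤ ‖y‖ → φ y = 0) →
    ∫ x in Icc a b, φ (u x) * Jc u x = d * ∫ y, φ y

lemma Deg.unique {a b : Fin 2 → ℝ} {u : (Fin 2 → ℝ) → (Fin 2 → ℝ)} {d e : ℤ}
    (hd : Deg a b u d) (he : Deg a b u e) : d = e := by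
  obtain ⟨δ, hδ, h1⟩ := hd
  obtain ⟨δ', hδ', h2⟩ := he
  let ψ : ContDiffBump (0 : Fin 2 → ℝ) := ⟨min δ δ' / 2, min δ δ', by positivity, by
    have : 0 < min δ δ' := by positivity
    linarith⟩
  have hs : ∀ y, min δ δ' ≤ ‖y‖ → ψ y = 0 := by
    intro y hy
    apply ψ.zero_of_le_dist
    rw [dist_zero_right]; exact hy
  have hc : ContDiff ℝ 1 (ψ : (Fin 2 → ℝ) → ℝ) := ψ.contDiff
  have e1 := h1 ψ hc (fun y hy => hs y ((min_le_left _ _).trans hy))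
  have e2 := h2 ψ hc (fun y hy => hs y ((min_le_right _ _).trans hy))
  rw [e1] at e2
  have hp : 0 < ∫ y, ψ y := ψ.integral_pos
  have := mul_right_cancel₀ hp.ne' e2
  exact_mod_cast this

lemma lineD {n : ℕ} (i : Fin n) {f : (Fin n → ℝ) → ℝ} {x : Fin n → ℝ}
    (hf : DifferentiableAt ℝ f x) : pd i f x = lineDeriv ℝ f x (Pi.single i 1) :=
  hf.lineDeriv_eq_fderiv.symm

lemma Deg.hom_aux {a b : Fin 2 → ℝ} (hab : a ≤ b) {H : ℝ → (Fin 2 → ℝ) → (Fin 2 → ℝ)}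
    (hH : ContDiff ℝ 2 (fun p : ℝ × (Fin 2 → ℝ) => H p.1 p.2))
    (h0 : ∀ τ ∈ Icc (0 : ℝ) 1, ∀ x ∈ Icc a b, (∃ l, x l = a l ∨ x l = b l) → H τ x ≠ 0) :
    ∃ δ > 0, ∀ φ : (Fin 2 → ℝ) → ℝ, ContDiff ℝ 1 φ → (∀ y, δ ≤ ‖y‖ → φ y = 0) →
      ∫ x in Icc a b, φ (H 0 x) * Jc (H 0) x = ∫ x in Icc a b, φ (H 1 x) * Jc (H 1) x := by
  set P : (Fin 3 → ℝ) → (Fin 2 → ℝ) := fun x => H (x 0) (fun i => x i.succ) with hPdef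
  have hP : ContDiff ℝ 2 P := by
    have : P = (fun p : ℝ × (Fin 2 → ℝ) => H p.1 p.2) ∘
      (fun x : Fin 3 → ℝ => (x 0, fun i : Fin 2 => x i.succ)) := rfl
    rw [this]
    refine hH.comp ?_
    fun_prop
  set A : Fin 3 → ℝ := Fin.cons 0 a with hA
  set B : Fin 3 → ℝ := Fin.cons 1 b with hB
  have hAB : A ≤ B := by
    intro i
    refine Fin.cases ?_ (fun j => ?_) i
    · simp [hA, hB]
    · simpa [hA, hB] using hab j
  set S : Set (Fin 3 → ℝ) := Icc A B ∩ ⋃ l : Fin 2, ({x | x l.succ = a l} ∪ {x | x l.succ = b l}) with hS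
  have hSc : IsCompact S := by
    apply IsCompact.inter_right isCompact_Icc
    refine isClosed_iUnion_of_finite fun l => ?_
    refine (isClosed_eq ?_ ?_).union (isClosed_eq ?_ ?_) <;> fun_prop
  have hSne : ∀ x ∈ S, 0 < ‖P x‖ := by
    rintro x ⟨hx, hx2⟩
    rw [norm_pos_iff]
    simp only [mem_iUnion, mem_union, mem_ofPred_eq] at hx2
    refine h0 _ ?_ _ ?_ hx2
    · have h1 := hx.1 0; have h2 := hx.2 0
      simp [hA, hB] at h1 h2
      exact ⟨h1, h2⟩
    · constructor <;> intro i
      · have := hx.1 i.succ; simpa [hA] using this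
      · have := hx.2 i.succ; simpa [hB] using this
  obtain ⟨δ, hδ, hδS⟩ := hSc.exists_forall_le' (f := fun x => ‖P x‖)
    hP.continuous.norm.continuousOn hSne
  refine ⟨δ, hδ, fun φ hφ hφ0 => ?_⟩
  have key := crs_face hφ hP A B hAB (by
    rintro x hx ⟨l, hl, hl2⟩
    apply hφ0
    apply hδS
    refine ⟨hx, ?_⟩
    obtain ⟨j, rfl⟩ := Fin.exists_succ_eq.2 hl
    simp only [mem_iUnion, mem_union, mem_ofPred_eq]
    exact ⟨j, by simpa [hA, hB] using hl2⟩)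
  have eA : A ∘ Fin.succAbove 0 = a := by ext i; simp [hA]
  have eB : B ∘ Fin.succAbove 0 = b := by ext i; simp [hB]
  rw [eA, eB] at key
  have hcr : ∀ τ : ℝ, ∀ x : Fin 2 → ℝ,
      crs φ P 1 2 (Fin.insertNth (0 : Fin 3) τ x) = φ (H τ x) * Jc (H τ) x := by
    intro τ x
    have hPι : ∀ y : Fin 2 → ℝ, P (Fin.insertNth (0 : Fin 3) τ y) = H τ y := by
      intro y; simp [hPdef]
    have hHτ : ContDiff ℝ 2 (H τ) := hH.comp (contDiff_prodMk_right τ)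
    have hp : ∀ (j l : Fin 2), pd j.succ (fun x => P x l) (Fin.insertNth (0 : Fin 3) τ x)
        = pd j (fun x => H τ x l) x := by
      intro j l
      have c1 : ContDiff ℝ 2 (fun x => P x l) := contDiff_pi.1 hP l
      have c2 : ContDiff ℝ 2 (fun x => H τ x l) := contDiff_pi.1 hHτ l
      rw [lineD _ (c1.differentiable (by norm_num) _), lineD _ (c2.differentiable (by norm_num) _)]
      unfold lineDeriv
      congr 1
      funext t
      beta_reduce
      rw [← hPι]
      congr 2
      ext i
      refine Fin.cases ?_ (fun i' => ?_) i
      · simp [Pi.single_apply]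
      · simp [Pi.single_apply]
    have hp10 := hp 0; have hp11 := hp 1
    change ∀ l, pd 1 _ _ = _ at hp10
    change ∀ l, pd 2 _ _ = _ at hp11
    unfold crs Jc
    rw [hPι, hp10, hp10, hp11, hp11]
  simp only [hcr] at key
  simpa [hA, hB] using key

lemma Deg.hom {a b : Fin 2 → ℝ} (hab : a ≤ b) {H : ℝ → (Fin 2 → ℝ) → (Fin 2 → ℝ)}
    (hH : ContDiff ℝ 2 (fun p : ℝ × (Fin 2 → ℝ) => H p.1 p.2))
    (h0 : ∀ τ ∈ Icc (0 : ℝ) 1, ∀ x ∈ Icc a b, (∃ l, x l = a l ∨ x l = b l) → H τ x ≠ 0) (d : ℤ) :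
    Deg a b (H 0) d ↔ Deg a b (H 1) d := by
  obtain ⟨δ, hδ, h⟩ := Deg.hom_aux hab hH h0
  constructor
  · rintro ⟨δ', hδ', h'⟩
    refine ⟨min δ δ', by positivity, fun φ hφ hs => ?_⟩
    rw [← h φ hφ fun y hy => hs y ((min_le_left _ _).trans hy)]
    exact h' φ hφ fun y hy => hs y ((min_le_right _ _).trans hy)
  · rintro ⟨δ', hδ', h'⟩
    refine ⟨min δ δ', by positivity, fun φ hφ hs => ?_⟩
    rw [h φ hφ fun y hy => hs y ((min_le_left _ _).trans hy)]
    exact h' φ hφ fun y hy => hs y ((min_le_right _ _).trans hy)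

lemma det_eq_Jc {u : (Fin 2 → ℝ) → (Fin 2 → ℝ)} {x : Fin 2 → ℝ} (hu : DifferentiableAt ℝ u x) :
    (fderiv ℝ u x).det = Jc u x := by
  have hc : ∀ i l : Fin 2, pd i (fun x => u x l) x = (fderiv ℝ u x (Pi.single i 1)) l := by
    intro i l
    unfold pd
    have := hasFDerivAt_pi'.1 hu.hasFDerivAt l
    rw [this.fderiv]; simp
  rw [ContinuousLinearMap.det, ← LinearMap.det_toMatrix', Matrix.det_fin_two]
  unfold Jc
  simp only [hc, LinearMap.toMatrix'_apply]
  rfl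

lemma Jc_continuous {u : (Fin 2 → ℝ) → (Fin 2 → ℝ)} (hu : ContDiff ℝ 2 u) :
    Continuous (Jc u) := by
  have h : ∀ l, ContDiff ℝ 2 (fun x => u x l) := fun l => contDiff_pi.1 hu l
  have h' : ∀ i l, Continuous (pd i (fun x => u x l)) := fun i l =>
    (pd_contDiff (r := 1) (s := 2) i (h l) (by norm_num)).continuous
  unfold Jc
  fun_prop

end Ell

namespace Ell
open MeasureTheory Set Topology

lemma local_inv {u : (Fin 2 → ℝ) → (Fin 2 → ℝ)} (hu : ContDiff ℝ 2 u) {z : Fin 2 → ℝ}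
    (hJ : Jc u z ≠ 0) {N : Set (Fin 2 → ℝ)} (hN : N ∈ 𝓝 z) :
    ∃ r > 0, Metric.ball z r ⊆ N ∧ InjOn u (Metric.ball z r) ∧
      (∀ x ∈ Metric.ball z r, 0 < Jc u x * Jc u z) ∧
      (∀ s > 0, u '' (Metric.ball z s) ∈ 𝓝 (u z)) := by
  have hd : HasStrictFDerivAt u (fderiv ℝ u z) z := hu.contDiffAt.hasStrictFDerivAt (by norm_num)
  have hdet : (fderiv ℝ u z).det ≠ 0 := by
    rwa [det_eq_Jc (hu.differentiable (by norm_num) z)]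
  set e := ContinuousLinearMap.toContinuousLinearEquivOfDetNeZero (fderiv ℝ u z) hdet with he
  have hd' : HasStrictFDerivAt u (e : (Fin 2 → ℝ) →L[ℝ] (Fin 2 → ℝ)) z := by
    rw [he, ContinuousLinearMap.coe_toContinuousLinearEquivOfDetNeZero]; exact hd
  have hsrc : (hd'.toOpenPartialHomeomorph u).source ∈ 𝓝 z :=
    (hd'.toOpenPartialHomeomorph u).open_source.mem_nhds hd'.mem_toOpenPartialHomeomorph_source
  have hsg : {x | 0 < Jc u x * Jc u z} ∈ 𝓝 z := by
    apply (isOpen_lt continuous_const ((Jc_continuous hu).mul continuous_const)).mem_nhds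
    exact mul_self_pos.2 hJ
  obtain ⟨r, hr, hb⟩ := Metric.mem_nhds_iff.1 (Filter.inter_mem hN (Filter.inter_mem hsrc hsg))
  refine ⟨r, hr, fun x hx => (hb hx).1, ?_, fun x hx => (hb hx).2.2, ?_⟩
  · exact (hd'.toOpenPartialHomeomorph u).injOn.mono (fun x hx => (hb hx).2.1)
  · intro s hs
    rw [← hd'.map_nhds_eq_of_equiv]
    exact Filter.image_mem_map (Metric.ball_mem_nhds z hs)

theorem Deg.count {a b : Fin 2 → ℝ} {u : (Fin 2 → ℝ) → (Fin 2 → ℝ)} (hu : ContDiff ℝ 2 u)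
    (Z : Finset (Fin 2 → ℝ)) (hZ : ∀ x ∈ Icc a b, u x = 0 → x ∈ Z) (hZ0 : ∀ z ∈ Z, u z = 0)
    (hZi : ∀ z ∈ Z, ∀ l, a l < z l ∧ z l < b l) (hJ : ∀ z ∈ Z, Jc u z ≠ 0) :
    Deg a b u (∑ z ∈ Z, (SignType.sign (Jc u z) : ℤ)) := by
  classical
  have hN : ∀ z ∈ Z, Icc a b ∩ ((Z.erase z : Finset _) : Set (Fin 2 → ℝ))ᶜ ∈ 𝓝 z := by
    intro z hz
    refine Filter.inter_mem (pi_Icc_mem_nhds (fun l => (hZi z hz l).1) (fun l => (hZi z hz l).2)) ?_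
    exact (Finset.finite_toSet _).isClosed.isOpen_compl.mem_nhds (by simp)
  have hloc : ∀ z : Z, ∃ r > 0, Metric.ball z.1 r ⊆ Icc a b ∩ ((Z.erase z.1 : Finset _) : Set (Fin 2 → ℝ))ᶜ
      ∧ InjOn u (Metric.ball z.1 r) ∧ (∀ x ∈ Metric.ball z.1 r, 0 < Jc u x * Jc u z.1) ∧
      (∀ s > 0, u '' (Metric.ball z.1 s) ∈ 𝓝 (u z.1)) :=
    fun z => local_inv hu (hJ z z.2) (hN z z.2)
  choose ρ hρ hsub hinj hsgn himg using hloc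
  -- a common radius
  obtain ⟨r, hr0, hrZ⟩ : ∃ r > 0, ∀ z : Z, 2 * r ≤ ρ z := by
    have h1 : ∀ᶠ r : ℝ in 𝓝[>] 0, ∀ z : Z, 2 * r ≤ ρ z := by
      rw [Filter.eventually_all]
      intro z
      have : Filter.Tendsto (fun r : ℝ => 2 * r) (𝓝[>] 0) (𝓝 0) := by
        have h : Continuous (fun r : ℝ => 2 * r) := by fun_prop
        have := (h.tendsto 0).mono_left (nhdsWithin_le_nhds (s := Ioi 0))
        simpa using this
      exact (this.eventually (gt_mem_nhds (hρ z))).mono fun r h => h.le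
    obtain ⟨r, h, h'⟩ := (h1.and self_mem_nhdsWithin).exists
    exact ⟨r, h', h⟩
  have hbsub : ∀ z : Z, Metric.ball z.1 r ⊆ Metric.ball z.1 (ρ z) := fun z =>
    Metric.ball_subset_ball (by linarith [hrZ z])
  have hdisj : ∀ z z' : Z, z ≠ z' → Disjoint (Metric.ball z.1 r) (Metric.ball z'.1 r) := by
    intro z z' hne
    rw [Set.disjoint_left]
    intro x h1 h2
    have h3 : dist z'.1 z.1 < ρ z := by
      have := dist_triangle_left z'.1 z.1 x
      rw [Metric.mem_ball] at h1 h2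
      linarith [hrZ z]
    have h4 := (hsub z (Metric.mem_ball.2 h3)).2
    apply h4
    simp only [Finset.coe_erase, mem_sdiff, Finset.mem_coe, mem_singleton_iff]
    exact ⟨z'.2, fun h => hne (Subtype.ext h.symm)⟩
  -- the complement
  set B : Set (Fin 2 → ℝ) := ⋃ z : Z, Metric.ball z.1 r with hB
  have hBo : IsOpen B := isOpen_iUnion fun z => Metric.isOpen_ball
  have hK : IsCompact (Icc a b \ B) := isCompact_Icc.diff hBo
  obtain ⟨δ₁, hδ₁, hδK⟩ := hK.exists_forall_le' (f := fun x => ‖u x‖)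
    hu.continuous.norm.continuousOn (a := 0) (by
      rintro x ⟨hx, hxB⟩
      rw [norm_pos_iff]
      intro h
      apply hxB
      exact mem_iUnion.2 ⟨⟨x, hZ x hx h⟩, Metric.mem_ball_self hr0⟩)
  have himg2 : ∀ z : Z, ∃ δ > 0, Metric.ball 0 δ ⊆ u '' (Metric.ball z.1 r) := by
    intro z
    have := himg z r hr0
    rw [hZ0 z z.2] at this
    exact Metric.mem_nhds_iff.1 this
  choose δ₂ hδ₂ hδimg using himg2
  obtain ⟨δ, hδ0, hδ1, hδZ⟩ : ∃ δ > 0, δ ≤ δ₁ ∧ ∀ z : Z, δ ≤ δ₂ z := by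
    have h1 : ∀ᶠ r : ℝ in 𝓝[>] 0, ∀ z : Z, r ≤ δ₂ z := by
      rw [Filter.eventually_all]
      intro z
      exact nhdsWithin_le_nhds ((gt_mem_nhds (hδ₂ z)).mono fun r h => h.le)
    have h2 : ∀ᶠ r : ℝ in 𝓝[>] 0, r ≤ δ₁ :=
      nhdsWithin_le_nhds ((gt_mem_nhds hδ₁).mono fun r h => h.le)
    obtain ⟨r, ⟨h, h'⟩, h''⟩ := ((h1.and h2).and self_mem_nhdsWithin).exists
    exact ⟨r, h'', h', h⟩
  refine ⟨δ, hδ0, fun φ hφ hφ0 => ?_⟩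
  have hBsub : B ⊆ Icc a b := iUnion_subset fun z x hx => (hsub z (hbsub z hx)).1
  have hcont : Continuous (fun x => φ (u x) * Jc u x) :=
    (hφ.continuous.comp hu.continuous).mul (Jc_continuous hu)
  have hintg : IntegrableOn (fun x => φ (u x) * Jc u x) (Icc a b) :=
    hcont.continuousOn.integrableOn_compact isCompact_Icc
  rw [setIntegral_eq_of_subset_of_forall_sdiff_eq_zero measurableSet_Icc hBsub (by
    intro x hx
    rw [hφ0 _ (hδ1.trans (hδK x hx)), zero_mul])]
  rw [hB, integral_iUnion_fintype (fun z => measurableSet_ball)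
    (fun z z' h => hdisj z z' h) (fun z => hintg.mono_set fun x hx => (hsub z (hbsub z hx)).1)]
  have each : ∀ z : Z, ∫ x in Metric.ball z.1 r, φ (u x) * Jc u x
      = ((SignType.sign (Jc u z.1) : ℤ) : ℝ) * ∫ y, φ y := by
    intro z
    have hch := integral_image_eq_integral_abs_det_fderiv_smul volume
      (s := Metric.ball z.1 r) measurableSet_ball
      (f' := fun x => fderiv ℝ u x)
      (fun x _ => ((hu.differentiable (by norm_num) x).hasFDerivAt).hasFDerivWithinAt)
      ((hinj z).mono (hbsub z)) φ
    have h1 : ∫ y in u '' Metric.ball z.1 r, φ y = ∫ y, φ y := by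
      apply setIntegral_eq_integral_of_forall_compl_eq_zero
      intro y hy
      apply hφ0
      by_contra hlt
      push Not at hlt
      exact hy (hδimg z (by rw [Metric.mem_ball, dist_zero_right]; linarith [hδZ z]))
    rw [← h1, hch, ← integral_const_mul]
    refine setIntegral_congr_fun measurableSet_ball fun x hx => ?_
    have hs := hsgn z x (hbsub z hx)
    simp only [smul_eq_mul]
    rw [det_eq_Jc (hu.differentiable (by norm_num) x)]
    rcases lt_or_gt_of_ne (hJ z z.2) with h | h
    · have : Jc u x < 0 := by by_contra h'; push Not at h'; nlinarith
      rw [sign_neg h, abs_of_neg this]; simp; ring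
    · have : 0 < Jc u x := by by_contra h'; push Not at h'; nlinarith
      rw [sign_pos h, abs_of_pos this]; simp; ring
  rw [Finset.sum_congr rfl fun z _ => each z, ← Finset.sum_mul]
  congr 1
  push_cast
  rw [← Finset.sum_coe_sort Z]

end Ell

namespace Ell
open MeasureTheory Set Topology

/-- square box around `p` -/
def bx (p : Fin 2 → ℝ) (r : ℝ) : Set (Fin 2 → ℝ) := Icc (fun i => p i - r) (fun i => p i + r)

lemma mem_bx {p x : Fin 2 → ℝ} {r : ℝ} (hr : 0 ≤ r) : x ∈ bx p r ↔ ‖x - p‖ ≤ r := by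
  rw [pi_norm_le_iff_of_nonneg hr]
  unfold bx
  simp only [mem_Icc, Pi.le_def, Pi.sub_apply, Real.norm_eq_abs, abs_le, ← forall_and]
  refine forall_congr' fun i => ?_
  constructor <;> rintro ⟨h1, h2⟩ <;> constructor <;> linarith

lemma bx_boundary {p x : Fin 2 → ℝ} {r : ℝ} (hr : 0 ≤ r)
    (h : ∃ l, x l = p l - r ∨ x l = p l + r) : r ≤ ‖x - p‖ := by
  obtain ⟨l, h⟩ := h
  have := norm_le_pi_norm (x - p) l
  rw [Pi.sub_apply, Real.norm_eq_abs] at this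
  rcases h with h | h <;> rw [h] at this
  · rw [show p l - r - p l = -r by ring, abs_neg, abs_of_nonneg hr] at this; exact this
  · rw [show p l + r - p l = r by ring, abs_of_nonneg hr] at this; exact this

abbrev BDeg (p : Fin 2 → ℝ) (r : ℝ) (u : (Fin 2 → ℝ) → (Fin 2 → ℝ)) (d : ℤ) : Prop :=
  Deg (fun i => p i - r) (fun i => p i + r) u d

lemma BDeg.hom {p : Fin 2 → ℝ} {r : ℝ} (hr : 0 ≤ r) {H : ℝ → (Fin 2 → ℝ) → (Fin 2 → ℝ)}
    (hH : ContDiff ℝ 2 (fun p : ℝ × (Fin 2 → ℝ) => H p.1 p.2))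
    (h0 : ∀ τ ∈ Icc (0 : ℝ) 1, ∀ x, ‖x - p‖ = r → H τ x ≠ 0) (d : ℤ) :
    BDeg p r (H 0) d ↔ BDeg p r (H 1) d := by
  refine Deg.hom (fun i => by linarith) hH ?_ d
  intro τ hτ x hx hl
  exact h0 τ hτ x (le_antisymm ((mem_bx hr).1 hx) (bx_boundary hr hl))

lemma BDeg.line {p : Fin 2 → ℝ} {r : ℝ} (hr : 0 ≤ r) {u v : (Fin 2 → ℝ) → (Fin 2 → ℝ)}
    (hu : ContDiff ℝ 2 u) (hv : ContDiff ℝ 2 v)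
    (h0 : ∀ τ ∈ Icc (0 : ℝ) 1, ∀ x, ‖x - p‖ = r → (1 - τ) • u x + τ • v x ≠ 0) (d : ℤ) :
    BDeg p r u d ↔ BDeg p r v d := by
  have := BDeg.hom hr (H := fun τ x => (1 - τ) • u x + τ • v x) (by fun_prop) h0 d
  simpa using this

lemma BDeg.smul {p : Fin 2 → ℝ} {r : ℝ} (hr : 0 ≤ r) {u : (Fin 2 → ℝ) → (Fin 2 → ℝ)}
    (hu : ContDiff ℝ 2 u) {c : ℝ} (hc : 0 < c)
    (h0 : ∀ x, ‖x - p‖ = r → u x ≠ 0) (d : ℤ) :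
    BDeg p r u d ↔ BDeg p r (fun x => c • u x) d := by
  refine BDeg.line hr hu (by fun_prop) ?_ d
  intro τ hτ x hx
  rw [smul_smul, ← add_smul]
  refine smul_ne_zero ?_ (h0 x hx)
  have h1 := hτ.1; have h2 := hτ.2
  rcases h1.eq_or_lt with h | h
  · rw [← h]; simp
  · have := mul_pos h hc
    have : 0 < 1 - τ + τ * c := by linarith
    exact this.ne'

lemma BDeg.id {p : Fin 2 → ℝ} {r : ℝ} (hr : 0 < r) : BDeg p r (fun x => x - p) 1 := by
  have hp : ∀ i l : Fin 2, ∀ x, pd i (fun x : Fin 2 → ℝ => (x - p) l) x = if l = i then 1 else 0 := by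
    intro i l x
    unfold pd
    have : HasFDerivAt (fun x : Fin 2 → ℝ => (x - p) l)
        (ContinuousLinearMap.proj (R := ℝ) (φ := fun _ : Fin 2 => ℝ) l) x := by
      have := ((ContinuousLinearMap.proj (R := ℝ) (φ := fun _ : Fin 2 => ℝ) l).hasFDerivAt
        (x := x)).sub_const (p l)
      exact this
    rw [this.fderiv]
    simp [Pi.single_apply]
  have hJ : ∀ x, Jc (fun x : Fin 2 → ℝ => x - p) x = 1 := by
    intro x
    unfold Jc
    simp only [hp]; simp
  have := Deg.count (a := fun i => p i - r) (b := fun i => p i + r)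
    (u := fun x : Fin 2 → ℝ => x - p) (by fun_prop) {p}
    (fun x _ h => by simpa [sub_eq_zero] using h) (by simp) (by simp [hr]) (by simp [hJ])
  simpa [hJ] using this

/-- gradient descent iterates -/
noncomputable def gd (g : (Fin 2 → ℝ) → (Fin 2 → ℝ)) (τ : ℝ) : ℕ → (Fin 2 → ℝ) → (Fin 2 → ℝ)
  | 0, x => x
  | n + 1, x => gd g τ n x - τ • g (gd g τ n x)

noncomputable def gS (g : (Fin 2 → ℝ) → (Fin 2 → ℝ)) (n : ℕ) (τ : ℝ) (x : Fin 2 → ℝ) : Fin 2 → ℝ :=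
  ∑ j ∈ Finset.range n, g (gd g τ j x)

lemma gd_eq (g : (Fin 2 → ℝ) → (Fin 2 → ℝ)) (τ : ℝ) (n : ℕ) (x : Fin 2 → ℝ) :
    gd g τ n x = x - τ • gS g n τ x := by
  induction n with
  | zero => simp [gd, gS]
  | succ n ih =>
    rw [gd, gS, Finset.sum_range_succ, ← gS, smul_add, ← sub_sub, ← ih]

lemma gd_contDiff {g : (Fin 2 → ℝ) → (Fin 2 → ℝ)} (hg : ContDiff ℝ 2 g) (n : ℕ) :
    ContDiff ℝ 2 (fun p : ℝ × (Fin 2 → ℝ) => gd g p.1 n p.2) := by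
  induction n with
  | zero => simp only [gd]; fun_prop
  | succ n ih =>
    simp only [gd]
    exact ih.sub (contDiff_fst.smul (hg.comp ih))

lemma gS_contDiff {g : (Fin 2 → ℝ) → (Fin 2 → ℝ)} (hg : ContDiff ℝ 2 g) (n : ℕ) :
    ContDiff ℝ 2 (fun p : ℝ × (Fin 2 → ℝ) => gS g n p.1 p.2) := by
  unfold gS
  exact ContDiff.sum fun j _ => hg.comp (gd_contDiff hg j)

lemma gd_zero (g : (Fin 2 → ℝ) → (Fin 2 → ℝ)) (n : ℕ) (x : Fin 2 → ℝ) : gd g 0 n x = x := by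
  rw [gd_eq]; simp

lemma sq_sum_pos {v : Fin 2 → ℝ} (h : v ≠ 0) : 0 < v 0 ^ 2 + v 1 ^ 2 := by
  by_contra hc
  push Not at hc
  apply h
  have h0 : v 0 = 0 := by nlinarith [sq_nonneg (v 0), sq_nonneg (v 1)]
  have h1 : v 1 = 0 := by nlinarith [sq_nonneg (v 0), sq_nonneg (v 1)]
  ext i; fin_cases i
  · exact h0
  · exact h1

lemma norm_sq_le (v : Fin 2 → ℝ) : ‖v‖ ^ 2 ≤ v 0 ^ 2 + v 1 ^ 2 := by
  have h : ‖v‖ ≤ Real.sqrt (v 0 ^ 2 + v 1 ^ 2) := by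
    rw [pi_norm_le_iff_of_nonneg (Real.sqrt_nonneg _)]
    intro i
    apply Real.le_sqrt_of_sq_le
    rw [Real.norm_eq_abs, sq_abs]
    fin_cases i
    · simp; positivity
    · simp; positivity
  calc ‖v‖ ^ 2 ≤ Real.sqrt (v 0 ^ 2 + v 1 ^ 2) ^ 2 := by gcongr
    _ = _ := Real.sq_sqrt (by positivity)

/-- uniform descent -/
lemma descent {f : (Fin 2 → ℝ) → ℝ} (hf : ContDiff ℝ 2 f) {g : (Fin 2 → ℝ) → (Fin 2 → ℝ)}
    (hgf : ∀ x v, fderiv ℝ f x v = g x 0 * v 0 + g x 1 * v 1)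
    (p : Fin 2 → ℝ) (R : ℝ) :
    ∃ τ₀ > 0, ∀ τ ∈ Icc 0 τ₀, ∀ x ∈ Metric.closedBall p R, x - τ • g x ∈ Metric.closedBall p R →
      f (x - τ • g x) ≤ f x - τ / 2 * (g x 0 ^ 2 + g x 1 ^ 2) := by
  have hf1 : ContDiff ℝ 1 (fderiv ℝ f) := hf.fderiv_right (by norm_num)
  obtain ⟨C, hC⟩ := (hf1.locallyLipschitz.locallyLipschitzOn
    (s := Metric.closedBall p R)).exists_lipschitzOnWith_of_compact (isCompact_closedBall p R)
  refine ⟨1 / (2 * (C + 1)), by positivity, ?_⟩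
  intro τ hτ x hx hy
  set y := x - τ • g x with hyd
  have hseg : segment ℝ x y ⊆ Metric.closedBall p R := (convex_closedBall p R).segment_subset hx hy
  have key := Convex.norm_image_sub_le_of_norm_fderiv_le' (𝕜 := ℝ) (f := f) (φ := fderiv ℝ f x)
    (C := C * ‖y - x‖) (s := segment ℝ x y) (x := x) (y := y)
    (fun z _ => hf.differentiable (by norm_num) z) (by
      intro z hz
      have h1 := hC.dist_le_mul z (hseg hz) x hx
      rw [dist_eq_norm, dist_eq_norm] at h1
      refine h1.trans ?_
      gcongr
      have h2 := norm_sub_le_of_mem_segment hz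
      rwa [norm_sub_rev y x, norm_sub_rev z x] at *) (convex_segment x y)
    (left_mem_segment ℝ x y) (right_mem_segment ℝ x y)
  have hyx : y - x = -(τ • g x) := by rw [hyd]; abel
  rw [hyx, hgf] at key
  have hn : ‖-(τ • g x)‖ ^ 2 = τ ^ 2 * ‖g x‖ ^ 2 := by
    rw [norm_neg, norm_smul, mul_pow, Real.norm_eq_abs, sq_abs]
  rw [mul_assoc, ← sq, hn, Real.norm_eq_abs] at key
  have k1 := (abs_le.1 key).2
  simp only [Pi.neg_apply, Pi.smul_apply, smul_eq_mul] at k1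
  have k2 := norm_sq_le (g x)
  set N := g x 0 ^ 2 + g x 1 ^ 2 with hN
  have hC0 : (0 : ℝ) ≤ C := C.2
  have h3 : C * (τ ^ 2 * ‖g x‖ ^ 2) ≤ τ / 2 * N := by
    have hτ1 := hτ.1; have hτ2 := hτ.2
    rw [le_div_iff₀ (by positivity)] at hτ2
    have : C * τ ≤ 1 / 2 := by nlinarith
    calc C * (τ ^ 2 * ‖g x‖ ^ 2) ≤ C * (τ ^ 2 * N) := by gcongr
      _ = (C * τ) * (τ * N) := by ring
      _ ≤ 1 / 2 * (τ * N) := by gcongr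
      _ = _ := by ring
  nlinarith

end Ell

namespace Ell
open MeasureTheory Set Topology

theorem iso_min {f : (Fin 2 → ℝ) → ℝ} (hf : ContDiff ℝ 2 f) {g : (Fin 2 → ℝ) → (Fin 2 → ℝ)}
    (hg : ContDiff ℝ 2 g) (hgf : ∀ x v, fderiv ℝ f x v = g x 0 * v 0 + g x 1 * v 1)
    (p : Fin 2 → ℝ) {R : ℝ} (hR : 0 < R) (hfp : f p = 0)
    (hpos : ∀ x, ‖x - p‖ ≤ R → x ≠ p → 0 < f x)
    (hg0 : ∀ x, ‖x - p‖ ≤ R → x ≠ p → g x ≠ 0) :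
    ∃ r, 0 < r ∧ r < R ∧ BDeg p r g 1 := by
  have hnn : ∀ x, ‖x - p‖ ≤ R → 0 ≤ f x := by
    intro x hx
    by_cases h : x = p
    · rw [h, hfp]
    · exact (hpos x hx h).le
  -- the annulus
  obtain ⟨m₂, hm₂, hm₂'⟩ := ((isCompact_closedBall p R).diff
    (Metric.isOpen_ball (x := p) (ε := R / 2))).exists_forall_le' (f := f)
    hf.continuous.continuousOn (a := 0) (by
      rintro x ⟨hx, hx2⟩
      rw [Metric.mem_closedBall, dist_eq_norm] at hx
      refine hpos x hx fun h => hx2 ?_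
      rw [h]; exact Metric.mem_ball_self (by linarith))
  obtain ⟨M, hM0, hMm⟩ : ∃ M, 0 < M ∧ M < m₂ := ⟨m₂ / 2, by linarith, by linarith⟩
  have hnb : ∀ᶠ x in 𝓝 p, f x < M := by
    apply hf.continuous.continuousAt.eventually_lt continuousAt_const
    rwa [hfp]
  obtain ⟨r', hr', hrM'⟩ := Metric.eventually_nhds_iff_ball.1 hnb
  obtain ⟨r, hr, hrR, hrr⟩ : ∃ r, 0 < r ∧ r < R ∧ r < r' :=
    ⟨min R r' / 2, by positivity, by
      have := min_le_left R r'; linarith [lt_min hR hr'], by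
      have := min_le_right R r'; linarith [lt_min hR hr']⟩
  have hrM : ∀ x, ‖x - p‖ ≤ r → f x ≤ M := fun x hx =>
    (hrM' x (by rw [Metric.mem_ball, dist_eq_norm]; linarith)).le
  refine ⟨r, hr, hrR, ?_⟩
  -- small steps
  obtain ⟨τ₁, hτ₁, hdesc⟩ := descent hf hgf p R
  obtain ⟨C, hC⟩ := (isCompact_closedBall p R).exists_bound_of_continuousOn
    hg.continuous.continuousOn
  have hC0 : 0 ≤ C := (norm_nonneg _).trans (hC p (Metric.mem_closedBall_self hR.le))
  set τ₀ := min τ₁ (R / 2 / (C + 1)) with hτ₀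
  have hτ₀0 : 0 < τ₀ := by positivity
  have hstep : ∀ τ ∈ Icc 0 τ₀, ∀ x, ‖x - p‖ ≤ R → f x ≤ M →
      ‖(x - τ • g x) - p‖ ≤ R ∧ f (x - τ • g x) ≤ f x - τ / 2 * (g x 0 ^ 2 + g x 1 ^ 2) := by
    intro τ hτ x hx hfx
    have hxb : x ∈ Metric.closedBall p R := by rwa [Metric.mem_closedBall, dist_eq_norm]
    have h1 : ‖x - p‖ < R / 2 := by
      by_contra h
      push Not at h
      have := hm₂' x ⟨hxb, fun h' => by rw [Metric.mem_ball, dist_eq_norm] at h'; linarith⟩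
      linarith
    have h2 : ‖τ • g x‖ ≤ R / 2 := by
      rw [norm_smul, Real.norm_eq_abs, abs_of_nonneg hτ.1]
      have h3 : τ ≤ R / 2 / (C + 1) := hτ.2.trans (min_le_right _ _)
      rw [le_div_iff₀ (by positivity)] at h3
      have := hC x hxb
      nlinarith [hτ.1]
    have h4 : ‖(x - τ • g x) - p‖ ≤ R := by
      rw [show x - τ • g x - p = (x - p) - τ • g x by abel]
      linarith [norm_sub_le (x - p) (τ • g x)]
    exact ⟨h4, hdesc τ ⟨hτ.1, hτ.2.trans (min_le_left _ _)⟩ x hxb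
      (by rwa [Metric.mem_closedBall, dist_eq_norm])⟩
  have hiter : ∀ τ ∈ Icc 0 τ₀, ∀ x, ‖x - p‖ ≤ R → f x ≤ M → ∀ n,
      ‖gd g τ n x - p‖ ≤ R ∧ f (gd g τ n x) ≤ f x - τ / 2 *
        ∑ j ∈ Finset.range n, (g (gd g τ j x) 0 ^ 2 + g (gd g τ j x) 1 ^ 2) := by
    intro τ hτ x hx hfx n
    induction n with
    | zero => simp [gd, hx]
    | succ n ih =>
      have hs : 0 ≤ τ / 2 * ∑ j ∈ Finset.range n, (g (gd g τ j x) 0 ^ 2 + g (gd g τ j x) 1 ^ 2) :=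
        mul_nonneg (by linarith [hτ.1]) (Finset.sum_nonneg fun j _ => by positivity)
      have := hstep τ hτ _ ih.1 (by linarith [ih.2])
      rw [gd]
      refine ⟨this.1, ?_⟩
      rw [Finset.sum_range_succ, mul_add]
      linarith [this.2, ih.2]
  -- number of steps
  obtain ⟨m, hm, hm'⟩ := ((isCompact_closedBall p R).diff
    (Metric.isOpen_ball (x := p) (ε := r))).exists_forall_le' (f := f)
    hf.continuous.continuousOn (a := 0) (by
      rintro x ⟨hx, hx2⟩
      rw [Metric.mem_closedBall, dist_eq_norm] at hx
      refine hpos x hx fun h => hx2 ?_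
      rw [h]; exact Metric.mem_ball_self hr)
  obtain ⟨c, hc, hc'⟩ := ((isCompact_closedBall p R).inter_right
    (isClosed_le continuous_const hf.continuous : IsClosed {x | m ≤ f x})).exists_forall_le'
    (f := fun x => g x 0 ^ 2 + g x 1 ^ 2) (by
      have h0 : Continuous fun x => g x 0 := (continuous_apply 0).comp hg.continuous
      have h1 : Continuous fun x => g x 1 := (continuous_apply 1).comp hg.continuous
      fun_prop) (a := 0) (by
      rintro x ⟨hx, hx2⟩
      rw [Metric.mem_closedBall, dist_eq_norm] at hx
      apply sq_sum_pos
      refine hg0 x hx fun h => ?_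
      rw [h, mem_ofPred_eq, hfp] at hx2
      linarith)
  obtain ⟨n, hn⟩ := exists_nat_gt (M / (τ₀ / 2 * c))
  have hn0 : 0 < n := by
    have : (0 : ℝ) < n := lt_of_le_of_lt (by positivity) hn
    exact_mod_cast this
  rw [div_lt_iff₀ (by positivity)] at hn
  have hend : ∀ x, ‖x - p‖ ≤ r → ‖gd g τ₀ n x - p‖ < r := by
    intro x hx
    have hit := hiter τ₀ ⟨hτ₀0.le, le_rfl⟩ x (by linarith) (hrM x hx)
    by_contra hcon
    push Not at hcon
    have hmn : m ≤ f (gd g τ₀ n x) := hm' _ ⟨by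
      rw [Metric.mem_closedBall, dist_eq_norm]; exact (hit n).1, fun h => by
      rw [Metric.mem_ball, dist_eq_norm] at h; linarith⟩
    have hmono : ∀ j, f (gd g τ₀ (j + 1) x) ≤ f (gd g τ₀ j x) := by
      intro j
      have hs : 0 ≤ τ₀ / 2 * ∑ j ∈ Finset.range j, (g (gd g τ₀ j x) 0 ^ 2 + g (gd g τ₀ j x) 1 ^ 2) :=
        mul_nonneg (by linarith) (Finset.sum_nonneg fun j _ => by positivity)
      have := (hstep τ₀ ⟨hτ₀0.le, le_rfl⟩ _ (hit j).1 (by linarith [(hit j).2, hrM x hx])).2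
      rw [gd]
      have : 0 ≤ τ₀ / 2 * (g (gd g τ₀ j x) 0 ^ 2 + g (gd g τ₀ j x) 1 ^ 2) := by positivity
      linarith
    have hanti := antitone_nat_of_succ_le (f := fun j => f (gd g τ₀ j x)) hmono
    have hsum : (n : ℝ) * c ≤ ∑ j ∈ Finset.range n,
        (g (gd g τ₀ j x) 0 ^ 2 + g (gd g τ₀ j x) 1 ^ 2) := by
      have : ∑ j ∈ Finset.range n, c ≤ ∑ j ∈ Finset.range n,
        (g (gd g τ₀ j x) 0 ^ 2 + g (gd g τ₀ j x) 1 ^ 2) := by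
        refine Finset.sum_le_sum fun j hj => ?_
        refine hc' _ ⟨?_, ?_⟩
        · rw [Metric.mem_closedBall, dist_eq_norm]; exact (hit j).1
        · exact hmn.trans (hanti (Finset.mem_range.1 hj).le)
      simpa using this
    have h1 := (hit n).2
    have h2 := hrM x hx
    have h3 : τ₀ / 2 * (n * c) ≤ τ₀ / 2 * ∑ j ∈ Finset.range n,
        (g (gd g τ₀ j x) 0 ^ 2 + g (gd g τ₀ j x) 1 ^ 2) := by gcongr
    nlinarith
  have hbne : ∀ x, ‖x - p‖ = r → x ≠ p := by
    rintro x hx rfl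
    simp at hx; linarith
  have hSne : ∀ τ ∈ Icc 0 τ₀, ∀ x, ‖x - p‖ = r → gS g n τ x ≠ 0 := by
    intro τ hτ x hx h
    have hgx := hg0 x (by linarith) (hbne x hx)
    rcases hτ.1.eq_or_lt with h0 | h0
    · rw [← h0] at h
      simp only [gS, gd_zero, Finset.sum_const, Finset.card_range] at h
      rw [smul_eq_zero] at h
      rcases h with h | h
      · omega
      · exact hgx h
    · have h1 := (hiter τ hτ x (by linarith) (hrM x hx.le) n).2
      have h2 : gd g τ n x = x := by rw [gd_eq, h]; simp
      rw [h2] at h1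
      have h3 : g x 0 ^ 2 + g x 1 ^ 2 ≤
        ∑ j ∈ Finset.range n, (g (gd g τ j x) 0 ^ 2 + g (gd g τ j x) 1 ^ 2) := by
        have := Finset.single_le_sum (f := fun j => g (gd g τ j x) 0 ^ 2 + g (gd g τ j x) 1 ^ 2)
          (s := Finset.range n) (fun j _ => by positivity) (Finset.mem_range.2 hn0)
        simpa [gd] using this
      have h4 := sq_sum_pos hgx
      nlinarith
  have hSc := gS_contDiff hg n
  have hSc0 : ContDiff ℝ 2 (gS g n τ₀) := hSc.comp (contDiff_prodMk_right τ₀)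
  have e1 := BDeg.smul hr.le hg (c := (n : ℝ)) (by exact_mod_cast hn0)
    (fun x hx => hg0 x (by linarith) (hbne x hx)) 1
  have e2 := BDeg.hom (p := p) hr.le (H := fun τ x => gS g n (τ * τ₀) x) (by
      exact hSc.comp (f := fun q : ℝ × (Fin 2 → ℝ) => (q.1 * τ₀, q.2)) (by fun_prop)) (by
      intro τ hτ x hx
      exact hSne _ ⟨mul_nonneg hτ.1 hτ₀0.le, by nlinarith [hτ.2]⟩ x hx) 1
  have e3 := BDeg.smul hr.le hSc0 (c := τ₀) hτ₀0
    (fun x hx => hSne _ ⟨hτ₀0.le, le_rfl⟩ x hx) 1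
  have e4 := BDeg.line (p := p) hr.le (u := fun x => τ₀ • gS g n τ₀ x) (v := fun x => x - p)
    (by fun_prop) (by fun_prop) (by
      intro τ hτ x hx h
      have h1 : τ₀ • gS g n τ₀ x = x - gd g τ₀ n x := by rw [gd_eq]; abel
      rw [h1] at h
      have h2 : x - p = (1 - τ) • (gd g τ₀ n x - p) := by
        rw [← sub_eq_zero, ← h]; module
      have h3 := hend x hx.le
      have h4 := congrArg norm h2
      rw [hx, norm_smul, Real.norm_eq_abs, abs_of_nonneg (by linarith [hτ.2])] at h4
      nlinarith [hτ.1, norm_nonneg (gd g τ₀ n x - p)]) 1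
  have e5 : (fun x => (n : ℝ) • g x) = gS g n (0 * τ₀) := by
    funext x
    simp only [gS, zero_mul, gd_zero, Finset.sum_const, Finset.card_range, Nat.cast_smul_eq_nsmul]
  rw [e1, e5, e2]
  simp only [one_mul]
  rw [e3, e4]
  exact BDeg.id hr

end Ell

namespace Ell
open Polynomial Set
open scoped Polynomial.Bivariate ComplexConjugate

noncomputable def zt : (Fin 2 → ℝ) →L[ℝ] ℂ :=
  Complex.ofRealCLM.comp (ContinuousLinearMap.proj (R := ℝ) (φ := fun _ : Fin 2 => ℝ) 0) +
    (Complex.I • Complex.ofRealCLM).comp (ContinuousLinearMap.proj (R := ℝ) (φ := fun _ : Fin 2 => ℝ) 1)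

noncomputable def ztc : (Fin 2 → ℝ) →L[ℝ] ℂ := (Complex.conjCLE : ℂ →L[ℝ] ℂ).comp zt

lemma zt_apply (x : Fin 2 → ℝ) : zt x = ⟨x 0, x 1⟩ := by
  apply Complex.ext <;> simp [zt]

lemma ztc_apply (x : Fin 2 → ℝ) : ztc x = conj (zt x) := rfl

lemma zt_re (x : Fin 2 → ℝ) : (zt x).re = x 0 := by rw [zt_apply]
lemma zt_im (x : Fin 2 → ℝ) : (zt x).im = x 1 := by rw [zt_apply]

lemma zt_inj : Function.Injective zt := by
  intro x y h
  ext i; fin_cases i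
  · simpa [zt_re] using congrArg Complex.re h
  · simpa [zt_im] using congrArg Complex.im h

lemma zt_surj (c : ℂ) : zt ![c.re, c.im] = c := by
  rw [zt_apply]; apply Complex.ext <;> simp

noncomputable def ev (p : ℂ[X][Y]) (x : Fin 2 → ℝ) : ℂ := p.evalEval (zt x) (conj (zt x))

lemma ev_add (p r : ℂ[X][Y]) (x) : ev (p + r) x = ev p x + ev r x := by simp [ev]
lemma ev_sub (p r : ℂ[X][Y]) (x) : ev (p - r) x = ev p x - ev r x := by simp [ev]
lemma ev_mul (p r : ℂ[X][Y]) (x) : ev (p * r) x = ev p x * ev r x := by simp [ev]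
lemma ev_pow (p : ℂ[X][Y]) (n : ℕ) (x) : ev (p ^ n) x = ev p x ^ n := by simp [ev]
lemma ev_one (x) : ev 1 x = 1 := by simp [ev]
lemma ev_CC (c : ℂ) (x) : ev (C (C c)) x = c := by simp [ev, evalEval]
lemma ev_z (x) : ev (C X) x = zt x := by simp [ev, evalEval]
lemma ev_w (x) : ev X x = conj (zt x) := by simp [ev, evalEval]

lemma ev_monomial (n m : ℕ) (r : ℂ) (x : Fin 2 → ℝ) :
    ev (monomial n (monomial m r)) x = r * (zt x ^ m * ztc x ^ n) := by
  rw [ev, evalEval_monomial, mul_assoc]; rfl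

lemma ev_hasFDerivAt (p : ℂ[X][Y]) (x : Fin 2 → ℝ) :
    HasFDerivAt (ev p) (ev (dz p) x • zt + ev (derivative p) x • ztc) x := by
  induction p using bi_induction with
  | hadd p r hp hr =>
    have : ev (p + r) = fun x => ev p x + ev r x := funext fun x => ev_add p r x
    rw [this]
    refine (hp.add hr).congr_fderiv ?_
    ext v
    simp [dz_add, ev_add]
    ring
  | hm n m r =>
    have : ev (monomial n (monomial m r)) = fun x => r * (zt x ^ m * ztc x ^ n) :=
      funext fun x => ev_monomial n m r x
    rw [this]
    have h1 : dz (monomial n (monomial m r) : ℂ[X][Y]) = monomial n (monomial (m - 1) (r * m)) := by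
      ext j i
      rw [coeff_dz, coeff_monomial, coeff_monomial]
      split_ifs
      · rw [derivative_monomial]
      · simp
    have h2 : derivative (monomial n (monomial m r) : ℂ[X][Y]) = monomial (n - 1) (monomial m (r * n)) := by
      rw [derivative_monomial]
      congr 1
      rw [← C_eq_natCast, mul_comm, C_mul_monomial, mul_comm]
    rw [h1, h2, ev_monomial, ev_monomial]
    have hz : HasFDerivAt (fun x => zt x) zt x := zt.hasFDerivAt
    have hc : HasFDerivAt (fun x => ztc x) ztc x := ztc.hasFDerivAt
    refine (((hz.pow m).mul (hc.pow n)).const_mul r).congr_fderiv ?_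
    ext v
    simp
    ring

lemma ev_contDiff (p : ℂ[X][Y]) {n : WithTop ℕ∞} : ContDiff ℝ n (ev p) := by
  induction p using bi_induction with
  | hadd p r hp hr =>
    have : ev (p + r) = fun x => ev p x + ev r x := funext fun x => ev_add p r x
    rw [this]; exact hp.add hr
  | hm i m r =>
    have : ev (monomial i (monomial m r)) = fun x => r * (zt x ^ m * ztc x ^ i) :=
      funext fun x => ev_monomial i m r x
    rw [this]
    exact contDiff_const.mul ((zt.contDiff.pow m).mul (ztc.contDiff.pow i))

/-- real-valued function -/
noncomputable def re (p : ℂ[X][Y]) (x : Fin 2 → ℝ) : ℝ := (ev p x).re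

noncomputable def uu (p : ℂ[X][Y]) (x : Fin 2 → ℝ) : Fin 2 → ℝ := ![(ev p x).re, (ev p x).im]

lemma re_contDiff (p : ℂ[X][Y]) {n : WithTop ℕ∞} : ContDiff ℝ n (re p) :=
  Complex.reCLM.contDiff.comp (ev_contDiff p)

lemma uu_contDiff (p : ℂ[X][Y]) {n : WithTop ℕ∞} : ContDiff ℝ n (uu p) := by
  rw [contDiff_pi]
  intro i
  fin_cases i
  · exact Complex.reCLM.contDiff.comp (ev_contDiff p)
  · exact Complex.imCLM.contDiff.comp (ev_contDiff p)

lemma uu_eq_zero {p : ℂ[X][Y]} {x : Fin 2 → ℝ} : uu p x = 0 ↔ ev p x = 0 := by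
  constructor
  · intro h
    apply Complex.ext
    · simpa [uu] using congrFun h 0
    · simpa [uu] using congrFun h 1
  · intro h; ext i; fin_cases i <;> simp [uu, h]

lemma fderiv_re (p : ℂ[X][Y]) (x v : Fin 2 → ℝ) :
    fderiv ℝ (fun x => (ev p x).re) x v = (ev (dz p) x * zt v + ev (derivative p) x * conj (zt v)).re := by
  have := (Complex.reCLM.hasFDerivAt (x := ev p x)).comp x (ev_hasFDerivAt p x)
  have h2 : HasFDerivAt (fun x => (ev p x).re) _ x := this
  rw [h2.fderiv]
  simp [ztc_apply]

lemma fderiv_im (p : ℂ[X][Y]) (x v : Fin 2 → ℝ) :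
    fderiv ℝ (fun x => (ev p x).im) x v = (ev (dz p) x * zt v + ev (derivative p) x * conj (zt v)).im := by
  have := (Complex.imCLM.hasFDerivAt (x := ev p x)).comp x (ev_hasFDerivAt p x)
  have h2 : HasFDerivAt (fun x => (ev p x).im) _ x := this
  rw [h2.fderiv]
  simp [ztc_apply]

lemma Jc_uu (b : ℂ[X][Y]) (x : Fin 2 → ℝ) :
    Jc (uu b) x = - (jac (sg b) b (zt x) (conj (zt x))).re := by
  rw [jac_real, Complex.ofReal_re]
  have e0 : (fun x => uu b x 0) = fun x => (ev b x).re := rfl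
  have e1 : (fun x => uu b x 1) = fun x => (ev b x).im := rfl
  have z0 : zt (Pi.single 0 1) = 1 := by rw [zt_apply]; apply Complex.ext <;> simp
  have z1 : zt (Pi.single 1 1) = Complex.I := by rw [zt_apply]; apply Complex.ext <;> simp
  unfold Jc pd
  rw [e0, e1, fderiv_re, fderiv_im, fderiv_re, fderiv_im, z0, z1]
  unfold ev
  simp [Complex.normSq_apply]
  ring

lemma ev_sg (p : ℂ[X][Y]) (x : Fin 2 → ℝ) : ev (sg p) x = conj (ev p x) := by
  unfold ev; rw [sg_eval]; simp

lemma ev_real {F : ℂ[X][Y]} (hF : sg F = F) (x : Fin 2 → ℝ) : ev F x = (re F x : ℂ) := by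
  have := ev_sg F x
  rw [hF] at this
  exact (Complex.conj_eq_iff_re.mp this.symm).symm

lemma ev_dz_real {F : ℂ[X][Y]} (hF : sg F = F) (x : Fin 2 → ℝ) :
    ev (dz F) x = conj (ev (derivative F) x) := by
  rw [← ev_sg, ← dz_sg, hF]

lemma grad_re {F : ℂ[X][Y]} (hF : sg F = F) (x v : Fin 2 → ℝ) :
    fderiv ℝ (re F) x v = ((2 : ℝ) • uu (derivative F) x) 0 * v 0 + ((2 : ℝ) • uu (derivative F) x) 1 * v 1 := by
  have : fderiv ℝ (re F) x v = _ := fderiv_re F x v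
  rw [this, ev_dz_real hF]
  simp [uu, zt_re, zt_im]
  ring

end Ell

namespace Ell
open Polynomial Set Topology
open scoped Polynomial.Bivariate ComplexConjugate

lemma local_min {F : ℂ[X][Y]} (hF : sg F = F) (P : Finset (Fin 2 → ℝ))
    (hP : ∀ x, re F x = 0 ↔ x ∈ P) (hpos : ∀ x, 0 ≤ re F x) {p : Fin 2 → ℝ} (hp : p ∈ P)
    {ρ : ℝ} (hρ : 0 < ρ) :
    ∃ r, 0 < r ∧ r < ρ ∧ BDeg p r (uu (derivative F)) 1 ∧
      ∀ x, ‖x - p‖ ≤ r → x ≠ p → (uu (derivative F) x ≠ 0 ∧ 0 < re F x) := by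
  classical
  obtain ⟨T, hT⟩ := crit_finite F
  have hfp : re F p = 0 := (hP p).2 hp
  have h1 : ∀ᶠ x in 𝓝 p, ev F x ∉ (T.erase 0) := by
    have hc : ContinuousAt (ev F) p := (ev_contDiff F (n := 0)).continuous.continuousAt
    have ho : IsOpen (((T.erase 0 : Finset ℂ) : Set ℂ)ᶜ) := (Finset.finite_toSet _).isClosed.isOpen_compl
    exact hc (ho.mem_nhds (by rw [ev_real hF, hfp]; simp))
  have h2 : ∀ᶠ x in 𝓝 p, x ∉ P.erase p := by
    have ho : IsOpen (((P.erase p : Finset _) : Set (Fin 2 → ℝ))ᶜ) := (Finset.finite_toSet _).isClosed.isOpen_compl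
    exact ho.mem_nhds (by simp)
  obtain ⟨R', hR', hball⟩ := Metric.eventually_nhds_iff.mp (h1.and h2)
  have key : ∀ x, ‖x - p‖ ≤ min ρ (R' / 2) → x ≠ p → (uu (derivative F) x ≠ 0 ∧ 0 < re F x) := by
    intro x hx hxp
    have hd : dist x p < R' := by
      rw [dist_eq_norm]; exact lt_of_le_of_lt (hx.trans (min_le_right _ _)) (by linarith)
    obtain ⟨ha, hb⟩ := hball hd
    have hfx : re F x ≠ 0 := fun h => hb (Finset.mem_erase.mpr ⟨hxp, (hP x).1 h⟩)
    refine ⟨fun h => ?_, lt_of_le_of_ne (hpos x) (Ne.symm hfx)⟩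
    rw [uu_eq_zero] at h
    apply ha
    rw [Finset.mem_erase]
    refine ⟨by rw [ev_real hF]; exact_mod_cast hfx, hT _ _ ?_ h⟩
    have := ev_dz_real hF x
    rw [h, map_zero] at this
    exact this
  have hRpos : 0 < min ρ (R' / 2) := lt_min hρ (by linarith)
  obtain ⟨r, hr, hrR, hdeg⟩ := iso_min (re_contDiff F) (g := fun x => (2 : ℝ) • uu (derivative F) x)
    (by have := uu_contDiff (derivative F) (n := 2); fun_prop) (grad_re hF) p hRpos hfp
    (fun x hx hxp => (key x hx hxp).2)
    (fun x hx hxp => smul_ne_zero two_ne_zero (key x hx hxp).1)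
  have key' : ∀ x, ‖x - p‖ ≤ r → x ≠ p → (uu (derivative F) x ≠ 0 ∧ 0 < re F x) :=
    fun x hx => key x (hx.trans hrR.le)
  refine ⟨r, hr, lt_of_lt_of_le hrR (min_le_left _ _), ?_, key'⟩
  refine (BDeg.smul hr.le (uu_contDiff _) (c := 2) (by norm_num) ?_ 1).mpr hdeg
  intro x hx
  exact (key' x hx.le (by rintro rfl; simp at hx; linarith)).1

end Ell

namespace Ell
open Polynomial Set Topology
open scoped Polynomial.Bivariate ComplexConjugate

lemma BDeg.sum_eq {p : Fin 2 → ℝ} {r : ℝ} (hr : 0 < r) {u : (Fin 2 → ℝ) → (Fin 2 → ℝ)}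
    (hu : ContDiff ℝ 2 u) (Z : Finset (Fin 2 → ℝ)) (hZ : ∀ x, u x = 0 ↔ x ∈ Z)
    (hJ : ∀ z ∈ Z, Jc u z ≠ 0) (hb : ∀ x, ‖x - p‖ = r → u x ≠ 0) {d : ℤ} (hd : BDeg p r u d) :
    ∑ z ∈ Z.filter (fun x => ‖x - p‖ ≤ r), (SignType.sign (Jc u z) : ℤ) = d := by
  classical
  refine (Deg.count hu (Z.filter (fun x => ‖x - p‖ ≤ r)) ?_ ?_ ?_ ?_).unique hd
  · intro x hx h0
    rw [Finset.mem_filter]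
    exact ⟨(hZ x).1 h0, (mem_bx hr.le).1 hx⟩
  · intro z hz
    exact (hZ z).2 (Finset.mem_filter.1 hz).1
  · intro z hz l
    obtain ⟨h1, h2⟩ := Finset.mem_filter.1 hz
    have h3 : ‖z - p‖ < r := lt_of_le_of_ne h2 (fun h => hb z h ((hZ z).2 h1))
    have h4 := norm_le_pi_norm (z - p) l
    rw [Pi.sub_apply, Real.norm_eq_abs] at h4
    have h5 := abs_lt.1 (lt_of_le_of_lt h4 h3)
    constructor <;> linarith [h5.1, h5.2]
  · intro z hz
    exact hJ z (Finset.mem_filter.1 hz).1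

theorem count_main {q d : ℕ} (hqd : q = 2 * d) {b W : ℂ[X][Y]} (hp : Pair q (sg b) b)
    (hg : Good q (sg b) b) (hW : Cls (q + 3) (q + 3) (2 * q + 3) W) (hWs : sg W = W)
    (P : Finset (Fin 2 → ℝ)) (r : (Fin 2 → ℝ) → ℝ) (R : ℝ) (hr : ∀ p ∈ P, 0 < r p) (hR : 0 < R)
    (hdis : ∀ p ∈ P, ∀ p' ∈ P, p ≠ p' → ∀ x, ‖x - p‖ ≤ r p → ‖x - p'‖ ≤ r p' → False)
    (hbd : ∀ p ∈ P, BDeg p (r p) (uu b) 1) (hBd : BDeg 0 R (uu b) 1)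
    (hin : ∀ x, uu b x = 0 → ‖x‖ < R) (hne : ∀ p ∈ P, ∀ x, ‖x - p‖ = r p → uu b x ≠ 0)
    (hneg : ∀ p ∈ P, ∀ x, ‖x - p‖ ≤ r p → uu b x = 0 → re W x < 0)
    (hpos : ∀ x, uu b x = 0 → (∀ p ∈ P, r p < ‖x - p‖) → 0 < re W x) :
    2 * (d + 1) ^ 2 + 2 * P.card ≤ 1 + mu q := by
  classical
  obtain ⟨Z, hZc, hZm, hZj, -, hEJ⟩ := hg.zeros hp
  set Rl := Z.filter (fun p => p.1 = conj p.2) with hRl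
  -- the embedding of real points
  let ι : (Fin 2 → ℝ) ↪ ℂ × ℂ := ⟨fun x => (zt x, conj (zt x)), fun x y h => zt_inj (congrArg Prod.fst h)⟩
  let Z' : Finset (Fin 2 → ℝ) := Rl.image (fun c => ![c.1.re, c.1.im])
  have hZ' : Rl = Z'.map ι := by
    ext c
    rw [Finset.mem_map]
    constructor
    · intro hc
      refine ⟨![c.1.re, c.1.im], Finset.mem_image_of_mem _ hc, ?_⟩
      have := (Finset.mem_filter.1 hc).2
      change (zt _, conj (zt _)) = c
      rw [zt_surj]
      refine Prod.ext rfl ?_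
      change conj c.1 = c.2
      rw [this, Complex.conj_conj]
    · rintro ⟨x, hx, rfl⟩
      obtain ⟨c, hc, rfl⟩ := Finset.mem_image.1 hx
      have := (Finset.mem_filter.1 hc).2
      convert hc using 1
      change (zt _, conj (zt _)) = c
      rw [zt_surj]
      refine Prod.ext rfl ?_
      change conj c.1 = c.2
      rw [this, Complex.conj_conj]
  have hZ'm : ∀ x, uu b x = 0 ↔ x ∈ Z' := by
    intro x
    have h1 : x ∈ Z' ↔ ι x ∈ Rl := by rw [hZ', Finset.mem_map' ]
    rw [h1, hRl, Finset.mem_filter, hZm, uu_eq_zero]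
    change _ ↔ (_ = 0 ∧ _ = 0) ∧ zt x = conj (conj (zt x))
    change _ ↔ (ev (sg b) x = 0 ∧ ev b x = 0) ∧ _
    rw [ev_sg]
    simp
  have hJ : ∀ x ∈ Z', jac (sg b) b (zt x) (conj (zt x)) = ((-Jc (uu b) x : ℝ) : ℂ) := by
    intro x _
    rw [Jc_uu, neg_neg, jac_real, Complex.ofReal_re]
  have hJ0 : ∀ x ∈ Z', Jc (uu b) x ≠ 0 := by
    intro x hx h
    have h1 : ι x ∈ Rl := by rw [hZ']; exact Finset.mem_map_of_mem _ hx
    apply hZj _ (Finset.mem_filter.1 h1).1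
    change jac (sg b) b (zt x) (conj (zt x)) = 0
    rw [hJ x hx, h]; simp
  -- small shift
  have hη : ∃ η : ℝ, 0 < η ∧ (∀ c ∈ Z, W.evalEval c.1 c.2 ≠ η) ∧
      ∀ x ∈ Z', 0 < re W x → η < re W x := by
    have e1 : ∀ᶠ η : ℝ in 𝓝[>] 0, ∀ c ∈ Z, W.evalEval c.1 c.2 ≠ η := by
      rw [Filter.eventually_all_finset]
      intro c _
      by_cases h : W.evalEval c.1 c.2 = 0
      · filter_upwards [self_mem_nhdsWithin] with η hη h2
        rw [h] at h2
        have : η = 0 := by exact_mod_cast h2.symm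
        exact (ne_of_gt hη) this
      · apply Filter.Eventually.filter_mono nhdsWithin_le_nhds
        have hc : ContinuousAt (fun η : ℝ => (η : ℂ)) 0 := Complex.continuous_ofReal.continuousAt
        have : ∀ᶠ y : ℂ in 𝓝 ((0 : ℝ) : ℂ), y ≠ W.evalEval c.1 c.2 := by
          apply isOpen_ne.mem_nhds
          simpa using Ne.symm h
        filter_upwards [hc this] with η hη
        exact Ne.symm hη
    have e2 : ∀ᶠ η : ℝ in 𝓝[>] 0, ∀ x ∈ Z', 0 < re W x → η < re W x := by
      rw [Filter.eventually_all_finset]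
      intro x _
      by_cases h : 0 < re W x
      · apply Filter.Eventually.filter_mono nhdsWithin_le_nhds
        filter_upwards [gt_mem_nhds h] with η hη _
        exact hη
      · exact Filter.Eventually.of_forall fun η h' => absurd h' h
    obtain ⟨η, h1, h2, h3⟩ := ((self_mem_nhdsWithin : Ioi (0 : ℝ) ∈ 𝓝[>] 0) |> fun h =>
      (Filter.Eventually.and h (e1.and e2))).exists
    exact ⟨η, h1, h2, h3⟩
  obtain ⟨η, hη0, hηZ, hηp⟩ := hη
  set W' := W - C (C (η : ℂ)) with hW'
  have hsig := sig_count hqd hp hg (hW.sub (Cls.CC _ _ _ (η : ℂ))) (by rw [map_sub, hWs, sg_CC]; simp) Z hZc hZm hZj hEJ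
    (by
      intro c hc
      have : (C (C (η : ℂ)) : ℂ[X][Y]).evalEval c.1 c.2 = η := by simp [evalEval]
      rw [evalEval_sub, this]
      exact sub_ne_zero.mpr (hηZ c hc))
  rw [← hW', ← hRl] at hsig
  -- translate
  set N := Z'.filter (fun x => 0 < re W' x * Jc (uu b) x) with hN
  have hre : ∀ x, re W' x = re W x - η := by
    intro x
    rw [hW', re, ev_sub, ev_CC]; simp [re]
  have hNc : (Rl.filter (fun p => (W'.evalEval p.1 p.2 / jac (sg b) b p.1 p.2).re < 0)).card = N.card := by
    rw [hZ', Finset.filter_map, Finset.card_map]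
    congr 1
    apply Finset.filter_congr
    intro x hx
    change (ev W' x / jac (sg b) b (zt x) (conj (zt x))).re < 0 ↔ _
    rw [hJ x hx, Complex.div_ofReal_re]
    change re W' x / _ < 0 ↔ _
    have hj := hJ0 x hx
    rw [div_neg, neg_lt_zero, div_eq_mul_inv]
    rcases lt_or_gt_of_ne hj with h | h
    · have h' := inv_lt_zero.2 h
      constructor <;> intro hh
      · exact mul_pos_of_neg_of_neg (by by_contra hc; nlinarith [mul_nonpos_of_nonneg_of_nonpos (not_lt.1 hc) h'.le]) h
      · exact mul_pos_of_neg_of_neg (by by_contra hc; nlinarith [mul_nonpos_of_nonneg_of_nonpos (not_lt.1 hc) h.le]) h'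
    · rw [mul_pos_iff_of_pos_right h, mul_pos_iff_of_pos_right (inv_pos.2 h)]
  rw [hNc, hZ', Finset.card_map] at hsig
  set ins : (Fin 2 → ℝ) → Prop := fun x => ∃ p ∈ P, ‖x - p‖ ≤ r p with hins
  have hterm : ∀ x ∈ Z', (if x ∈ N then (1 : ℤ) else -1) =
      (SignType.sign (Jc (uu b) x) : ℤ) - 2 * (if ins x then (SignType.sign (Jc (uu b) x) : ℤ) else 0) := by
    intro x hx
    have h0 := (hZ'm x).2 hx
    have hxN : x ∈ N ↔ 0 < re W' x * Jc (uu b) x := by rw [hN, Finset.mem_filter]; simp [hx]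
    by_cases hi : ins x
    · obtain ⟨p, hpP, hxp⟩ := hi
      have hw : re W' x < 0 := by rw [hre]; linarith [hneg p hpP x hxp h0]
      have hi : ins x := ⟨p, hpP, hxp⟩
      rcases lt_or_gt_of_ne (hJ0 x hx) with hj | hj
      · rw [if_pos (hxN.2 (mul_pos_of_neg_of_neg hw hj)), if_pos hi, sign_neg hj]; norm_num
      · rw [if_neg (fun h => absurd (hxN.1 h) (not_lt.2 (mul_nonpos_of_nonpos_of_nonneg hw.le hj.le))),
          if_pos hi, sign_pos hj]; norm_num
    · have hi' : ∀ p ∈ P, r p < ‖x - p‖ := by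
        intro p hpP; by_contra hc; exact hi ⟨p, hpP, not_lt.1 hc⟩
      have hw : 0 < re W' x := by rw [hre]; linarith [hηp x hx (hpos x h0 hi')]
      rcases lt_or_gt_of_ne (hJ0 x hx) with hj | hj
      · rw [if_neg (fun h => absurd (hxN.1 h) (not_lt.2 (mul_nonpos_of_nonneg_of_nonpos hw.le hj.le))),
          if_neg hi, sign_neg hj]; norm_num
      · rw [if_pos (hxN.2 (mul_pos hw hj)), if_neg hi, sign_pos hj]; norm_num
  have hsum := Finset.sum_congr (rfl : Z' = Z') hterm
  rw [Finset.sum_sub_distrib, ← Finset.mul_sum, ← Finset.sum_filter, Finset.sum_ite] at hsum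
  have hall : ∑ x ∈ Z', (SignType.sign (Jc (uu b) x) : ℤ) = 1 := by
    have := BDeg.sum_eq hR (uu_contDiff b) Z' hZ'm hJ0
      (fun x hx h => by rw [sub_zero] at hx; linarith [hin x h]) hBd
    rwa [Finset.filter_true_of_mem] at this
    intro x hx
    rw [sub_zero]; exact (hin x ((hZ'm x).2 hx)).le
  have hinS : ∑ x ∈ Z'.filter ins, (SignType.sign (Jc (uu b) x) : ℤ) = P.card := by
    have : Z'.filter ins = P.biUnion (fun p => Z'.filter (fun x => ‖x - p‖ ≤ r p)) := by
      ext x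
      simp only [Finset.mem_filter, Finset.mem_biUnion, hins]
      tauto
    rw [this, Finset.sum_biUnion]
    · rw [Finset.sum_congr rfl (fun p hpP => BDeg.sum_eq (hr p hpP) (uu_contDiff b) Z' hZ'm hJ0
        (hne p hpP) (hbd p hpP))]
      simp
    · intro p hpP p' hpP' hpp
      rw [Function.onFun, Finset.disjoint_left]
      intro x hx hx'
      exact hdis p hpP p' hpP' hpp x (Finset.mem_filter.1 hx).2 (Finset.mem_filter.1 hx').2
  rw [hall, hinS] at hsum
  have hf1 : Z'.filter (fun x => x ∈ N) = N := by
    ext x; simp [hN]; 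
  have hf2 : (Z'.filter (fun x => x ∈ N)).card + (Z'.filter (fun x => ¬ x ∈ N)).card = Z'.card :=
    Finset.card_filter_add_card_filter_not _
  rw [hf1] at hf2
  rw [hf1] at hsum
  simp only [Finset.sum_const, nsmul_eq_mul, mul_one, mul_neg] at hsum
  zify at hsig hf2 ⊢
  linarith

end Ell

namespace Ell
open Polynomial Set Topology
open scoped Polynomial.Bivariate ComplexConjugate

noncomputable def eul (p : ℂ[X][Y]) : ℂ[X][Y] := C X * dz p + X * derivative p

lemma coeff_eul (p : ℂ[X][Y]) (i j : ℕ) :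
    ((eul p).coeff j).coeff i = ((i + j : ℕ) : ℂ) * (p.coeff j).coeff i := by
  unfold eul
  rw [coeff_add, coeff_add, coeff_C_mul, coeff_dz]
  have h1 : (X * derivative (p.coeff j)).coeff i = (i : ℂ) * (p.coeff j).coeff i := by
    cases i with
    | zero => simp
    | succ i => rw [coeff_X_mul, coeff_derivative]; push_cast; ring
  have h2 : ((X * derivative p).coeff j).coeff i = (j : ℂ) * (p.coeff j).coeff i := by
    cases j with
    | zero => simp
    | succ j =>
      rw [coeff_X_mul, coeff_derivative]
      have : ((j : ℂ[X]) + 1) = C ((j : ℂ) + 1) := by simp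
      rw [this, coeff_mul_C]; push_cast; ring
  rw [h1, h2]; push_cast; ring

lemma eul_cls {d e t : ℕ} {p : ℂ[X][Y]} (hp : Cls d e (t + 1) p) :
    Cls d e t (C (C ((t + 1 : ℕ) : ℂ)) * p - eul p) := by
  intro i j h
  rw [coeff_sub, coeff_sub, coeff_eul, coeff_C_mul, coeff_C_mul, ← sub_mul] at h
  have h1 := right_ne_zero_of_mul h
  have h2 := left_ne_zero_of_mul h
  obtain ⟨ha, hb, hc⟩ := hp i j h1
  refine ⟨ha, hb, ?_⟩
  by_contra hcon
  apply h2
  have : i + j = t + 1 := by omega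
  rw [this, sub_self]

lemma eul_sg (p : ℂ[X][Y]) : sg (eul p) = eul (sg p) := by
  refine bi_ext fun i j => ?_
  rw [coeff_sg, coeff_eul, coeff_eul, coeff_sg, map_mul, add_comm]
  simp

lemma eul_add (p r : ℂ[X][Y]) : eul (p + r) = eul p + eul r := by
  unfold eul; rw [dz_add, derivative_add]; ring

lemma ev_eul {F : ℂ[X][Y]} (hF : sg F = F) (x : Fin 2 → ℝ) :
    re (eul F) x = 2 * (conj (zt x) * ev (derivative F) x).re := by
  unfold re eul
  rw [ev_add, ev_mul, ev_mul, ev_z, ev_w, ev_dz_real hF]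
  simp
  ring

lemma cls_bound {d e t : ℕ} {p : ℂ[X][Y]} (hp : Cls d e t p) :
    ∃ c : ℝ, 0 ≤ c ∧ ∀ x, ‖ev p x‖ ≤ c * (1 + ‖zt x‖) ^ t := by
  refine ⟨∑ j ∈ p.support, ∑ i ∈ (p.coeff j).support, ‖(p.coeff j).coeff i‖,
    Finset.sum_nonneg fun _ _ => Finset.sum_nonneg fun _ _ => norm_nonneg _, fun x => ?_⟩
  have h1 : ev p x = ∑ j ∈ p.support, ∑ i ∈ (p.coeff j).support,
      (p.coeff j).coeff i * zt x ^ i * conj (zt x) ^ j := by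
    unfold ev evalEval
    rw [eval_eq_sum (p := p), sum_def, eval_finsetSum]
    refine Finset.sum_congr rfl fun j _ => ?_
    rw [eval_mul, eval_pow, eval_C, eval_eq_sum, sum_def, Finset.sum_mul]
  rw [h1, Finset.sum_mul]
  refine (norm_sum_le _ _).trans (Finset.sum_le_sum fun j _ => ?_)
  rw [Finset.sum_mul]
  refine (norm_sum_le _ _).trans (Finset.sum_le_sum fun i hi => ?_)
  rw [mul_assoc, norm_mul]
  refine mul_le_mul_of_nonneg_left ?_ (norm_nonneg _)
  rw [norm_mul, norm_pow, norm_pow, Complex.norm_conj, ← pow_add]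
  have hij := hp i j (mem_support_iff.1 hi)
  calc ‖zt x‖ ^ (i + j) ≤ (1 + ‖zt x‖) ^ (i + j) :=
        pow_le_pow_left₀ (norm_nonneg _) (by linarith) _
    _ ≤ _ := pow_le_pow_right₀ (by linarith [norm_nonneg (zt x)]) hij.2.2

/-- squared euclidean norm -/
noncomputable def nn (x : Fin 2 → ℝ) : ℝ := x 0 ^ 2 + x 1 ^ 2

lemma nn_zt (x : Fin 2 → ℝ) : nn x = ‖zt x‖ ^ 2 := by
  rw [← Complex.normSq_eq_norm_sq, Complex.normSq_apply, zt_re, zt_im]; unfold nn; ring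

lemma norm_le_zt (x : Fin 2 → ℝ) : ‖x‖ ≤ ‖zt x‖ := by
  have := norm_sq_le x
  have h2 := nn_zt x
  unfold nn at h2
  rw [h2] at this
  exact (pow_le_pow_iff_left₀ (norm_nonneg _) (norm_nonneg _) two_ne_zero).1 this

noncomputable def EE (n : ℕ) : ℂ[X][Y] := (1 + C X * X) ^ n

lemma EE_cls (n : ℕ) : Cls n n (2 * n) (EE n) := by
  have h : Cls 1 1 2 (1 + C X * X : ℂ[X][Y]) := (Cls.one _ _ _).add (Cls.z.mul Cls.w)
  have := h.pow n
  exact this.mono (by omega) (by omega) (by omega)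

lemma EE_sg (n : ℕ) : sg (EE n) = EE n := by
  unfold EE
  rw [map_pow, map_add, map_one, map_mul, sg_z, sg_w, mul_comm]

lemma ev_EE (n : ℕ) (x : Fin 2 → ℝ) : ev (EE n) x = (((1 + nn x) ^ n : ℝ) : ℂ) := by
  unfold EE
  rw [ev_pow, ev_add, ev_one, ev_mul, ev_z, ev_w, Complex.mul_conj, nn_zt, Complex.normSq_eq_norm_sq]
  push_cast; rfl

lemma re_EE (n : ℕ) (x : Fin 2 → ℝ) : re (EE n) x = (1 + nn x) ^ n := by
  rw [re, ev_EE, Complex.ofReal_re]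

lemma ev_dEE (n : ℕ) (x : Fin 2 → ℝ) :
    (conj (zt x) * ev (derivative (EE (n + 1))) x).re = (n + 1) * (1 + nn x) ^ n * nn x := by
  have h : derivative (EE (n + 1)) = C (C ((n + 1 : ℕ) : ℂ)) * EE n * C X := by
    unfold EE
    rw [derivative_pow]
    simp
  rw [h, ev_mul, ev_mul, ev_CC, ev_EE, ev_z]
  have : conj (zt x) * (((n + 1 : ℕ) : ℂ) * (((1 + nn x) ^ n : ℝ) : ℂ) * zt x)
      = (((n + 1) * (1 + nn x) ^ n * nn x : ℝ) : ℂ) := by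
    have h2 : conj (zt x) * zt x = ((nn x : ℝ) : ℂ) := by
      rw [mul_comm, Complex.mul_conj, nn_zt, Complex.normSq_eq_norm_sq]
    push_cast at h2 ⊢
    linear_combination ((n : ℂ) + 1) * (1 + (nn x : ℂ)) ^ n * h2
  rw [this, Complex.ofReal_re]

lemma nn_nonneg (x : Fin 2 → ℝ) : 0 ≤ nn x := by unfold nn; positivity

theorem big_ball {q : ℕ} {F b' : ℂ[X][Y]} (hFc : Cls (q + 3) (q + 3) (2 * q + 4) F) (hF : sg F = F)
    (hpos : ∀ x, 0 ≤ re F x) (hb' : Cls (q + 3) (q + 2) (2 * q + 3) b') {ε : ℝ} (hε : 0 < ε) :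
    ∃ R1 s₀ : ℝ, 0 < R1 ∧ 0 < s₀ ∧ ∀ s : ℝ, 0 ≤ s → s ≤ s₀ → ∀ x, R1 ≤ ‖x‖ →
      0 < (conj (zt x) * ev (lin (derivative (F + C (C (ε : ℂ)) * EE (q + 2)))
        (b' - derivative (F + C (C (ε : ℂ)) * EE (q + 2))) s) x).re := by
  set b₁ := derivative (F + C (C (ε : ℂ)) * EE (q + 2)) with hb₁
  have hb₁e : b₁ = derivative F + C (C (ε : ℂ)) * derivative (EE (q + 2)) := by
    rw [hb₁, derivative_add, derivative_C_mul]
  have hEc : Cls (q + 3) (q + 3) (2 * q + 4) (EE (q + 2)) :=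
    (EE_cls (q + 2)).mono (by omega) (by omega) (by omega)
  have hb₁c : Cls (q + 3) (q + 2) (2 * q + 3) b₁ := (hFc.add (hEc.smul _)).dw
  obtain ⟨cH, hcH, hH⟩ := cls_bound (eul_cls hFc)
  obtain ⟨cD, hcD, hD⟩ := cls_bound (hb'.sub hb₁c)
  set L : ℝ := 2 ^ (2 * q + 3) with hL
  have hLpos : 0 < L := by positivity
  refine ⟨1 + cH * L / ε, ε / (2 * (cD * L + 1)), by positivity, by positivity, ?_⟩
  intro s hs0 hs x hx
  set ρ := ‖zt x‖ with hρ
  have hxρ : 1 + cH * L / ε ≤ ρ := hx.trans (norm_le_zt x)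
  have hρ1 : 1 ≤ ρ := by
    have : 0 ≤ cH * L / ε := by positivity
    linarith
  have hρL : cH * L < ε * ρ := by
    have : cH * L / ε < ρ := by linarith
    rw [div_lt_iff₀ hε] at this; linarith
  have hpw : (1 + ρ) ^ (2 * q + 3) ≤ L * ρ ^ (2 * q + 3) := by
    rw [hL, ← mul_pow]; exact pow_le_pow_left₀ (by linarith) (by linarith) _
  set y := ρ ^ (2 * q + 3) with hy
  have hypos : 0 < y := by positivity
  have hsD : s * (cD * L) ≤ ε / 2 := by
    rw [le_div_iff₀ (by positivity)] at hs
    nlinarith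
  -- first term
  have t1 : - (cH * L * y) ≤ 2 * (conj (zt x) * ev (derivative F) x).re := by
    rw [← ev_eul hF]
    have e1 : re (eul F) x = ((2 * q + 3 + 1 : ℕ) : ℝ) * re F x
        - re (C (C ((2 * q + 3 + 1 : ℕ) : ℂ)) * F - eul F) x := by
      unfold re
      rw [ev_sub, ev_mul, ev_CC, Complex.sub_re, ← Complex.ofReal_natCast, Complex.re_ofReal_mul]; ring
    have e2 : re (C (C ((2 * q + 3 + 1 : ℕ) : ℂ)) * F - eul F) x ≤ cH * L * y := by
      calc _ ≤ ‖ev (C (C ((2 * q + 3 + 1 : ℕ) : ℂ)) * F - eul F) x‖ := Complex.re_le_norm _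
        _ ≤ cH * (1 + ρ) ^ (2 * q + 3) := hH x
        _ ≤ cH * (L * y) := mul_le_mul_of_nonneg_left hpw hcH
        _ = _ := by ring
    have e3 : 0 ≤ ((2 * q + 3 + 1 : ℕ) : ℝ) * re F x := mul_nonneg (Nat.cast_nonneg _) (hpos x)
    linarith
  have t2 : ρ * y ≤ (conj (zt x) * ev (derivative (EE (q + 2))) x).re := by
    rw [ev_dEE (q + 1), nn_zt, ← hρ]
    have h1 : ρ ^ (2 * (q + 1)) ≤ (1 + ρ ^ 2) ^ (q + 1) := by
      rw [pow_mul]; exact pow_le_pow_left₀ (by positivity) (by linarith) _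
    have h2 : ρ * y = ρ ^ (2 * (q + 1)) * ρ ^ 2 := by rw [hy]; ring
    rw [h2]
    refine mul_le_mul_of_nonneg_right ?_ (by positivity)
    have h3 : (0 : ℝ) ≤ (1 + ρ ^ 2) ^ (q + 1) := by positivity
    have h4 : (1 : ℝ) ≤ ((q + 1 : ℕ) : ℝ) + 1 := by push_cast; linarith [Nat.cast_nonneg (α := ℝ) q]
    nlinarith
  have t3 : - (ρ * (cD * (L * y))) ≤ (conj (zt x) * ev (b' - b₁) x).re := by
    have h1 : ‖conj (zt x) * ev (b' - b₁) x‖ ≤ ρ * (cD * (L * y)) := by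
      rw [norm_mul, Complex.norm_conj]
      refine mul_le_mul_of_nonneg_left ?_ (norm_nonneg _)
      exact (hD x).trans (mul_le_mul_of_nonneg_left hpw hcD)
    have := (abs_le.1 ((Complex.abs_re_le_norm _).trans h1)).1
    exact this
  have heq : (conj (zt x) * ev (lin b₁ (b' - b₁) s) x).re =
      (conj (zt x) * ev (derivative F) x).re + ε * (conj (zt x) * ev (derivative (EE (q + 2))) x).re
        + s * (conj (zt x) * ev (b' - b₁) x).re := by
    unfold lin
    rw [ev_add, ev_mul, ev_CC]
    conv_lhs => rw [hb₁e]
    rw [ev_add, ev_mul, ev_CC, ← Complex.re_ofReal_mul, ← Complex.re_ofReal_mul, ← Complex.add_re,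
      ← Complex.add_re, hb₁e]
    congr 1; ring
  rw [heq]
  have u2 := mul_le_mul_of_nonneg_left t2 hε.le
  have u3 := mul_le_mul_of_nonneg_left t3 hs0
  have u4 : s * (cD * L) * (ρ * y) ≤ ε / 2 * (ρ * y) := mul_le_mul_of_nonneg_right hsD (by positivity)
  have u5 : cH * L * y < ε * ρ * y := mul_lt_mul_of_pos_right hρL hypos
  nlinarith

end Ell

namespace Ell
open Polynomial Set Topology
open scoped Polynomial.Bivariate ComplexConjugate

lemma exists_boxes {F : ℂ[X][Y]} (hF : sg F = F) (P : Finset (Fin 2 → ℝ))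
    (hP : ∀ x, re F x = 0 ↔ x ∈ P) (hpos : ∀ x, 0 ≤ re F x) :
    ∃ r : (Fin 2 → ℝ) → ℝ, (∀ p ∈ P, 0 < r p ∧ BDeg p (r p) (uu (derivative F)) 1 ∧
      ∀ x, ‖x - p‖ ≤ r p → x ≠ p → uu (derivative F) x ≠ 0) ∧
      (∀ p ∈ P, ∀ p' ∈ P, p ≠ p' → ∀ x, ‖x - p‖ ≤ r p → ‖x - p'‖ ≤ r p' → False) := by
  classical
  have hsep : ∃ ρ > 0, ∀ p ∈ P, ∀ p' ∈ P, p ≠ p' → ρ ≤ ‖p - p'‖ := by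
    by_cases hne : P.offDiag.Nonempty
    · obtain ⟨c, hc, hmin⟩ := P.offDiag.exists_min_image (fun c => ‖c.1 - c.2‖) hne
      refine ⟨‖c.1 - c.2‖, norm_pos_iff.2 (sub_ne_zero.2 (Finset.mem_offDiag.1 hc).2.2), ?_⟩
      intro p hp p' hp' hpp
      exact hmin (p, p') (Finset.mem_offDiag.2 ⟨hp, hp', hpp⟩)
    · refine ⟨1, one_pos, fun p hp p' hp' hpp => absurd ⟨(p, p'), Finset.mem_offDiag.2 ⟨hp, hp', hpp⟩⟩ hne⟩
  obtain ⟨ρ, hρ, hρP⟩ := hsep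
  have h := fun p : P => local_min hF P hP hpos p.2 (half_pos hρ)
  choose r hr using h
  refine ⟨fun p => if hp : p ∈ P then r ⟨p, hp⟩ else 0, ?_, ?_⟩
  · intro p hp
    simp only [dif_pos hp]
    obtain ⟨h1, h2, h3, h4⟩ := hr ⟨p, hp⟩
    exact ⟨h1, h3, fun x hx hxp => (h4 x hx hxp).1⟩
  · intro p hp p' hp' hpp x hx hx'
    simp only [dif_pos hp, dif_pos hp'] at hx hx'
    have h1 := (hr ⟨p, hp⟩).2.1
    have h2 := (hr ⟨p', hp'⟩).2.1
    have h3 := hρP p hp p' hp' hpp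
    have h4 : ‖p - p'‖ ≤ ‖x - p‖ + ‖x - p'‖ := by
      have : p - p' = (x - p') - (x - p) := by abel
      rw [this, add_comm]; exact norm_sub_le _ _
    linarith

lemma re_CC_mul (c : ℝ) (p : ℂ[X][Y]) (x : Fin 2 → ℝ) : re (C (C (c : ℂ)) * p) x = c * re p x := by
  unfold re; rw [ev_mul, ev_CC, Complex.re_ofReal_mul]

lemma re_add (p r : ℂ[X][Y]) (x : Fin 2 → ℝ) : re (p + r) x = re p x + re r x := by
  unfold re; rw [ev_add, Complex.add_re]

lemma re_sub (p r : ℂ[X][Y]) (x : Fin 2 → ℝ) : re (p - r) x = re p x - re r x := by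
  unfold re; rw [ev_sub, Complex.sub_re]

lemma compact_bound {S : Set (Fin 2 → ℝ)} (hS : IsCompact S) {f : (Fin 2 → ℝ) → ℝ} (hf : Continuous f) :
    ∃ M > 0, ∀ x ∈ S, f x ≤ M := by
  obtain ⟨M, hM⟩ := (hS.bddAbove_image hf.continuousOn)
  exact ⟨max M 1, by positivity, fun x hx => (hM (mem_image_of_mem f hx)).trans (le_max_left _ _)⟩

lemma sg_CC_real (c : ℝ) : sg (C (C (c : ℂ))) = C (C (c : ℂ)) := by rw [sg_CC]; simp

lemma nn_continuous : Continuous nn := by unfold nn; fun_prop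

lemma le_nn (x : Fin 2 → ℝ) : ‖x‖ ^ 2 ≤ nn x := norm_sq_le x

/-- good small parameters exist -/
lemma exists_small (T : ℂ[X]) (hT : T ≠ 0) {s₀ : ℝ} (hs : 0 < s₀) :
    ∃ s : ℝ, 0 < s ∧ s < s₀ ∧ T.eval (s : ℂ) ≠ 0 := by
  by_contra hcon
  push Not at hcon
  apply hT
  refine eq_zero_of_infinite_isRoot T ?_
  refine Set.Infinite.mono (s := (fun s : ℝ => (s : ℂ)) '' Ioo 0 s₀) ?_ ?_
  · rintro _ ⟨s, hs, rfl⟩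
    exact hcon s hs.1 hs.2
  · exact (Ioo_infinite hs).image Complex.ofReal_injective.injOn

set_option maxHeartbeats 2000000 in
theorem core {q d : ℕ} (hqd : q = 2 * d) {F : ℂ[X][Y]} (hFc : Cls (q + 3) (q + 3) (2 * q + 4) F)
    (hF : sg F = F) (P : Finset (Fin 2 → ℝ)) (hP : ∀ x, re F x = 0 ↔ x ∈ P)
    (hpos : ∀ x, 0 ≤ re F x) : 2 * (d + 1) ^ 2 + 2 * P.card ≤ 1 + mu q := by
  classical
  obtain ⟨b', hb'p, hb'g⟩ := exists_real_good q
  obtain ⟨r, hr, hdis⟩ := exists_boxes hF P hP hpos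
  have hfc : Continuous (re F) := (re_contDiff F (n := 0)).continuous
  -- union of the boxes
  set Bx : Set (Fin 2 → ℝ) := ⋃ p ∈ P, Metric.closedBall p (r p) with hBx
  have hBxc : IsCompact Bx := P.isCompact_biUnion fun p _ => isCompact_closedBall _ _
  have hmB : ∀ {x}, x ∈ Bx ↔ ∃ p ∈ P, ‖x - p‖ ≤ r p := by
    intro x; simp [hBx, dist_eq_norm]
  obtain ⟨B, hB0, hB⟩ := compact_bound hBxc nn_continuous
  set A : ℝ := (2 * (1 + B)) ^ (q + 1) with hA
  have hA1 : 1 ≤ A := one_le_pow₀ (by linarith)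
  set om : (Fin 2 → ℝ) → ℝ := fun x => A - (1 + nn x) ^ (q + 1) with hom
  have hom1 : ∀ x ∈ Bx, 1 ≤ om x := by
    intro x hx
    have h1 : (1 + nn x) ^ (q + 1) ≤ (1 + B) ^ (q + 1) :=
      pow_le_pow_left₀ (by linarith [nn_nonneg x]) (by linarith [hB x hx]) _
    have h2 : A = 2 ^ (q + 1) * (1 + B) ^ (q + 1) := by rw [hA, mul_pow]
    have h3 : (1 : ℝ) ≤ (1 + B) ^ (q + 1) := one_le_pow₀ (by linarith)
    have h4 : (2 : ℝ) ≤ 2 ^ (q + 1) := le_self_pow₀ (by norm_num) (by omega)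
    simp only [hom]
    nlinarith
  have homA : ∀ x, om x ≤ A := fun x => by
    have := nn_nonneg x
    simp only [hom]; linarith [show (0 : ℝ) ≤ (1 + nn x) ^ (q + 1) by positivity]
  have hom0 : ∀ x, 2 * B + 1 ≤ nn x → om x ≤ 0 := by
    intro x hx
    simp only [hom]
    have := pow_le_pow_left₀ (by linarith : (0 : ℝ) ≤ 2 * (1 + B)) (by linarith : 2 * (1 + B) ≤ 1 + nn x) (q + 1)
    linarith
  -- minimum of `f` away from boxes
  set K : Set (Fin 2 → ℝ) := {x | nn x ≤ 2 * B + 1} \ ⋃ p ∈ P, Metric.ball p (r p) with hK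
  have hKc : IsCompact K := by
    refine IsCompact.diff ?_ (isOpen_biUnion fun p _ => Metric.isOpen_ball)
    refine Metric.isCompact_of_isClosed_isBounded (isClosed_le nn_continuous continuous_const) ?_
    refine (Metric.isBounded_closedBall (x := (0 : Fin 2 → ℝ)) (r := 2 * B + 1)).subset ?_
    intro x hx
    rw [mem_closedBall_zero_iff]
    have h1 : nn x ≤ 2 * B + 1 := hx
    have h2 := le_nn x
    by_contra hc
    push Not at hc
    nlinarith
  obtain ⟨δ, hδ, hδK⟩ : ∃ δ > 0, ∀ x ∈ K, δ ≤ re F x := by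
    refine hKc.exists_forall_le' (f := re F) hfc.continuousOn (a := 0) ?_
    intro x hx
    refine lt_of_le_of_ne (hpos x) fun h => ?_
    have hxP := (hP x).1 h.symm
    apply hx.2
    simp only [mem_iUnion]
    exact ⟨x, hxP, Metric.mem_ball_self (hr x hxP).1⟩
  set t : ℝ := δ / A with ht
  have htpos : 0 < t := by positivity
  have houtside : ∀ x, (∀ p ∈ P, r p < ‖x - p‖) → 0 ≤ re F x - t * om x := by
    intro x hx
    by_cases hn : nn x ≤ 2 * B + 1
    · have hxK : x ∈ K := by
        refine ⟨hn, ?_⟩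
        simp only [mem_iUnion, not_exists]
        intro p hp hb
        rw [Metric.mem_ball, dist_eq_norm] at hb
        exact absurd hb (not_lt.2 (hx p hp).le)
      have h1 := hδK x hxK
      have h2 : t * om x ≤ t * A := mul_le_mul_of_nonneg_left (homA x) htpos.le
      have h3 : t * A = δ := by rw [ht]; field_simp
      linarith
    · have h1 := hom0 x (by linarith)
      have := hpos x
      nlinarith
  -- where the gradient is bounded below
  set S : Set (Fin 2 → ℝ) := ⋃ p ∈ P, (Metric.closedBall p (r p) ∩ {x | t / 2 ≤ re F x}) ∪
    Metric.sphere p (r p) with hS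
  have hSc : IsCompact S := by
    refine P.isCompact_biUnion fun p _ => IsCompact.union ?_ (isCompact_sphere _ _)
    exact (isCompact_closedBall _ _).inter_right (isClosed_le continuous_const hfc)
  have hS0 : ∀ x ∈ S, 0 < ‖ev (derivative F) x‖ := by
    intro x hx
    rw [norm_pos_iff, Ne, ← uu_eq_zero]
    simp only [hS, mem_iUnion] at hx
    obtain ⟨p, hp, hx | hx⟩ := hx
    · refine (hr p hp).2.2 x (by simpa [dist_eq_norm] using hx.1) ?_
      rintro rfl
      have h1 : t / 2 ≤ re F x := hx.2
      rw [(hP x).2 hp] at h1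
      linarith
    · rw [mem_sphere_iff_norm] at hx
      refine (hr p hp).2.2 x hx.le ?_
      rintro rfl
      have := (hr x hp).1
      simp at hx
      linarith
  have hcont : ∀ p : ℂ[X][Y], Continuous (ev p) := fun p => (ev_contDiff p (n := 0)).continuous
  obtain ⟨c, hc, hcS⟩ : ∃ c > 0, ∀ x ∈ S, c ≤ ‖ev (derivative F) x‖ :=
    hSc.exists_forall_le' (f := fun x => ‖ev (derivative F) x‖) ((hcont _).norm.continuousOn) (a := 0) hS0
  -- choose ε
  obtain ⟨M1, hM1, hM1S⟩ := compact_bound hSc (hcont (derivative (EE (q + 2)))).norm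
  obtain ⟨M2, hM2, hM2B⟩ := compact_bound hBxc (f := re (EE (q + 2))) (re_contDiff _ (n := 0)).continuous
  set ε : ℝ := min (c / (4 * M1)) (t / (8 * M2)) with hε
  have hεpos : 0 < ε := by positivity
  have hε1 : ε * M1 ≤ c / 4 := by
    have : ε ≤ c / (4 * M1) := min_le_left _ _
    calc ε * M1 ≤ c / (4 * M1) * M1 := mul_le_mul_of_nonneg_right this hM1.le
      _ = c / 4 := by field_simp
  have hε2 : ε * M2 ≤ t / 8 := by
    have : ε ≤ t / (8 * M2) := min_le_right _ _
    calc ε * M2 ≤ t / (8 * M2) * M2 := mul_le_mul_of_nonneg_right this hM2.le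
      _ = t / 8 := by field_simp
  obtain ⟨R1, s₀, hR1, hs₀, hbig⟩ := big_ball hFc hF hpos hb'p.hb hεpos
  set F₁ := F + C (C (ε : ℂ)) * EE (q + 2) with hF₁
  set b₁ := derivative F₁ with hb₁
  have hF₁s : sg F₁ = F₁ := by rw [hF₁, map_add, map_mul, sg_CC_real, EE_sg, hF]
  have hEc : Cls (q + 3) (q + 3) (2 * q + 4) (EE (q + 2)) :=
    (EE_cls (q + 2)).mono (by omega) (by omega) (by omega)
  have hF₁c : Cls (q + 3) (q + 3) (2 * q + 4) F₁ := hFc.add (hEc.smul _)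
  have hsb₁ : sg b₁ = dz F₁ := by rw [hb₁, ← dz_sg, hF₁s]
  have hpair1 : Pair q (sg b₁) b₁ := ⟨by rw [hsb₁]; exact hF₁c.dz, hF₁c.dw⟩
  set D := b' - b₁ with hD
  have hpairD : Pair q (sg D) D := ⟨by rw [hD, map_sub]; exact hb'p.ha.sub hpair1.ha, hb'p.hb.sub hpair1.hb⟩
  obtain ⟨T, hT, hTg⟩ := good_generic hpair1 hpairD 1 (by
    have h1 : lin (sg b₁) (sg D) 1 = sg b' := by unfold lin; rw [hD, map_sub]; simp
    have h2 : lin b₁ D 1 = b' := by unfold lin; rw [hD]; simp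
    rw [h1, h2]; exact hb'g)
  obtain ⟨M3, hM3, hM3S⟩ := compact_bound (hSc.union (isCompact_closedBall (0 : Fin 2 → ℝ) R1))
    (f := fun x => (1 + 2 * ‖zt x‖) * ‖ev D x‖)
    ((continuous_const.add (continuous_const.mul zt.continuous.norm)).mul (hcont D).norm)
  set κ : ℝ := min (min (c / 4) (t / 8)) (ε / 2) with hκ
  have hκpos : 0 < κ := by positivity
  obtain ⟨s, hs0, hsl, hsT⟩ := exists_small T hT (s₀ := min s₀ (κ / M3)) (by positivity)
  have hss₀ : s ≤ s₀ := (hsl.trans_le (min_le_left _ _)).le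
  have hsM : s * M3 ≤ κ := by
    have := (hsl.trans_le (min_le_right _ _)).le
    rwa [le_div_iff₀ hM3] at this
  have hκ1 : κ ≤ c / 4 := (min_le_left _ _).trans (min_le_left _ _)
  have hκ2 : κ ≤ t / 8 := (min_le_left _ _).trans (min_le_right _ _)
  have hκ3 : κ ≤ ε / 2 := min_le_right _ _
  set b := lin b₁ D (s : ℂ) with hb
  have hsgb : sg b = lin (sg b₁) (sg D) (s : ℂ) := by
    rw [hb]; unfold lin; rw [map_add, map_mul, sg_CC_real]
  have hgood : Good q (sg b) b := by rw [hsgb]; exact hTg _ hsT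
  have hpair : Pair q (sg b) b := ⟨by rw [hsgb]; exact hpair1.ha.lin hpairD.ha _, hpair1.hb.lin hpairD.hb _⟩
  have hevb : ∀ x, ev b x = ev b₁ x + s * ev D x := by
    intro x; rw [hb]; unfold lin; rw [ev_add, ev_mul, ev_CC]
  have hevb1 : ∀ x, ev b₁ x = ev (derivative F) x + ε * ev (derivative (EE (q + 2))) x := by
    intro x; rw [hb₁, hF₁, derivative_add, derivative_C_mul, ev_add, ev_mul, ev_CC]
  have hsD : ∀ x ∈ S ∪ Metric.closedBall 0 R1, s * ((1 + 2 * ‖zt x‖) * ‖ev D x‖) ≤ κ := fun x hx =>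
    (mul_le_mul_of_nonneg_left (hM3S x hx) hs0.le).trans hsM
  -- on S
  have hSd : ∀ x ∈ S, ‖ev b x - ev (derivative F) x‖ < ‖ev (derivative F) x‖ := by
    intro x hx
    have h1 := hsD x (Or.inl hx)
    have h2 : ev b x - ev (derivative F) x = ε * ev (derivative (EE (q + 2))) x + s * ev D x := by
      rw [hevb, hevb1]; ring
    rw [h2]
    have h3 : ‖(ε : ℂ) * ev (derivative (EE (q + 2))) x‖ ≤ c / 4 := by
      rw [norm_mul, Complex.norm_real, Real.norm_of_nonneg hεpos.le]
      exact (mul_le_mul_of_nonneg_left (hM1S x hx) hεpos.le).trans hε1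
    have h4 : ‖(s : ℂ) * ev D x‖ ≤ c / 4 := by
      rw [norm_mul, Complex.norm_real, Real.norm_of_nonneg hs0.le]
      have : s * ‖ev D x‖ ≤ s * ((1 + 2 * ‖zt x‖) * ‖ev D x‖) := by
        refine mul_le_mul_of_nonneg_left ?_ hs0.le
        nlinarith [norm_nonneg (zt x), norm_nonneg (ev D x), mul_nonneg (norm_nonneg (zt x)) (norm_nonneg (ev D x))]
      linarith
    have h5 := norm_add_le ((ε : ℂ) * ev (derivative (EE (q + 2))) x) ((s : ℂ) * ev D x)
    have h6 := hcS x hx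
    linarith
  have hSne : ∀ x ∈ S, uu b x ≠ 0 := by
    intro x hx h
    have h1 := hSd x hx
    rw [uu_eq_zero.1 h, zero_sub, norm_neg] at h1
    exact lt_irrefl _ h1
  have hsph : ∀ p ∈ P, ∀ x, ‖x - p‖ = r p → x ∈ S := by
    intro p hp x hx
    simp only [hS, mem_iUnion]
    exact ⟨p, hp, Or.inr (by rw [mem_sphere_iff_norm]; exact hx)⟩
  have hin : ∀ x, uu b x = 0 → ‖x‖ < R1 := by
    intro x hx
    by_contra hc
    have := hbig s hs0.le hss₀ x (not_lt.1 hc)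
    rw [uu_eq_zero.1 hx] at this
    simp at this
  -- value of the Euler field at a zero
  have heul : ∀ x, uu b x = 0 → |re (eul F₁) x| ≤ κ := by
    intro x hx
    have h1 := hsD x (Or.inr (by rw [mem_closedBall_zero_iff]; exact (hin x hx).le))
    have h2 := uu_eq_zero.1 hx
    rw [hevb] at h2
    have h3 : ev b₁ x = - (s * ev D x) := by linear_combination h2
    rw [ev_eul hF₁s, ← hb₁, h3, abs_mul]
    have h4 := Complex.abs_re_le_norm (conj (zt x) * -((s : ℂ) * ev D x))
    rw [norm_mul, Complex.norm_conj, norm_neg, norm_mul, Complex.norm_real, Real.norm_of_nonneg hs0.le] at h4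
    have h5 : 0 ≤ s * ‖ev D x‖ := mul_nonneg hs0.le (norm_nonneg _)
    rw [abs_of_pos (by norm_num : (0 : ℝ) < 2)]
    nlinarith
  -- the test polynomial
  set n₀ : ℝ := ((2 * q + 3 + 1 : ℕ) : ℝ) with hn₀
  have hn₀1 : 1 ≤ n₀ := by rw [hn₀]; push_cast; linarith [Nat.cast_nonneg (α := ℝ) q]
  set W := (C (C ((2 * q + 3 + 1 : ℕ) : ℂ)) * F₁ - eul F₁) - C (C ((n₀ * t : ℝ) : ℂ)) *
    (C (C (A : ℂ)) - EE (q + 1)) with hW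
  have hWc : Cls (q + 3) (q + 3) (2 * q + 3) W := by
    refine (eul_cls hF₁c).sub (Cls.smul ((Cls.CC _ _ _ _).sub ?_) _)
    exact (EE_cls (q + 1)).mono (by omega) (by omega) (by omega)
  have hcast : ((2 * q + 3 + 1 : ℕ) : ℂ) = ((n₀ : ℝ) : ℂ) := by rw [hn₀]; push_cast; rfl
  have hWs : sg W = W := by
    rw [hW, hcast, map_sub, map_sub, map_mul, map_mul, map_sub, sg_CC_real, sg_CC_real, sg_CC_real, EE_sg, hF₁s,
      eul_sg, hF₁s]
  have hWre : ∀ x, re W x = n₀ * (re F x + ε * re (EE (q + 2)) x - t * om x) - re (eul F₁) x := by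
    intro x
    have hA' : re (C (C (A : ℂ))) x = A := by unfold re; rw [ev_CC]; simp
    rw [hW, hcast, re_sub, re_sub, re_CC_mul, re_CC_mul, re_sub, hA', re_EE (q + 1), hF₁, re_add, re_CC_mul]
    simp only [hom]; ring
  have hEge : ∀ x, 1 ≤ re (EE (q + 2)) x := fun x => by
    rw [re_EE]; exact one_le_pow₀ (by linarith [nn_nonneg x])
  refine count_main hqd hpair hgood hWc hWs P r R1 (fun p hp => (hr p hp).1) hR1 hdis ?_ ?_ hin
    (fun p hp x hx => hSne x (hsph p hp x hx)) ?_ ?_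
  · intro p hp
    refine (BDeg.line (hr p hp).1.le (uu_contDiff (derivative F)) (uu_contDiff b) ?_ 1).1 (hr p hp).2.1
    intro τ hτ x hx h0
    have h1 := hSd x (hsph p hp x hx)
    have h2 : (1 - τ : ℝ) * ev (derivative F) x + τ * ev b x = 0 := by
      apply Complex.ext
      · simpa [uu] using congrFun h0 0
      · simpa [uu] using congrFun h0 1
    have h3 : ev (derivative F) x = - (τ * (ev b x - ev (derivative F) x)) := by
      push_cast at h2
      linear_combination h2
    have h4 : ‖ev (derivative F) x‖ ≤ ‖ev b x - ev (derivative F) x‖ := by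
      conv_lhs => rw [h3]
      rw [norm_neg, norm_mul, Complex.norm_real, Real.norm_of_nonneg hτ.1]
      nlinarith [hτ.2, norm_nonneg (ev b x - ev (derivative F) x)]
    linarith
  · refine (BDeg.line hR1.le (uu_contDiff b) (v := fun x => x - 0) (by fun_prop) ?_ 1).2 (BDeg.id hR1)
    intro τ hτ x hx h0
    rw [sub_zero] at hx
    have h1 := hbig s hs0.le hss₀ x hx.ge
    have h2 : (1 - τ : ℝ) * ev b x + τ * zt x = 0 := by
      apply Complex.ext
      · simpa [uu, zt_re] using congrFun h0 0
      · simpa [uu, zt_im] using congrFun h0 1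
    have h3 := congrArg (fun y => (conj (zt x) * y).re) h2
    have h4 : (conj (zt x) * ((1 - τ : ℝ) * ev b x + τ * zt x)).re
        = (1 - τ) * (conj (zt x) * ev b x).re + τ * nn x := by
      have h5 : conj (zt x) * zt x = ((nn x : ℝ) : ℂ) := by
        rw [mul_comm, Complex.mul_conj, nn_zt, Complex.normSq_eq_norm_sq]
      have : conj (zt x) * ((1 - τ : ℝ) * ev b x + τ * zt x) =
        ((1 - τ : ℝ) : ℂ) * (conj (zt x) * ev b x) + (τ : ℂ) * ((nn x : ℝ) : ℂ) := by rw [← h5]; ring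
      rw [this, Complex.add_re, Complex.re_ofReal_mul, Complex.re_ofReal_mul, Complex.ofReal_re]
    simp only [mul_zero, Complex.zero_re] at h3
    rw [h4] at h3
    have hnx : 0 < nn x := lt_of_lt_of_le (by rw [hx]; positivity) (le_nn x)
    rcases eq_or_lt_of_le hτ.1 with h | h
    · rw [← h] at h3
      simp only [sub_zero, one_mul, zero_mul, add_zero] at h3
      have h1' : 0 < (conj (zt x) * ev b x).re := h1
      rw [h3] at h1'
      exact lt_irrefl _ h1'
    · have h7 := mul_pos h hnx
      have h8 : 0 ≤ (1 - τ) * (conj (zt x) * ev b x).re :=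
        mul_nonneg (sub_nonneg.2 hτ.2) (le_of_lt h1)
      exact absurd h3 (ne_of_gt (add_pos_of_nonneg_of_pos h8 h7))
  · intro p hp x hx hx0
    have hxB : x ∈ Bx := hmB.2 ⟨p, hp, hx⟩
    have h1 : re F x < t / 2 := by
      by_contra hc
      refine hSne x ?_ hx0
      simp only [hS, mem_iUnion]
      exact ⟨p, hp, Or.inl ⟨by rwa [Metric.mem_closedBall, dist_eq_norm], not_lt.1 hc⟩⟩
    have h2 := mul_le_mul_of_nonneg_left (hM2B x hxB) hεpos.le
    have h3 := mul_le_mul_of_nonneg_left (hom1 x hxB) htpos.le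
    have h4 := (abs_le.1 (heul x hx0)).1
    rw [hWre]
    have h5 : re F x + ε * re (EE (q + 2)) x - t * om x ≤ - (t / 4) := by linarith only [h1, h2, h3, hε2, htpos]
    have h6 := mul_le_mul_of_nonneg_left h5 (zero_le_one.trans hn₀1)
    have h7 : t / 4 ≤ n₀ * (t / 4) := le_mul_of_one_le_left (by positivity) hn₀1
    linarith only [h4, h6, h7, hκ2, htpos]
  · intro x hx0 hx
    have h1 := houtside x hx
    have h2 := mul_le_mul_of_nonneg_left (hEge x) hεpos.le
    have h4 := (abs_le.1 (heul x hx0)).2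
    rw [hWre]
    have h5 : ε ≤ re F x + ε * re (EE (q + 2)) x - t * om x := by linarith only [h1, h2]
    have h6 := mul_le_mul_of_nonneg_left h5 (zero_le_one.trans hn₀1)
    have h7 : ε ≤ n₀ * ε := le_mul_of_one_le_left hεpos.le hn₀1
    linarith only [h4, h6, h7, hκ3, hεpos]

end Ell

namespace Ell
open Polynomial Set Topology
open scoped Polynomial.Bivariate ComplexConjugate

lemma ev_sum (p : ℂ[X][Y]) (x : Fin 2 → ℝ) : ev p x = ∑ j ∈ p.support, ∑ i ∈ (p.coeff j).support,
      (p.coeff j).coeff i * zt x ^ i * conj (zt x) ^ j := by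
  unfold ev evalEval
  rw [eval_eq_sum (p := p), sum_def, eval_finsetSum]
  refine Finset.sum_congr rfl fun j _ => ?_
  rw [eval_mul, eval_pow, eval_C, eval_eq_sum, sum_def, Finset.sum_mul]

/-- part of degree `t` of `p`, as a function -/
noncomputable def topF (t : ℕ) (p : ℂ[X][Y]) (x : Fin 2 → ℝ) : ℂ :=
  ∑ j ∈ p.support, ∑ i ∈ (p.coeff j).support,
    if i + j = t then (p.coeff j).coeff i * zt x ^ i * conj (zt x) ^ j else 0

lemma topF_tendsto {d e t : ℕ} {p : ℂ[X][Y]} (hp : Cls d e t p) (x : Fin 2 → ℝ) :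
    Filter.Tendsto (fun r : ℝ => ev p (r • x) / (r : ℂ) ^ t) Filter.atTop (𝓝 (topF t p x)) := by
  unfold topF
  simp only [ev_sum, Finset.sum_div]
  refine tendsto_finsetSum _ fun j _ => tendsto_finsetSum _ fun i hi => ?_
  have hij := (hp i j (mem_support_iff.1 hi)).2.2
  obtain ⟨s, hs⟩ := Nat.exists_eq_add_of_le hij
  have h1 : ∀ r : ℝ, 0 < r → (p.coeff j).coeff i * zt (r • x) ^ i * conj (zt (r • x)) ^ j / (r : ℂ) ^ t
      = (p.coeff j).coeff i * zt x ^ i * conj (zt x) ^ j * (((r⁻¹) ^ s : ℝ) : ℂ) := by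
    intro r hr
    have hr' : (r : ℂ) ≠ 0 := by exact_mod_cast hr.ne'
    have : zt (r • x) = (r : ℂ) * zt x := by rw [map_smul]; simp
    rw [this, map_mul, Complex.conj_ofReal, hs]
    have hrs : (r : ℂ) ^ s * ((r : ℂ)⁻¹) ^ s = 1 := by rw [← mul_pow, mul_inv_cancel₀ hr', one_pow]
    push_cast
    rw [div_eq_iff (pow_ne_zero _ hr')]
    linear_combination (-(p.coeff j).coeff i * (r : ℂ) ^ i * (r : ℂ) ^ j * zt x ^ i * conj (zt x) ^ j) * hrs
  have h2 : Filter.Tendsto (fun r : ℝ => (((r⁻¹) ^ s : ℝ) : ℂ)) Filter.atTop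
      (𝓝 (((0 : ℝ) ^ s : ℝ) : ℂ)) :=
    (Complex.continuous_ofReal.tendsto _).comp (tendsto_inv_atTop_zero.pow s)
  have h3 := h2.const_mul ((p.coeff j).coeff i * zt x ^ i * conj (zt x) ^ j)
  have h4 : (p.coeff j).coeff i * zt x ^ i * conj (zt x) ^ j * (((0 : ℝ) ^ s : ℝ) : ℂ)
      = if i + j = t then (p.coeff j).coeff i * zt x ^ i * conj (zt x) ^ j else 0 := by
    split_ifs with h
    · have : s = 0 := by omega
      simp [this]
    · have : s ≠ 0 := by omega
      simp [this]
  rw [← h4]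
  refine h3.congr' ?_
  filter_upwards [Filter.eventually_gt_atTop 0] with r hr
  exact (h1 r hr).symm

lemma topF_neg {t : ℕ} (ht : Odd t) (p : ℂ[X][Y]) (x : Fin 2 → ℝ) : topF t p (-x) = - topF t p x := by
  unfold topF
  rw [← Finset.sum_neg_distrib]
  refine Finset.sum_congr rfl fun j _ => ?_
  rw [← Finset.sum_neg_distrib]
  refine Finset.sum_congr rfl fun i _ => ?_
  split_ifs with h
  · rw [map_neg, map_neg, neg_pow, neg_pow (conj (zt x))]
    have : (-1 : ℂ) ^ i * (-1) ^ j = -1 := by rw [← pow_add, h, ht.neg_one_pow]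
    linear_combination ((p.coeff j).coeff i * zt x ^ i * conj (zt x) ^ j) * this
  · simp

lemma cls_drop {d e t : ℕ} {p : ℂ[X][Y]} (hp : Cls d e (t + 1) p) (h : ∀ x, topF (t + 1) p x = 0) :
    Cls d e t p := by
  set U : ℂ[X] := ∑ j ∈ p.support, ∑ i ∈ (p.coeff j).support,
    if i + j = t + 1 then monomial (2 * i) ((p.coeff j).coeff i) else 0 with hU
  have hroot : ∀ x, ‖zt x‖ = 1 → U.IsRoot (zt x) := by
    intro x hx
    have h1 : zt x * conj (zt x) = 1 := by
      rw [Complex.mul_conj, Complex.normSq_eq_norm_sq, hx]; simp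
    have h2 := h x
    rw [IsRoot.def]
    have h3 : U.eval (zt x) = zt x ^ (t + 1) * topF (t + 1) p x := by
      rw [hU, topF, eval_finsetSum, Finset.mul_sum]
      refine Finset.sum_congr rfl fun j _ => ?_
      rw [eval_finsetSum, Finset.mul_sum]
      refine Finset.sum_congr rfl fun i _ => ?_
      split_ifs with hij
      · rw [eval_monomial, ← hij]
        have : (zt x * conj (zt x)) ^ j = 1 := by rw [h1, one_pow]
        rw [mul_pow] at this
        linear_combination (-(p.coeff j).coeff i * zt x ^ (2 * i)) * this
      · simp
    rw [h3, h2, mul_zero]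
  have hU0 : U = 0 := by
    apply eq_zero_of_infinite_isRoot
    have hinf : (Set.range fun θ : ℝ => (⟨Real.cos θ, Real.sin θ⟩ : ℂ)).Infinite := by
      have : ((fun θ : ℝ => (⟨Real.cos θ, Real.sin θ⟩ : ℂ)) '' Icc 0 Real.pi).Infinite := by
        refine Set.Infinite.image ?_ (Icc_infinite Real.pi_pos)
        intro a ha b hb hab
        exact Real.injOn_cos ha hb (Complex.ext_iff.1 hab).1
      exact this.mono (image_subset_range _ _)
    refine hinf.mono ?_
    rintro _ ⟨θ, rfl⟩
    have h1 := zt_surj ⟨Real.cos θ, Real.sin θ⟩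
    have h2 := hroot ![Real.cos θ, Real.sin θ] (by
      have h3 := nn_zt ![Real.cos θ, Real.sin θ]
      have h4 : nn ![Real.cos θ, Real.sin θ] = 1 := by simp [nn]
      rw [h4] at h3
      exact (pow_eq_one_iff_of_nonneg (norm_nonneg _) two_ne_zero).1 h3.symm)
    simp only at h1
    rw [h1] at h2
    exact h2
  intro i j hij
  obtain ⟨h1, h2, h3⟩ := hp i j hij
  refine ⟨h1, h2, ?_⟩
  by_contra hcon
  have hs : i + j = t + 1 := by omega
  apply hij
  have h4 : U.coeff (2 * i) = (p.coeff j).coeff i := by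
    rw [hU, finsetSum_coeff, Finset.sum_eq_single j]
    · rw [finsetSum_coeff, Finset.sum_eq_single i]
      · rw [if_pos hs, coeff_monomial, if_pos rfl]
      · intro i' _ hi'
        split_ifs with h
        · omega
        · simp
      · intro h; rw [if_pos hs, coeff_monomial, if_pos rfl]; simpa using h
    · intro j' _ hj'
      rw [finsetSum_coeff]
      refine Finset.sum_eq_zero fun i' _ => ?_
      split_ifs with h
      · rw [coeff_monomial, if_neg (by omega)]
      · simp
    · intro h
      rw [finsetSum_coeff]
      refine Finset.sum_eq_zero fun i' _ => ?_
      split_ifs with h'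
      · have : p.coeff j = 0 := by simpa using h
        exact absurd (by rw [this, coeff_zero]) hij
      · simp
  rw [← h4, hU0, coeff_zero]

lemma cls_drop_nonneg {d e t : ℕ} {p : ℂ[X][Y]} (ht : Odd (t + 1)) (hp : Cls d e (t + 1) p) (hs : sg p = p)
    (hpos : ∀ x, 0 ≤ re p x) : Cls d e t p := by
  refine cls_drop hp fun x => ?_
  have key : ∀ x, 0 ≤ (topF (t + 1) p x).re ∧ (topF (t + 1) p x).im = 0 := by
    intro x
    have h1 := topF_tendsto hp x
    have h2 : (fun r : ℝ => ev p (r • x) / (r : ℂ) ^ (t + 1)) =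
        fun r : ℝ => ((re p (r • x) / r ^ (t + 1) : ℝ) : ℂ) := by
      funext r; rw [ev_real hs]; push_cast; rfl
    rw [h2] at h1
    constructor
    · have h3 := (Complex.continuous_re.tendsto _).comp h1
      refine ge_of_tendsto h3 ?_
      filter_upwards [Filter.eventually_gt_atTop 0] with r hr
      have := hpos (r • x)
      simp only [Function.comp, Complex.ofReal_re]
      positivity
    · have h3 := (Complex.continuous_im.tendsto _).comp h1
      refine tendsto_nhds_unique h3 ?_
      simp only [Function.comp_def, Complex.ofReal_im]
      exact tendsto_const_nhds
  have h1 := key x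
  have h2 := key (-x)
  rw [topF_neg ht] at h2
  apply Complex.ext
  · have := h2.1; rw [Complex.neg_re] at this; simp only [Complex.zero_re]; linarith [h1.1]
  · exact h1.2

/-- constant sign -/
lemma const_sign {f : (Fin 2 → ℝ) → ℝ} (hf : Continuous f) (hfin : {x | f x = 0}.Finite) :
    (∀ x, 0 ≤ f x) ∨ (∀ x, f x ≤ 0) := by
  have hr : 1 < Module.rank ℝ (Fin 2 → ℝ) := by
    rw [rank_fin_fun]; norm_num
  have hc := (hfin.countable.isPathConnected_compl_of_one_lt_rank hr).isConnected.isPreconnected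
  by_contra hcon
  push Not at hcon
  obtain ⟨⟨x, hx⟩, ⟨y, hy⟩⟩ := hcon
  have := hc.intermediate_value (a := x) (b := y) (by simpa using hx.ne) (by simpa using hy.ne')
    hf.continuousOn
  obtain ⟨c, hc1, hc2⟩ := this ⟨hx.le, hy.le⟩
  exact hc1 hc2

end Ell

namespace Ell
open Polynomial Set Topology
open scoped Polynomial.Bivariate ComplexConjugate

/-- Data of a stereographic parametrisation. -/
noncomputable def stp (a b g h : ℝ) : ℂ[X][Y] :=
  C (C (a : ℂ)) * (C X + X) + C (C (b : ℂ)) * (C (C Complex.I) * (X - C X)) +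
    C (C (g : ℂ)) * (C X * X) + C (C (h : ℂ))

lemma stp_cls (a b g h : ℝ) : Cls 1 1 2 (stp a b g h) := by
  have hz : Cls 1 1 2 (C X : ℂ[X][Y]) := Cls.z.mono (by omega) (by omega) (by omega)
  have hw : Cls 1 1 2 (X : ℂ[X][Y]) := Cls.w.mono (by omega) (by omega) (by omega)
  exact ((((hz.add hw).smul _).add (((hw.sub hz).smul _).smul _)).add ((Cls.z.mul Cls.w).smul _)).add
    (Cls.CC _ _ _ _)

lemma stp_sg (a b g h : ℝ) : sg (stp a b g h) = stp a b g h := by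
  unfold stp
  simp only [map_add, map_mul, map_sub, sg_CC, Complex.conj_ofReal, sg_z, sg_w, Complex.conj_I, map_neg]
  ring

lemma stp_ev (a b g h : ℝ) (x : Fin 2 → ℝ) :
    ev (stp a b g h) x = ((2 * a * x 0 + 2 * b * x 1 + g * nn x + h : ℝ) : ℂ) := by
  unfold stp
  simp only [ev_add, ev_mul, ev_sub, ev_CC, ev_z, ev_w]
  rw [zt_apply]
  unfold nn
  apply Complex.ext
  · simp [pow_two]; ring
  · simp [pow_two]; right; ring

section F
variable (a b g h : Fin 4 → ℝ)

noncomputable def CCr : ℝ →+* ℂ[X][Y] := (C : ℂ[X] →+* ℂ[X][Y]).comp ((C : ℂ →+* ℂ[X]).comp Complex.ofRealHom)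

noncomputable def pull (G : MvPolynomial (Fin 4) ℝ) : ℂ[X][Y] :=
  MvPolynomial.eval₂ CCr (fun i => stp (a i) (b i) (g i) (h i)) G

noncomputable def pt (x : Fin 2 → ℝ) (i : Fin 4) : ℝ := 2 * a i * x 0 + 2 * b i * x 1 + g i * nn x + h i

lemma pull_cls {G : MvPolynomial (Fin 4) ℝ} {m : ℕ} (hG : G.IsHomogeneous m) :
    Cls m m (2 * m) (pull a b g h G) := by
  unfold pull
  rw [MvPolynomial.eval₂_eq']
  refine Cls.sum _ _ fun s hs => ?_
  refine Cls.smul ?_ _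
  have hdeg := hG (MvPolynomial.mem_support_iff.1 hs)
  have hd : ∑ i, s i = m := by
    rw [← hdeg, Finsupp.weight_apply, Finsupp.sum_fintype] <;> simp
  have := Cls.prod Finset.univ (fun i => stp (a i) (b i) (g i) (h i) ^ s i) (fun i => s i * 1) (fun i => s i * 1)
    (fun i => s i * 2) (fun i _ => by simpa using (stp_cls (a i) (b i) (g i) (h i)).pow (s i))
  refine this.mono ?_ ?_ ?_
  · simp [hd]
  · simp [hd]
  · rw [← Finset.sum_mul, hd]; omega

lemma pull_sg (G : MvPolynomial (Fin 4) ℝ) : sg (pull a b g h G) = pull a b g h G := by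
  unfold pull
  induction G using MvPolynomial.induction_on with
  | C r => simp only [MvPolynomial.eval₂_C]; exact sg_CC_real r
  | add p q hp hq => rw [MvPolynomial.eval₂_add, map_add, hp, hq]
  | mul_X p i hp => rw [MvPolynomial.eval₂_mul, MvPolynomial.eval₂_X, map_mul, hp, stp_sg]

lemma pull_ev (G : MvPolynomial (Fin 4) ℝ) (x : Fin 2 → ℝ) :
    ev (pull a b g h G) x = ((MvPolynomial.eval (pt a b g h x) G : ℝ) : ℂ) := by
  unfold pull
  induction G using MvPolynomial.induction_on with
  | C r => simp only [MvPolynomial.eval₂_C, MvPolynomial.eval_C]; exact ev_CC (r : ℂ) x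
  | add p q hp hq => rw [MvPolynomial.eval₂_add, ev_add, hp, hq, map_add]; push_cast; rfl
  | mul_X p i hp =>
    rw [MvPolynomial.eval₂_mul, MvPolynomial.eval₂_X, ev_mul, hp, stp_ev, map_mul, MvPolynomial.eval_X]
    push_cast [pt]; rfl

lemma pull_re (G : MvPolynomial (Fin 4) ℝ) (x : Fin 2 → ℝ) :
    re (pull a b g h G) x = MvPolynomial.eval (pt a b g h x) G := by
  rw [re, pull_ev, Complex.ofReal_re]

end F

lemma hom_eval {G : MvPolynomial (Fin 4) ℝ} {m : ℕ} (hG : G.IsHomogeneous m) (c : ℝ) (y : Fin 4 → ℝ) :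
    MvPolynomial.eval (fun i => c * y i) G = c ^ m * MvPolynomial.eval y G := by
  rw [MvPolynomial.eval_eq', MvPolynomial.eval_eq', Finset.mul_sum]
  refine Finset.sum_congr rfl fun s hs => ?_
  have hdeg := hG (MvPolynomial.mem_support_iff.1 hs)
  have hd : ∑ i, s i = m := by
    rw [← hdeg, Finsupp.weight_apply, Finsupp.sum_fintype] <;> simp
  simp only [mul_pow]
  rw [Finset.prod_mul_distrib, Finset.prod_pow_eq_pow_sum, hd]
  ring

lemma pull_drop (a b g h : Fin 4 → ℝ) {G : MvPolynomial (Fin 4) ℝ} {m : ℕ} (hG : G.IsHomogeneous (m + 1))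
    (h0 : MvPolynomial.eval g G = 0) :
    Cls (m + 1) (m + 1) (2 * m + 1) (pull a b g h G) := by
  have hc := pull_cls a b g h hG
  have hc' : Cls (m + 1) (m + 1) (2 * m + 1 + 1) (pull a b g h G) := hc.mono le_rfl le_rfl (by omega)
  refine cls_drop hc' fun x => ?_
  refine tendsto_nhds_unique (topF_tendsto hc' x) ?_
  have h1 : Filter.Tendsto (fun r : ℝ => ((MvPolynomial.eval
      (fun i => 2 * a i * x 0 * r⁻¹ + 2 * b i * x 1 * r⁻¹ + g i * nn x + h i * (r⁻¹) ^ 2) G : ℝ) : ℂ))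
      Filter.atTop (𝓝 ((MvPolynomial.eval (fun i => nn x * g i) G : ℝ) : ℂ)) := by
    refine (Complex.continuous_ofReal.tendsto _).comp ?_
    refine ((MvPolynomial.continuous_eval G).tendsto _).comp ?_
    rw [tendsto_pi_nhds]
    intro i
    have h2 := tendsto_inv_atTop_zero (𝕜 := ℝ)
    have h3 := ((((h2.const_mul (2 * a i * x 0)).add (h2.const_mul (2 * b i * x 1))).add_const (g i * nn x)).add
      ((h2.pow 2).const_mul (h i)))
    have h4 : 2 * a i * x 0 * 0 + 2 * b i * x 1 * 0 + g i * nn x + h i * 0 ^ 2 = nn x * g i := by ring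
    rw [h4] at h3
    exact h3
  rw [hom_eval hG, h0, mul_zero, Complex.ofReal_zero] at h1
  refine h1.congr' ?_
  filter_upwards [Filter.eventually_gt_atTop 0] with r hr
  rw [pull_ev]
  have h5 : pt a b g h (r • x) = fun i => r ^ 2 *
      (2 * a i * x 0 * r⁻¹ + 2 * b i * x 1 * r⁻¹ + g i * nn x + h i * (r⁻¹) ^ 2) := by
    funext i
    simp only [pt, nn, Pi.smul_apply, smul_eq_mul]
    field_simp
  have hr' : (r : ℂ) ≠ 0 := by exact_mod_cast hr.ne'
  rw [h5, hom_eval hG]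
  push_cast
  rw [eq_div_iff (pow_ne_zero _ hr')]
  ring

/-- Main bound for an arbitrary parametrisation. -/
theorem pull_bound (a b g h : Fin 4 → ℝ) {G : MvPolynomial (Fin 4) ℝ} {d : ℕ}
    (hG : G.IsHomogeneous (2 * (d + 1) + 1)) (h0 : MvPolynomial.eval g G = 0)
    (hfin : {x | MvPolynomial.eval (pt a b g h x) G = 0}.Finite) :
    {x | MvPolynomial.eval (pt a b g h x) G = 0}.ncard + 1 ≤ 3 * (d + 1) ^ 2 + 2 * (d + 1) := by
  set F := pull a b g h G with hF
  have hFs : sg F = F := pull_sg a b g h G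
  have hFc : Cls (2 * d + 3) (2 * d + 3) (2 * (2 * d) + 4 + 1) F :=
    (pull_drop a b g h (m := 2 * (d + 1)) hG h0).mono (by omega) (by omega) (by omega)
  have hre : ∀ x, re F x = MvPolynomial.eval (pt a b g h x) G := fun x => pull_re a b g h G x
  have key : ∀ F' : ℂ[X][Y], sg F' = F' → Cls (2 * d + 3) (2 * d + 3) (2 * (2 * d) + 4 + 1) F' →
      (∀ x, 0 ≤ re F' x) → (∀ x, re F' x = 0 ↔ MvPolynomial.eval (pt a b g h x) G = 0) →
      {x | MvPolynomial.eval (pt a b g h x) G = 0}.ncard + 1 ≤ 3 * (d + 1) ^ 2 + 2 * (d + 1) := by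
    intro F' hs hc hp hz
    have hc' := cls_drop_nonneg ⟨2 * d + 2, by ring⟩ hc hs hp
    have := core (q := 2 * d) (d := d) rfl hc' hs hfin.toFinset (fun x => by rw [hz]; simp) hp
    rw [ncard_eq_toFinset_card _ hfin]
    unfold mu at this
    nlinarith
  rcases const_sign (re_contDiff F (n := 0)).continuous (by simpa only [hre] using hfin) with hp | hp
  · exact key F hFs hFc hp fun x => by rw [hre]
  · have hneg : ∀ x, re (-F) x = - re F x := fun x => by simp [re, ev]
    refine key (-F) (by rw [map_neg, hFs]) hFc.neg (fun x => by rw [hneg]; linarith [hp x]) fun x => ?_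
    rw [hneg, hre, neg_eq_zero]

end Ell

namespace Ell
open Set

lemma perp_exists {p q r : ℝ} (h : p ^ 2 + q ^ 2 + r ^ 2 = 1) :
    ∃ a b c : ℝ, a ^ 2 + b ^ 2 + c ^ 2 = 1 ∧ a * p + b * q + c * r = 0 := by
  by_cases h0 : p ^ 2 + q ^ 2 = 0
  · have hp : p = 0 := by nlinarith [sq_nonneg p, sq_nonneg q]
    exact ⟨1, 0, 0, by norm_num, by rw [hp]; ring⟩
  · have hpos : 0 < p ^ 2 + q ^ 2 := lt_of_le_of_ne (by positivity) (Ne.symm h0)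
    have hs := Real.sq_sqrt hpos.le
    have hs0 : Real.sqrt (p ^ 2 + q ^ 2) ≠ 0 := (Real.sqrt_pos.2 hpos).ne'
    refine ⟨-q / Real.sqrt (p ^ 2 + q ^ 2), p / Real.sqrt (p ^ 2 + q ^ 2), 0, ?_, ?_⟩
    · field_simp
      rw [hs]; ring
    · field_simp
      ring

/-- An orthonormal frame with prescribed last vector. -/
lemma frame_exists {p q r : ℝ} (h : p ^ 2 + q ^ 2 + r ^ 2 = 1) :
    ∃ M : Matrix (Fin 3) (Fin 3) ℝ, M * M.transpose = 1 ∧ M.transpose * M = 1 ∧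
      M 2 0 = p ∧ M 2 1 = q ∧ M 2 2 = r := by
  obtain ⟨a, b, c, h1, h2⟩ := perp_exists h
  have hM : (!![a, b, c; q * c - r * b, r * a - p * c, p * b - q * a; p, q, r] : Matrix (Fin 3) (Fin 3) ℝ) *
      (!![a, b, c; q * c - r * b, r * a - p * c, p * b - q * a; p, q, r] : Matrix (Fin 3) (Fin 3) ℝ).transpose
      = 1 := by
    ext i j
    fin_cases i <;> fin_cases j <;> simp [Matrix.mul_apply, Fin.sum_univ_three]
    · linear_combination h1
    · ring
    · linear_combination h2
    · ring
    · linear_combination (p ^ 2 + q ^ 2 + r ^ 2) * h1 + h - (a * p + b * q + c * r) * h2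
    · ring
    · linear_combination h2
    · ring
    · linear_combination h
  exact ⟨_, hM, mul_eq_one_comm.1 hM, by simp, by simp, by simp⟩

lemma mem_sphereRZ_mk {G : MvPolynomial (Fin 4) ℝ} {m : ℕ} (hG : G.IsHomogeneous m) (v : Fin 4 → ℝ)
    (hv : v ≠ 0) : Projectivization.mk ℝ v hv ∈ sphereRZ G ↔
      v 0 ^ 2 + v 1 ^ 2 + v 2 ^ 2 = v 3 ^ 2 ∧ MvPolynomial.eval v G = 0 := by
  obtain ⟨a, ha⟩ := Projectivization.exists_smul_eq_mk_rep ℝ v hv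
  have ha0 : (a : ℝ) ≠ 0 := a.ne_zero
  have h1 : (Projectivization.mk ℝ v hv).rep = fun i => (a : ℝ) * v i := by
    rw [← ha]; rfl
  unfold sphereRZ
  rw [mem_ofPred_eq, h1, hom_eval hG]
  have h2 : ((a : ℝ) * v 0) ^ 2 + ((a : ℝ) * v 1) ^ 2 + ((a : ℝ) * v 2) ^ 2
      = (a : ℝ) ^ 2 * (v 0 ^ 2 + v 1 ^ 2 + v 2 ^ 2) := by ring
  simp only [h2]
  rw [mul_pow (a : ℝ) (v 3), mul_right_inj' (pow_ne_zero 2 ha0), mul_eq_zero, or_iff_right (pow_ne_zero m ha0)]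

/-- Every point of the sphere has a representative with last coordinate one. -/
lemma sphere_normalize {G : MvPolynomial (Fin 4) ℝ} {m : ℕ} (hG : G.IsHomogeneous m)
    {y : Projectivization ℝ (Fin 4 → ℝ)} (hy : y ∈ sphereRZ G) :
    ∃ p q r : ℝ, ∃ hv : ![p, q, r, 1] ≠ 0, p ^ 2 + q ^ 2 + r ^ 2 = 1 ∧
      MvPolynomial.eval ![p, q, r, 1] G = 0 ∧ y = Projectivization.mk ℝ ![p, q, r, 1] hv := by
  have h3 : y.rep 3 ≠ 0 := by
    intro h
    have h1 := hy.1
    rw [h] at h1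
    apply y.rep_nonzero
    ext i
    fin_cases i
    · show y.rep 0 = 0
      nlinarith [sq_nonneg (y.rep 0), sq_nonneg (y.rep 1), sq_nonneg (y.rep 2)]
    · show y.rep 1 = 0
      nlinarith [sq_nonneg (y.rep 0), sq_nonneg (y.rep 1), sq_nonneg (y.rep 2)]
    · show y.rep 2 = 0
      nlinarith [sq_nonneg (y.rep 0), sq_nonneg (y.rep 1), sq_nonneg (y.rep 2)]
    · exact h
  have hv : ![y.rep 0 / y.rep 3, y.rep 1 / y.rep 3, y.rep 2 / y.rep 3, (1 : ℝ)] ≠ 0 := by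
    intro h
    simpa using congrFun h 3
  have hy2 : y = Projectivization.mk ℝ _ hv := by
    conv_lhs => rw [← y.mk_rep]
    rw [Projectivization.mk_eq_mk_iff']
    refine ⟨y.rep 3, ?_⟩
    ext i
    fin_cases i
    · simp; field_simp
    · simp; field_simp
    · simp; field_simp
    · simp
  have h4 := hy
  rw [hy2, mem_sphereRZ_mk hG] at h4
  refine ⟨_, _, _, hv, ?_, h4.2, hy2⟩
  simpa using h4.1

lemma three_sq {a b c p q r : ℝ} (h : (a - p) ^ 2 + (b - q) ^ 2 + (c - r) ^ 2 = 0) :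
    a = p ∧ b = q ∧ c = r := by
  refine ⟨?_, ?_, ?_⟩ <;>
  nlinarith [sq_nonneg (a - p), sq_nonneg (b - q), sq_nonneg (c - r)]

set_option maxHeartbeats 1000000 in
theorem main_bound {d : ℕ} {G : MvPolynomial (Fin 4) ℝ} (hG : G.IsHomogeneous (2 * (d + 1) + 1))
    (hfin : (sphereRZ G).Finite) : (sphereRZ G).ncard ≤ 3 * (d + 1) ^ 2 + 2 * (d + 1) := by
  rcases (sphereRZ G).eq_empty_or_nonempty with he | ⟨y₀, hy₀⟩
  · rw [he]; simp
  obtain ⟨p, q, r, hv₀, hs, hz, hy₀e⟩ := sphere_normalize hG hy₀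
  obtain ⟨M, hM1, hM2, m20, m21, m22⟩ := frame_exists hs
  have o : ∀ i j, M i 0 * M j 0 + M i 1 * M j 1 + M i 2 * M j 2 = if i = j then 1 else 0 := by
    intro i j
    have := congrFun (congrFun hM1 i) j
    simpa [Matrix.mul_apply, Fin.sum_univ_three, Matrix.one_apply] using this
  have o' : ∀ i j, M 0 i * M 0 j + M 1 i * M 1 j + M 2 i * M 2 j = if i = j then 1 else 0 := by
    intro i j
    have := congrFun (congrFun hM2 i) j
    simpa [Matrix.mul_apply, Fin.sum_univ_three, Matrix.one_apply] using this
  obtain ⟨o00, o01, o02, o11, o12⟩ : _ ∧ _ ∧ _ ∧ _ ∧ _ := ⟨o 0 0, o 0 1, o 0 2, o 1 1, o 1 2⟩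
  obtain ⟨c00, c01, c02, c11, c12, c22⟩ : _ ∧ _ ∧ _ ∧ _ ∧ _ ∧ _ :=
    ⟨o' 0 0, o' 0 1, o' 0 2, o' 1 1, o' 1 2, o' 2 2⟩
  simp only [Fin.isValue, m20, m21, m22, if_true, Fin.reduceEq, if_false] at o00 o01 o02 o11 o12 c00 c01 c02 c11 c12 c22
  generalize M 0 0 = u0 at *
  generalize M 0 1 = u1 at *
  generalize M 0 2 = u2 at *
  generalize M 1 0 = v0 at *
  generalize M 1 1 = v1 at *
  generalize M 1 2 = v2 at *
  clear o o' hM1 hM2 m20 m21 m22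
  set f : (Fin 2 → ℝ) → Fin 4 → ℝ := pt ![u0, u1, u2, 0] ![v0, v1, v2, 0] ![p, q, r, 1] ![-p, -q, -r, 1] with hf
  have f0 : ∀ x, f x 0 = 2 * u0 * x 0 + 2 * v0 * x 1 + p * nn x - p := fun x => by simp [hf, pt]; ring
  have f1 : ∀ x, f x 1 = 2 * u1 * x 0 + 2 * v1 * x 1 + q * nn x - q := fun x => by simp [hf, pt]; ring
  have f2 : ∀ x, f x 2 = 2 * u2 * x 0 + 2 * v2 * x 1 + r * nn x - r := fun x => by simp [hf, pt]; ring
  have f3 : ∀ x, f x 3 = nn x + 1 := fun x => by simp [hf, pt]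
  have dP : ∀ x, p * f x 0 + q * f x 1 + r * f x 2 = nn x - 1 := by
    intro x; rw [f0, f1, f2]
    linear_combination 2 * x 0 * o02 + 2 * x 1 * o12 + (nn x - 1) * hs
  have du : ∀ x, u0 * f x 0 + u1 * f x 1 + u2 * f x 2 = 2 * x 0 := by
    intro x; rw [f0, f1, f2]
    linear_combination 2 * x 0 * o00 + 2 * x 1 * o01 + (nn x - 1) * o02
  have dv : ∀ x, v0 * f x 0 + v1 * f x 1 + v2 * f x 2 = 2 * x 1 := by
    intro x; rw [f0, f1, f2]
    linear_combination 2 * x 0 * o01 + 2 * x 1 * o11 + (nn x - 1) * o12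
  have fne : ∀ x, f x ≠ 0 := fun x h => by
    have := congrFun h 3
    rw [f3] at this
    have h2 := nn_nonneg x
    simp at this
    linarith
  have fsph : ∀ x, f x 0 ^ 2 + f x 1 ^ 2 + f x 2 ^ 2 = f x 3 ^ 2 := by
    intro x
    rw [f0, f1, f2, f3]
    have hn : nn x = x 0 ^ 2 + x 1 ^ 2 := rfl
    linear_combination 4 * x 0 ^ 2 * o00 + 4 * x 1 ^ 2 * o11 + (nn x - 1) ^ 2 * hs + 8 * x 0 * x 1 * o01
      + 4 * x 0 * (nn x - 1) * o02 + 4 * x 1 * (nn x - 1) * o12 - 4 * hn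
  set Φ : (Fin 2 → ℝ) → Projectivization ℝ (Fin 4 → ℝ) := fun x => Projectivization.mk ℝ (f x) (fne x) with hΦ
  have hinj : Function.Injective Φ := by
    intro x y hxy
    obtain ⟨a, ha⟩ := (Projectivization.mk_eq_mk_iff' ℝ _ _ _ _).1 hxy
    have g : ∀ i, a * f y i = f x i := fun i => congrFun ha i
    have e1 := g 3
    rw [f3, f3] at e1
    have e2 : a * (nn y - 1) = nn x - 1 := by
      rw [← dP, ← dP, ← g 0, ← g 1, ← g 2]; ring
    have ha1 : a = 1 := by linarith
    have e3 : 2 * x 0 = 2 * y 0 := by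
      rw [← du, ← du, ← g 0, ← g 1, ← g 2, ha1]; ring
    have e4 : 2 * x 1 = 2 * y 1 := by
      rw [← dv, ← dv, ← g 0, ← g 1, ← g 2, ha1]; ring
    ext i
    fin_cases i
    · show x 0 = y 0
      linarith
    · show x 1 = y 1
      linarith
  set Z : Set (Fin 2 → ℝ) := {x | MvPolynomial.eval (f x) G = 0} with hZ
  have hmem : ∀ x, Φ x ∈ sphereRZ G ↔ x ∈ Z := by
    intro x
    rw [hΦ, mem_sphereRZ_mk hG]
    exact ⟨fun h => h.2, fun h => ⟨fsph x, h⟩⟩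
  have hZfin : Z.Finite := by
    refine Set.Finite.of_finite_image (f := Φ) (hfin.subset ?_) hinj.injOn
    rintro _ ⟨x, hx, rfl⟩
    exact (hmem x).2 hx
  have hcover : sphereRZ G ⊆ insert y₀ (Φ '' Z) := by
    intro y hy
    obtain ⟨a, b, c, hv, hs', hz', hye⟩ := sphere_normalize hG hy
    by_cases hs1 : a * p + b * q + c * r = 1
    · left
      have h1 : (a - p) ^ 2 + (b - q) ^ 2 + (c - r) ^ 2 = 0 := by
        linear_combination hs' + hs - 2 * hs1
      have ha : a = p := (three_sq h1).1
      have hb : b = q := (three_sq h1).2.1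
      have hc : c = r := (three_sq h1).2.2
      subst ha hb hc
      rw [hye, hy₀e]
    · right
      set s := a * p + b * q + c * r with hsdef
      set α := a * u0 + b * u1 + c * u2 with hα
      set β := a * v0 + b * v1 + c * v2 with hβ
      have h1s : 1 - s ≠ 0 := fun h => hs1 (by linarith)
      have ea : α * u0 + β * v0 + s * p = a := by
        rw [hα, hβ, hsdef]; linear_combination a * c00 + b * c01 + c * c02
      have eb : α * u1 + β * v1 + s * q = b := by
        rw [hα, hβ, hsdef]; linear_combination a * c01 + b * c11 + c * c12
      have ec : α * u2 + β * v2 + s * r = c := by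
        rw [hα, hβ, hsdef]; linear_combination a * c02 + b * c12 + c * c22
      have eN : α ^ 2 + β ^ 2 + s ^ 2 = 1 := by
        rw [← hs']
        have : α ^ 2 + β ^ 2 + s ^ 2 = a * (α * u0 + β * v0 + s * p) + b * (α * u1 + β * v1 + s * q)
          + c * (α * u2 + β * v2 + s * r) := by rw [hα, hβ, hsdef]; ring
        rw [this, ea, eb, ec]; ring
      have hnx : (1 - s) * nn ![α / (1 - s), β / (1 - s)] = 1 + s := by
        simp only [nn, Matrix.cons_val_zero, Matrix.cons_val_one]
        field_simp
        linear_combination eN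
      have hyΦ : Φ ![α / (1 - s), β / (1 - s)] = y := by
        rw [hye, hΦ, Projectivization.mk_eq_mk_iff']
        refine ⟨2 / (1 - s), ?_⟩
        have hA : (1 - s) * (α / (1 - s)) = α := by field_simp
        have hB : (1 - s) * (β / (1 - s)) = β := by field_simp
        have red : ∀ t w : ℝ, 2 * t = (1 - s) * w → 2 / (1 - s) * t = w := by
          intro t w h
          rw [div_mul_eq_mul_div, div_eq_iff h1s, h]; ring
        ext i
        fin_cases i
        · show 2 / (1 - s) * a = f _ 0
          apply red; rw [f0]
          simp only [Matrix.cons_val_zero, Matrix.cons_val_one]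
          linear_combination -2 * ea - 2 * u0 * hA - 2 * v0 * hB - p * hnx
        · show 2 / (1 - s) * b = f _ 1
          apply red; rw [f1]
          simp only [Matrix.cons_val_zero, Matrix.cons_val_one]
          linear_combination -2 * eb - 2 * u1 * hA - 2 * v1 * hB - q * hnx
        · show 2 / (1 - s) * c = f _ 2
          apply red; rw [f2]
          simp only [Matrix.cons_val_zero, Matrix.cons_val_one]
          linear_combination -2 * ec - 2 * u2 * hA - 2 * v2 * hB - r * hnx
        · show 2 / (1 - s) * 1 = f _ 3
          apply red; rw [f3]
          linear_combination -hnx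
      refine ⟨_, (hmem _).1 ?_, hyΦ⟩
      rw [hyΦ]; exact hy
  have hb := pull_bound _ _ _ _ hG hz hZfin
  calc (sphereRZ G).ncard ≤ (insert y₀ (Φ '' Z)).ncard := ncard_le_ncard hcover ((hZfin.image Φ).insert y₀)
    _ ≤ (Φ '' Z).ncard + 1 := ncard_insert_le _ _
    _ ≤ Z.ncard + 1 := Nat.add_le_add_right (ncard_image_le hZfin) 1
    _ ≤ _ := hb

end Ell

section Final
open MvPolynomial

theorem stmt_10 (k : ℕ) (hk : 1 ≤ k) (G : MvPolynomial (Fin 4) ℝ) (hG : G ≠ 0)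
    (hhom : G.IsHomogeneous (2 * k + 1))
    (hsf : SquarefreeOnEllipsoid G)
    (hfin : (sphereRZ G).Finite) :
    (sphereRZ G).ncard ≤ 3 * k ^ 2 + 2 * k := by
  obtain ⟨d, rfl⟩ : ∃ d, k = d + 1 := ⟨k - 1, by omega⟩
  exact Ell.main_bound hhom hfin

end Final
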